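/- Main theorem for C_n^(1) (Theorem 3.1): Let n ≥ 2 and l, k ≥ 1. Let ι : B_l ⊗ B_k → B_k ⊗ B_l be any isomorphism of U_q'(C_n^(1)) crystals and let H be any energy function for ι. For every b_1 ⊗ b_2 ∈ B_l ⊗ B_k, let b'_2 ∈ B_k, b'_1 ∈ B_l and the integers l', k', m be produced by Rule (C). Then ι(b_1 ⊗ b_2) = b'_2 ⊗ b'_1 and H(b_1 ⊗ b_2) = min(l', k') − m. -/

import Mathlib

namespace KTT

/-- Raw data of a crystal element `(x_1,…,x_n,x̄_n,…,x̄_1)`: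
`b.1 i` is `x_{i+1}` and `b.2 i` is `x̄_{i+1}` for `i : Fin n`. -/
abbrev Tup (n : ℕ) := (Fin n → ℕ) × (Fin n → ℕ)

/-- The entry `x_j` (for `1 ≤ j ≤ n`). -/
def xc {n : ℕ} (b : Tup n) (j : ℕ) : ℕ :=
  if h : j - 1 < n then b.1 ⟨j - 1, h⟩ else 0

/-- The entry `x̄_j` (for `1 ≤ j ≤ n`). -/
def xbc {n : ℕ} (b : Tup n) (j : ℕ) : ℕ :=
  if h : j - 1 < n then b.2 ⟨j - 1, h⟩ else 0

/-- Set the entry indexed by `j` (i.e. `x_j`) to the value `v`. -/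
def setx {n : ℕ} (f : Fin n → ℕ) (j v : ℕ) : Fin n → ℕ :=
  fun t => if (t : ℕ) + 1 = j then v else f t

/-- `Σ_{i=1}^n (x_i + x̄_i)`. -/
def tsum {n : ℕ} (b : Tup n) : ℕ := ∑ i, (b.1 i + b.2 i)

/-- The element `(v,0,…,0)`. -/
def uvec (n v : ℕ) : Tup n := (fun j => if (j : ℕ) = 0 then v else 0, fun _ => 0)

/-- The element `(0,v,---,0)` (only `x_2 = v` nonzero). -/
def u2vec (n v : ℕ) : Tup n := (fun j => if (j : ℕ) = 1 then v else 0, fun _ => 0)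

/-- The element `(0,0,---,v)` (only `x̄_1 = v` nonzero). -/
def barvec (n v : ℕ) : Tup n := (fun _ => 0, fun j => if (j : ℕ) = 0 then v else 0)

/-- The element `(a,c,---,d)` with `x_1 = a`, `x_2 = c`, `x̄_1 = d`, all else `0`. -/
def tripleVec (n a c d : ℕ) : Tup n :=
  (fun j => if (j : ℕ) = 0 then a else if (j : ℕ) = 1 then c else 0,
   fun j => if (j : ℕ) = 0 then d else 0)

/-! ### The `U_q'(C_n^{(1)})` crystal `B_l` -/

/-- Membership in the `C_n^{(1)}` crystal `B_l` : the sum of the entries belongs to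
`{l, l-2, l-4, …}`. -/
def memC (n l : ℕ) (b : Tup n) : Prop := tsum b ≤ l ∧ (l - tsum b) % 2 = 0

def BC (n l : ℕ) : Set (Tup n) := {b | memC n l b}

/-- The number `x_0(b)` of `(0,0̄)` pairs. -/
def x0 (l : ℕ) {n : ℕ} (b : Tup n) : ℕ := (l - tsum b) / 2

/-- The operator `ẽ_i` on `B_l` (C case); `none` plays the role of `0`. -/
def eC (n l i : ℕ) (b : Tup n) : Option (Tup n) :=
  if i = 0 then
    if 0 < n then
      if xbc b 1 + 2 ≤ xc b 1 then some (setx b.1 1 (xc b 1 - 2), b.2)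
      else if xc b 1 = xbc b 1 + 1 then
        some (setx b.1 1 (xc b 1 - 1), setx b.2 1 (xbc b 1 + 1))
      else if tsum b + 2 ≤ l then some (b.1, setx b.2 1 (xbc b 1 + 2))
      else none
    else none
  else if i = n then
    if 0 < xbc b n then some (setx b.1 n (xc b n + 1), setx b.2 n (xbc b n - 1))
    else none
  else if i < n then
    if xbc b (i + 1) < xc b (i + 1) then
      some (setx (setx b.1 i (xc b i + 1)) (i + 1) (xc b (i + 1) - 1), b.2)
    else if 0 < xbc b i then
      some (b.1, setx (setx b.2 (i + 1) (xbc b (i + 1) + 1)) i (xbc b i - 1))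
    else none
  else none

/-- The operator `f̃_i` on `B_l` (C case). -/
def fC (n l i : ℕ) (b : Tup n) : Option (Tup n) :=
  if i = 0 then
    if 0 < n then
      if xbc b 1 ≤ xc b 1 then
        if tsum b + 2 ≤ l then some (setx b.1 1 (xc b 1 + 2), b.2) else none
      else if xc b 1 + 1 = xbc b 1 then
        some (setx b.1 1 (xc b 1 + 1), setx b.2 1 (xbc b 1 - 1))
      else some (b.1, setx b.2 1 (xbc b 1 - 2))
    else none
  else if i = n then
    if 0 < xc b n then some (setx b.1 n (xc b n - 1), setx b.2 n (xbc b n + 1))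
    else none
  else if i < n then
    if xbc b (i + 1) ≤ xc b (i + 1) then
      if 0 < xc b i then
        some (setx (setx b.1 i (xc b i - 1)) (i + 1) (xc b (i + 1) + 1), b.2)
      else none
    else some (b.1, setx (setx b.2 (i + 1) (xbc b (i + 1) - 1)) i (xbc b i + 1))
  else none

def eCIter (n l i m : ℕ) (b : Tup n) : Option (Tup n) :=
  (fun o => Option.bind o (eC n l i))^[m] (some b)

def fCIter (n l i m : ℕ) (b : Tup n) : Option (Tup n) :=
  (fun o => Option.bind o (fC n l i))^[m] (some b)

/-- `ε_i(b) = max {m | ẽ_i^m b ≠ 0}` (C case). -/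
noncomputable def epsC (n l i : ℕ) (b : Tup n) : ℕ :=
  sSup {m | eCIter n l i m b ≠ none}

/-- `φ_i(b) = max {m | f̃_i^m b ≠ 0}` (C case). -/
noncomputable def phiC (n l i : ℕ) (b : Tup n) : ℕ :=
  sSup {m | fCIter n l i m b ≠ none}

/-- `ẽ_i` on the tensor product `B_l ⊗ B_k` (C case). -/
noncomputable def eTenC (n l k i : ℕ) (u : Tup n × Tup n) : Option (Tup n × Tup n) :=
  if epsC n k i u.2 ≤ phiC n l i u.1 then (eC n l i u.1).map (fun c => (c, u.2))
  else (eC n k i u.2).map (fun c => (u.1, c))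

/-- `f̃_i` on the tensor product `B_l ⊗ B_k` (C case). -/
noncomputable def fTenC (n l k i : ℕ) (u : Tup n × Tup n) : Option (Tup n × Tup n) :=
  if epsC n k i u.2 < phiC n l i u.1 then (fC n l i u.1).map (fun c => (c, u.2))
  else (fC n k i u.2).map (fun c => (u.1, c))

/-- `ι : B_l ⊗ B_k → B_k ⊗ B_l` is an isomorphism of `U_q'(C_n^{(1)})` crystals. -/
def IsIsoC (n l k : ℕ) (ι : Tup n × Tup n → Tup n × Tup n) : Prop :=
  Set.BijOn ι (BC n l ×ˢ BC n k) (BC n k ×ˢ BC n l) ∧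
  ∀ u ∈ BC n l ×ˢ BC n k, ∀ i ≤ n,
    Option.map ι (eTenC n l k i u) = eTenC n k l i (ι u) ∧
    Option.map ι (fTenC n l k i u) = fTenC n k l i (ι u)

/-- `H` is an energy function for the isomorphism `ι` (C case), normalized by
`H((l,0,…,0) ⊗ (0,k,---,0)) = 0`. -/
def IsEnergyC (n l k : ℕ) (ι : Tup n × Tup n → Tup n × Tup n)
    (H : Tup n × Tup n → ℤ) : Prop :=
  (∀ u ∈ BC n l ×ˢ BC n k, ∀ i ≤ n, ∀ v, eTenC n l k i u = some v →
      H v = H u +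
        (if i = 0 then
          (if epsC n k 0 u.2 ≤ phiC n l 0 u.1 ∧ epsC n l 0 (ι u).2 ≤ phiC n k 0 (ι u).1
           then 1
           else if phiC n l 0 u.1 < epsC n k 0 u.2 ∧ phiC n k 0 (ι u).1 < epsC n l 0 (ι u).2
           then -1 else 0)
         else 0)) ∧
  H (uvec n l, u2vec n k) = 0

/-! ### The `U_q'(A_{2n-1}^{(2)})` crystal `B_l` -/

def memA (n l : ℕ) (b : Tup n) : Prop := tsum b = l

def BA (n l : ℕ) : Set (Tup n) := {b | memA n l b}

/-- The operator `ẽ_i` (A case). -/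
def eA (n i : ℕ) (b : Tup n) : Option (Tup n) :=
  if i = 0 then
    if 1 < n then
      if xbc b 2 < xc b 2 then some (setx b.1 2 (xc b 2 - 1), setx b.2 1 (xbc b 1 + 1))
      else if 0 < xc b 1 then some (setx b.1 1 (xc b 1 - 1), setx b.2 2 (xbc b 2 + 1))
      else none
    else none
  else if i = n then
    if 0 < xbc b n then some (setx b.1 n (xc b n + 1), setx b.2 n (xbc b n - 1))
    else none
  else if i < n then
    if xbc b (i + 1) < xc b (i + 1) then
      some (setx (setx b.1 i (xc b i + 1)) (i + 1) (xc b (i + 1) - 1), b.2)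
    else if 0 < xbc b i then
      some (b.1, setx (setx b.2 (i + 1) (xbc b (i + 1) + 1)) i (xbc b i - 1))
    else none
  else none

/-- The operator `f̃_i` (A case). -/
def fA (n i : ℕ) (b : Tup n) : Option (Tup n) :=
  if i = 0 then
    if 1 < n then
      if xbc b 2 ≤ xc b 2 then
        if 0 < xbc b 1 then some (setx b.1 2 (xc b 2 + 1), setx b.2 1 (xbc b 1 - 1))
        else none
      else some (setx b.1 1 (xc b 1 + 1), setx b.2 2 (xbc b 2 - 1))
    else none
  else if i = n then
    if 0 < xc b n then some (setx b.1 n (xc b n - 1), setx b.2 n (xbc b n + 1))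
    else none
  else if i < n then
    if xbc b (i + 1) ≤ xc b (i + 1) then
      if 0 < xc b i then
        some (setx (setx b.1 i (xc b i - 1)) (i + 1) (xc b (i + 1) + 1), b.2)
      else none
    else some (b.1, setx (setx b.2 (i + 1) (xbc b (i + 1) - 1)) i (xbc b i + 1))
  else none

def eAIter (n i m : ℕ) (b : Tup n) : Option (Tup n) :=
  (fun o => Option.bind o (eA n i))^[m] (some b)

def fAIter (n i m : ℕ) (b : Tup n) : Option (Tup n) :=
  (fun o => Option.bind o (fA n i))^[m] (some b)

noncomputable def epsA (n i : ℕ) (b : Tup n) : ℕ :=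
  sSup {m | eAIter n i m b ≠ none}

noncomputable def phiA (n i : ℕ) (b : Tup n) : ℕ :=
  sSup {m | fAIter n i m b ≠ none}

/-- `ẽ_i` on a tensor product (A case). -/
noncomputable def eTenA (n i : ℕ) (u : Tup n × Tup n) : Option (Tup n × Tup n) :=
  if epsA n i u.2 ≤ phiA n i u.1 then (eA n i u.1).map (fun c => (c, u.2))
  else (eA n i u.2).map (fun c => (u.1, c))

/-- `f̃_i` on a tensor product (A case). -/
noncomputable def fTenA (n i : ℕ) (u : Tup n × Tup n) : Option (Tup n × Tup n) :=
  if epsA n i u.2 < phiA n i u.1 then (fA n i u.1).map (fun c => (c, u.2))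
  else (fA n i u.2).map (fun c => (u.1, c))

/-- `ι : B_l ⊗ B_k → B_k ⊗ B_l` is an isomorphism of `U_q'(A_{2n-1}^{(2)})` crystals. -/
def IsIsoA (n l k : ℕ) (ι : Tup n × Tup n → Tup n × Tup n) : Prop :=
  Set.BijOn ι (BA n l ×ˢ BA n k) (BA n k ×ˢ BA n l) ∧
  ∀ u ∈ BA n l ×ˢ BA n k, ∀ i ≤ n,
    Option.map ι (eTenA n i u) = eTenA n i (ι u) ∧
    Option.map ι (fTenA n i u) = fTenA n i (ι u)

/-- `H` is an energy function for `ι` (A case), normalized by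
`H((l,0,…,0) ⊗ (0,0,---,k)) = 0`. -/
def IsEnergyA (n l k : ℕ) (ι : Tup n × Tup n → Tup n × Tup n)
    (H : Tup n × Tup n → ℤ) : Prop :=
  (∀ u ∈ BA n l ×ˢ BA n k, ∀ i ≤ n, ∀ v, eTenA n i u = some v →
      H v = H u +
        (if i = 0 then
          (if epsA n 0 u.2 ≤ phiA n 0 u.1 ∧ epsA n 0 (ι u).2 ≤ phiA n 0 (ι u).1
           then 1
           else if phiA n 0 u.1 < epsA n 0 u.2 ∧ phiA n 0 (ι u).1 < epsA n 0 (ι u).2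
           then -1 else 0)
         else 0)) ∧
  H (uvec n l, barvec n k) = 0

/-! ### Words, tableaux and column insertion

Letters are encoded as natural numbers: the unbarred letter `j` (for `0 ≤ j ≤ n`) is `j`,
and the barred letter `j̄` is `2n+1-j`; the natural order of `ℕ` is the order
`0 < 1 < ⋯ < n < n̄ < ⋯ < 1̄ < 0̄`.  A (two-row) tableau is encoded as the list of its
columns (left to right), each column being the list of its entries (top to bottom). -/

/-- The barred partner `j̄` of an unbarred letter `j`. -/
def bar (n j : ℕ) : ℕ := 2 * n + 1 - j

/-- Column insertion of a letter into a tableau with at most two rows. -/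
def insertLetter (n : ℕ) : ℕ → List (List ℕ) → List (List ℕ)
  | a, [] => [[a]]
  | a, [p] :: rest =>
      if a ≤ p then [a] :: insertLetter n p rest else [p, a] :: rest
  | a, [p, q] :: rest =>
      if p ≠ 0 ∧ p ≤ n ∧ q = bar n p ∧ p ≤ a ∧ a ≤ q then
        -- the column is a pair `(x, x̄)` with `x ≠ 0` and `x ≤ a ≤ x̄`
        [p - 1, a] :: insertLetter n (bar n (p - 1)) rest
      else if n + 1 ≤ q ∧ bar n q < p ∧ p < q ∧ a = bar n q ∧ q ≠ n + 1 then
        -- the column is `(β, x̄)` with `x < β < x̄`, `a = x` and `x ≠ n`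
        [a + 1, bar n (a + 1)] :: insertLetter n p rest
      else if a ≤ p then [a, q] :: insertLetter n p rest
      else if a ≤ q then [p, a] :: insertLetter n q rest
      else [p, q, a] :: rest
  | a, C :: rest => (C ++ [a]) :: rest

/-- Column insertion of a word `u = u_1 ⋯ u_j` into a tableau: `u_j` first, `u_1` last. -/
def insertWord (n : ℕ) (u : List ℕ) (T : List (List ℕ)) : List (List ℕ) :=
  u.foldr (fun a T => insertLetter n a T) T

/-- One step of reverse insertion: letter `g` comes back (moving leftward) into a column;
returns the restored column together with the letter passed further left. -/
def revStep (n g : ℕ) (C : List ℕ) : List ℕ × ℕ :=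
  match C with
  | [p] => ([g], p)
  | [p, q] =>
      if p ≠ 0 ∧ p ≤ n ∧ q = bar n p ∧ p ≤ g ∧ g ≤ q then
        ([g, bar n (p - 1)], p - 1)
      else if p ≤ n ∧ g = bar n p ∧ p < q ∧ q < g ∧ p ≠ n then
        ([p + 1, bar n (p + 1)], q)
      else if q ≤ g then ([p, g], q)
      else ([g, q], p)
  | _ => (C, g)

/-- Reverse insertion of a letter through a list of columns, from right to left;
returns the new columns and the letter ejected from the leftmost column. -/
def revPass (n g : ℕ) : List (List ℕ) → List (List ℕ) × ℕ
  | [] => ([], g)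
  | C :: rest =>
      let p := revPass n g rest
      let q := revStep n p.2 C
      (q.1 :: p.1, q.2)

/-- Reverse-bump the rightmost cell of the first row (the last column, a single box). -/
def rbFirst (n : ℕ) (T : List (List ℕ)) : List (List ℕ) × ℕ :=
  match T.getLast? with
  | some [a] => revPass n a T.dropLast
  | _ => (T, 0)

/-- Number of columns of height (at least) two, i.e. the length of the second row. -/
def numTwoCols (T : List (List ℕ)) : ℕ :=
  (T.filter (fun C => decide (2 ≤ C.length))).length

/-- Reverse-bump the rightmost cell of the second row. -/
def rbSecond (n : ℕ) (T : List (List ℕ)) : List (List ℕ) × ℕ :=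
  match (T.drop (numTwoCols T - 1)).head? with
  | some [a, b] =>
      let p := revPass n b (T.take (numTwoCols T - 1))
      (p.1 ++ [a] :: T.drop (numTwoCols T), p.2)
  | _ => (T, 0)

/-- Iterate a reverse-bumping step, collecting the ejected letters in order of ejection. -/
def rbIter (step : List (List ℕ) → List (List ℕ) × ℕ) :
    ℕ → List (List ℕ) → List (List ℕ) × List ℕ
  | 0, T => (T, [])
  | c + 1, T =>
      let p := step T
      let q := rbIter step c p.1
      (q.1, p.2 :: q.2)

/-- A one-row word regarded as a tableau (list of one-box columns). -/
def rowCols (w : List ℕ) : List (List ℕ) := w.map (fun a => [a])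

/-- The row word of a one-row tableau. -/
def colsWord (T : List (List ℕ)) : List ℕ := T.foldr (fun C acc => C ++ acc) []

/-- The word `1^{x_1} ⋯ n^{x_n} n̄^{x̄_n} ⋯ 1̄^{x̄_1}`. -/
def coreWord (n : ℕ) (b : Tup n) : List ℕ :=
  ((List.finRange n).map (fun i => List.replicate (b.1 i) ((i : ℕ) + 1))).foldr (· ++ ·) []
  ++ ((List.finRange n).reverse.map
      (fun i => List.replicate (b.2 i) (bar n ((i : ℕ) + 1)))).foldr (· ++ ·) []

/-- The word `𝕋(b) = 0^{x_0} 1^{x_1} ⋯ 1̄^{x̄_1} 0̄^{x_0}` of an element of the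
`C_n^{(1)}` crystal `B_l`. -/
def rowWordC (n l : ℕ) (b : Tup n) : List ℕ :=
  List.replicate (x0 l b) 0 ++ coreWord n b ++ List.replicate (x0 l b) (bar n 0)

/-- The word `𝕋(b)` with `z` pairs `(0, 0̄)` removed. -/
def hatWordC (n l z : ℕ) (b : Tup n) : List ℕ :=
  List.replicate (x0 l b - z) 0 ++ coreWord n b ++ List.replicate (x0 l b - z) (bar n 0)

/-- The word `𝒯(b) = 1^{x_1} ⋯ 1̄^{x̄_1}` of an element of the `A_{2n-1}^{(2)}` crystal. -/
def rowWordA (n : ℕ) (b : Tup n) : List ℕ := coreWord n b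



set_option linter.all false
set_option linter.unusedSimpArgs false
set_option linter.unusedVariables false
set_option linter.unnecessarySeqFocus false
set_option linter.unusedTactic false
set_option linter.unreachableTactic false

/-- A (one-index) abstract crystal. -/
structure Cry (X : Type) where
  e : X → Option X
  f : X → Option X
  ep : X → ℕ
  ph : X → ℕ
  ef : ∀ x y, e x = some y ↔ f y = some x
  e_none : ∀ x, e x = none ↔ ep x = 0
  f_none : ∀ x, f x = none ↔ ph x = 0
  e_ep : ∀ x y, e x = some y → ep x = ep y + 1 ∧ ph y = ph x + 1

/-- `e` or `f`. -/
def Cry.op {X : Type} (C : Cry X) (b : Bool) : X → Option X := if b then C.e else C.f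

def tenE {X Y : Type} (C : Cry X) (D : Cry Y) (u : X × Y) : Option (X × Y) :=
  if D.ep u.2 ≤ C.ph u.1 then (C.e u.1).map (fun c => (c, u.2))
  else (D.e u.2).map (fun c => (u.1, c))

def tenF {X Y : Type} (C : Cry X) (D : Cry Y) (u : X × Y) : Option (X × Y) :=
  if D.ep u.2 < C.ph u.1 then (C.f u.1).map (fun c => (c, u.2))
  else (D.f u.2).map (fun c => (u.1, c))

def ten {X Y : Type} (C : Cry X) (D : Cry Y) : Cry (X × Y) where
  e := tenE C D
  f := tenF C D
  ep u := C.ep u.1 + (D.ep u.2 - C.ph u.1)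
  ph u := D.ph u.2 + (C.ph u.1 - D.ep u.2)
  ef := by
    rintro ⟨x, y⟩ ⟨x', y'⟩
    have h1 := C.e_ep x x'
    have h2 := D.e_ep y y'
    have h3 := C.ef x x'
    have h4 := D.ef y y'
    simp only [tenE, tenF]
    split_ifs with a b b <;> simp only [Option.map_eq_some_iff, Prod.mk.injEq] <;> constructor <;>
      rintro ⟨c, hc, rfl, rfl⟩
    · exact ⟨_, h3.1 hc, rfl, rfl⟩
    · exact ⟨_, h3.2 hc, rfl, rfl⟩
    · have := h1 hc; omega
    · have := h2 (h4.2 hc); omega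
    · have := h2 hc; omega
    · have := h1 (h3.2 hc); omega
    · exact ⟨_, h4.1 hc, rfl, rfl⟩
    · exact ⟨_, h4.2 hc, rfl, rfl⟩
  e_none := by
    rintro ⟨x, y⟩
    simp only [tenE]
    split_ifs <;> simp only [Option.map_eq_none_iff, C.e_none, D.e_none] <;> omega
  f_none := by
    rintro ⟨x, y⟩
    simp only [tenF]
    split_ifs <;> simp only [Option.map_eq_none_iff, C.f_none, D.f_none] <;> omega
  e_ep := by
    rintro ⟨x, y⟩ ⟨x', y'⟩
    have h1 := C.e_ep x x'
    have h2 := D.e_ep y y'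
    simp only [tenE]
    split_ifs with a <;> simp only [Option.map_eq_some_iff, Prod.mk.injEq] <;>
      rintro ⟨c, hc, rfl, rfl⟩
    · have := h1 hc; omega
    · have := h2 hc; omega

section lists
variable {X : Type} (C : Cry X)

def lep : List X → ℕ
  | [] => 0
  | a :: w => C.ep a + (lep w - C.ph a)
def lph : List X → ℕ
  | [] => 0
  | a :: w => lph w + (C.ph a - lep C w)
def leE : List X → Option (List X)
  | [] => none
  | a :: w => if lep C w ≤ C.ph a then (C.e a).map (fun c => c :: w) else (leE w).map (fun c => a :: c)
def leF : List X → Option (List X)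
  | [] => none
  | a :: w => if lep C w < C.ph a then (C.f a).map (fun c => c :: w) else (leF w).map (fun c => a :: c)

lemma leE_len : ∀ (w v : List X), leE C w = some v → v.length = w.length
  | [], v, h => by simp [leE] at h
  | a :: w, v, h => by
    simp only [leE] at h
    split_ifs at h <;> simp only [Option.map_eq_some_iff] at h
    · obtain ⟨c, _, rfl⟩ := h; simp
    · obtain ⟨c, hc, rfl⟩ := h; simp [leE_len w c hc]

lemma leE_ep : ∀ (w v : List X), leE C w = some v → lep C w = lep C v + 1 ∧ lph C v = lph C w + 1
  | [], v, h => by simp [leE] at h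
  | a :: w, v, h => by
    simp only [leE] at h
    split_ifs at h <;> simp only [Option.map_eq_some_iff] at h
    · obtain ⟨c, hc, rfl⟩ := h
      have := C.e_ep _ _ hc
      simp only [lep, lph]; omega
    · obtain ⟨c, hc, rfl⟩ := h
      have := leE_ep w c hc
      simp only [lep, lph]; omega

lemma leE_none : ∀ (w : List X), leE C w = none ↔ lep C w = 0
  | [] => by simp [leE, lep]
  | a :: w => by
    simp only [leE, lep]
    split_ifs <;> simp only [Option.map_eq_none_iff, leE_none w, C.e_none] <;> omega
lemma leF_none : ∀ (w : List X), leF C w = none ↔ lph C w = 0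
  | [] => by simp [leF, lph]
  | a :: w => by
    simp only [leF, lph]
    split_ifs <;> simp only [Option.map_eq_none_iff, leF_none w, C.f_none] <;> omega

lemma leEF : ∀ (w v : List X), leE C w = some v ↔ leF C v = some w
  | [], v => by
    cases v with
    | nil => simp [leE, leF]
    | cons a v => simp only [leE, leF]; split_ifs <;> simp
  | a :: w, [] => by simp only [leE, leF]; split_ifs <;> simp
  | a :: w, b :: v => by
    have h1 := C.e_ep a b
    have h2 := leE_ep C w v
    have h3 := C.ef a b
    have h4 := leEF w v
    simp only [leE, leF]
    split_ifs with p q q <;> simp only [Option.map_eq_some_iff, List.cons.injEq] <;> constructor <;>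
      rintro ⟨c, hc, rfl, rfl⟩
    · exact ⟨_, h3.1 hc, rfl, rfl⟩
    · exact ⟨_, h3.2 hc, rfl, rfl⟩
    · have := h1 hc; omega
    · have := h2 (h4.2 hc); omega
    · have := h2 hc; omega
    · have := h1 (h3.2 hc); omega
    · exact ⟨_, h4.1 hc, rfl, rfl⟩
    · exact ⟨_, h4.2 hc, rfl, rfl⟩

def listC : Cry (List X) where
  e := leE C
  f := leF C
  ep := lep C
  ph := lph C
  ef := leEF C
  e_none := leE_none C
  f_none := leF_none C
  e_ep := leE_ep C

lemma lep_append (u v : List X) : lep C (u ++ v) = lep C u + (lep C v - lph C u) := by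
  induction u with
  | nil => simp [lep, lph]
  | cons a u ih => simp only [List.cons_append, lep, lph, ih]; omega
lemma lph_append (u v : List X) : lph C (u ++ v) = lph C v + (lph C u - lep C v) := by
  induction u with
  | nil => simp [lph]
  | cons a u ih => simp only [List.cons_append, lph, ih, lep_append]; omega
lemma leE_append (u v : List X) : leE C (u ++ v) =
    if lep C v ≤ lph C u then (leE C u).map (fun c => c ++ v) else (leE C v).map (fun c => u ++ c) := by
  induction u with
  | nil =>
    by_cases h : lep C v ≤ lph C []
    · rw [if_pos h]; simp only [List.nil_append, leE, Option.map_none]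
      rw [leE_none]; simp only [lph] at h; omega
    · rw [if_neg h]; simp
  | cons a u ih =>
    simp only [List.cons_append, leE, ih, lep_append]
    have : lph C (a :: u) = lph C u + (C.ph a - lep C u) := rfl
    split_ifs <;> first | omega | simp [Option.map_map, Function.comp_def]
lemma leF_append (u v : List X) : leF C (u ++ v) =
    if lep C v < lph C u then (leF C u).map (fun c => c ++ v) else (leF C v).map (fun c => u ++ c) := by
  induction u with
  | nil => simp [lph]
  | cons a u ih =>
    simp only [List.cons_append, leF, ih, lep_append]
    have : lph C (a :: u) = lph C u + (C.ph a - lep C u) := rfl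
    split_ifs <;> first | omega | simp [Option.map_map, Function.comp_def]

lemma leF_len (w v : List X) (h : leF C w = some v) : v.length = w.length :=
  (leE_len C v w ((leEF C v w).2 h)).symm

lemma op_len (b : Bool) (w v : List X) (h : (listC C).op b w = some v) : v.length = w.length := by
  cases b
  · exact leF_len C w v h
  · exact leE_len C w v h

lemma op_append (b : Bool) (u v w : List X) (h : (listC C).op b (u ++ v) = some w) (v' : List X)
    (h1 : lep C v = lep C v') :
    (∃ u1, (listC C).op b u = some u1 ∧ w = u1 ++ v ∧ (listC C).op b (u ++ v') = some (u1 ++ v')) ∨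
    (∃ v1, (listC C).op b v = some v1 ∧ w = u ++ v1 ∧ ∀ v1', (listC C).op b v' = some v1' →
      (listC C).op b (u ++ v') = some (u ++ v1')) := by
  cases b <;> simp only [Cry.op, listC, Bool.false_eq_true, ↓reduceIte] at h ⊢
  · rw [leF_append] at h
    rw [leF_append, ← h1]
    split_ifs at h ⊢ with hc <;> simp only [Option.map_eq_some_iff] at h ⊢
    · left; obtain ⟨c, hc, rfl⟩ := h; exact ⟨c, hc, rfl, c, hc, rfl⟩
    · right; obtain ⟨c, hc, rfl⟩ := h; exact ⟨c, hc, rfl, fun c' h => ⟨c', h, rfl⟩⟩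
  · rw [leE_append] at h
    rw [leE_append, ← h1]
    split_ifs at h ⊢ with hc <;> simp only [Option.map_eq_some_iff] at h ⊢
    · left; obtain ⟨c, hc, rfl⟩ := h; exact ⟨c, hc, rfl, c, hc, rfl⟩
    · right; obtain ⟨c, hc, rfl⟩ := h; exact ⟨c, hc, rfl, fun c' h => ⟨c', h, rfl⟩⟩

lemma op_append' (b : Bool) (u v w : List X) (h : (listC C).op b (u ++ v) = some w) (u' : List X)
    (h2 : lph C u = lph C u') :
    (∃ u1, (listC C).op b u = some u1 ∧ w = u1 ++ v ∧ ∀ u1', (listC C).op b u' = some u1' →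
      (listC C).op b (u' ++ v) = some (u1' ++ v)) ∨
    (∃ v1, (listC C).op b v = some v1 ∧ w = u ++ v1 ∧
      (listC C).op b (u' ++ v) = some (u' ++ v1)) := by
  cases b <;> simp only [Cry.op, listC, Bool.false_eq_true, ↓reduceIte] at h ⊢
  · rw [leF_append] at h
    rw [leF_append, ← h2]
    split_ifs at h ⊢ with hc <;> simp only [Option.map_eq_some_iff] at h ⊢
    · left; obtain ⟨c, hc, rfl⟩ := h; exact ⟨c, hc, rfl, fun c' h => ⟨c', h, rfl⟩⟩
    · right; obtain ⟨c, hc, rfl⟩ := h; exact ⟨c, hc, rfl, c, hc, rfl⟩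
  · rw [leE_append] at h
    rw [leE_append, ← h2]
    split_ifs at h ⊢ with hc <;> simp only [Option.map_eq_some_iff] at h ⊢
    · left; obtain ⟨c, hc, rfl⟩ := h; exact ⟨c, hc, rfl, fun c' h => ⟨c', h, rfl⟩⟩
    · right; obtain ⟨c, hc, rfl⟩ := h; exact ⟨c, hc, rfl, c, hc, rfl⟩

/-- Replacing a middle segment by one with the same `ε`, `φ`. -/
lemma seg3 (b : Bool) (L s R L1 t R1 s' : List X)
    (h : (listC C).op b (L ++ (s ++ R)) = some (L1 ++ (t ++ R1)))
    (hL : L1.length = L.length) (ht : t.length = s.length)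
    (h1 : lep C s = lep C s') (h2 : lph C s = lph C s') :
    (t = s ∧ (listC C).op b (L ++ (s' ++ R)) = some (L1 ++ (s' ++ R1))) ∨
    ((listC C).op b s = some t ∧ ∀ t', (listC C).op b s' = some t' →
      (listC C).op b (L ++ (s' ++ R)) = some (L1 ++ (t' ++ R1))) := by
  have e1 : lep C (s ++ R) = lep C (s' ++ R) := by rw [lep_append, lep_append, h1, h2]
  rcases op_append C b L (s ++ R) _ h (s' ++ R) e1 with ⟨u1, hu, hw, hh⟩ | ⟨v1, hv, hw, hh⟩
  · have := op_len C b _ _ hu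
    obtain ⟨rfl, hw'⟩ := List.append_inj hw (by omega)
    clear hw
    obtain ⟨rfl, rfl⟩ := List.append_inj hw' (by omega)
    exact Or.inl ⟨rfl, hh⟩
  · obtain ⟨rfl, rfl⟩ := List.append_inj hw (by omega)
    rcases op_append' C b s R _ hv s' h2 with ⟨u1, hu, hw, hh'⟩ | ⟨v1, hv, hw, hh'⟩
    · have := op_len C b _ _ hu
      obtain ⟨rfl, rfl⟩ := List.append_inj hw (by omega)
      exact Or.inr ⟨hu, fun t' ht' => hh _ (hh' _ ht')⟩
    · obtain ⟨rfl, rfl⟩ := List.append_inj hw (by omega)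
      exact Or.inl ⟨rfl, hh _ hh'⟩

end lists


/-- letter crystal -/
def lE (n i a : ℕ) : Bool := decide (a = i + 1 ∨ a + i = 2 * n + 1)
def lF (n i a : ℕ) : Bool := decide (a = i ∨ a + i = 2 * n)

def letC (n i : ℕ) (hi : i ≤ n) : Cry ℕ where
  e a := if lE n i a then some (a - 1) else none
  f a := if lF n i a then some (a + 1) else none
  ep a := if lE n i a then 1 else 0
  ph a := if lF n i a then 1 else 0
  ef := by
    intro x y
    simp only [lE, lF, decide_eq_true_eq]
    split_ifs <;> simp only [Option.some.injEq, reduceCtorEq, false_iff, iff_false] <;> omega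
  e_none := by intro x; split_ifs <;> simp
  f_none := by intro x; split_ifs <;> simp
  e_ep := by
    intro x y
    simp only [lE, lF, decide_eq_true_eq]
    split_ifs <;> simp <;> omega

def Dom (n p q a : ℕ) : Prop := p < q ∧ a ≤ q ∧ q ≤ 2 * n + 1 ∧ (p ≠ 0 ∨ q ≠ 2 * n + 1)

def c1 (n p q a : ℕ) : Prop := p ≠ 0 ∧ p ≤ n ∧ q = bar n p ∧ p ≤ a ∧ a ≤ q
def c2 (n p q a : ℕ) : Prop := n + 1 ≤ q ∧ bar n q < p ∧ p < q ∧ a = bar n q ∧ q ≠ n + 1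
instance (n p q a : ℕ) : Decidable (c1 n p q a) := by unfold c1; infer_instance
instance (n p q a : ℕ) : Decidable (c2 n p q a) := by unfold c2; infer_instance

def psi (n p q a : ℕ) : ℕ × ℕ × ℕ :=
  if c1 n p q a then (bar n (p - 1), p - 1, a)
  else if c2 n p q a then (p, a + 1, bar n (a + 1))
  else if a ≤ p then (p, a, q)
  else (q, p, a)

lemma psi_cases (n p q a : ℕ) (h : Dom n p q a) (P : ℕ → ℕ → ℕ → Prop)
    (h1 : 1 ≤ p → p ≤ n → q + p = 2 * n + 1 → p ≤ a → a ≤ q → P (2 * n + 2 - p) (p - 1) a)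
    (h2 : n + 2 ≤ q → q ≤ 2 * n + 1 → 2 * n + 1 < p + q → p < q → a + q = 2 * n + 1 → P p (a + 1) (2 * n - a))
    (h3 : ¬ c1 n p q a → ¬ c2 n p q a → a ≤ p → P p a q)
    (h4 : ¬ c1 n p q a → ¬ c2 n p q a → p < a → P q p a) :
    P (psi n p q a).1 (psi n p q a).2.1 (psi n p q a).2.2 := by
  unfold psi
  obtain ⟨d1, d2, d3, d4⟩ := h
  split_ifs with k1 k2 k3
  · obtain ⟨x1, x2, x3, x4, x5⟩ := k1
    have := h1 (by omega) x2 (by unfold bar at x3; omega) x4 x5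
    convert this using 1; unfold bar; omega
  · obtain ⟨x1, x2, x3, x4, x5⟩ := k2
    unfold bar at x2 x4
    have := h2 (by omega) (by omega) (by omega) x3 (by omega)
    convert this using 1; simp only [bar]; omega
  · exact h3 k1 k2 k3
  · exact h4 k1 k2 (by omega)

lemma psi_inv (n p q a : ℕ) (h : Dom n p q a) : 
    (psi n p q a).2.1 < (psi n p q a).2.2 ∧ (psi n p q a).2.2 ≤ 2 * n + 1 ∧ (psi n p q a).1 ≤ 2 * n + 1
     ∧ ((psi n p q a).2.1 ≠ 0 ∨ (psi n p q a).2.2 ≠ 2 * n + 1) ∧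
    revStep n (psi n p q a).1 [(psi n p q a).2.1, (psi n p q a).2.2] = ([p, q], a) := by
  refine psi_cases n p q a h (fun r p' q' => p' < q' ∧ q' ≤ 2 * n + 1 ∧ r ≤ 2 * n + 1 ∧ (p' ≠ 0 ∨ q' ≠ 2 * n + 1) ∧ revStep n r [p', q'] = ([p, q], a)) ?_ ?_ ?_ ?_ <;>
  intros <;> (try simp only [c1, c2, bar] at *) <;> simp only [Dom] at h <;>
  (refine ⟨by omega, by omega, by omega, by omega, ?_⟩; simp only [revStep]; split_ifs <;> (try simp only [bar] at *) <;> first | (exfalso; omega) | (simp only [Prod.mk.injEq, List.cons.injEq, and_true, true_and]; omega))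

def w3 (t : ℕ × ℕ × ℕ) : List ℕ := [t.1, t.2.1, t.2.2]

def vE (n i x : ℕ) : ℕ := if lE n i x then 1 else 0
def vF (n i x : ℕ) : ℕ := if lF n i x then 1 else 0

lemma v_cases (n i x : ℕ) (hi : i ≤ n) : ((x = i ∨ x + i = 2 * n) ∧ vE n i x = 0 ∧ vF n i x = 1) ∨
   ((x = i + 1 ∨ x + i = 2 * n + 1) ∧ vE n i x = 1 ∧ vF n i x = 0) ∨
   ((x ≠ i ∧ x + i ≠ 2 * n ∧ x ≠ i + 1 ∧ x + i ≠ 2 * n + 1) ∧ vE n i x = 0 ∧ vF n i x = 0) := by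
  unfold vE vF lE lF
  simp only [decide_eq_true_eq]
  split_ifs <;> omega

set_option maxHeartbeats 1000000 in
lemma loc3_eps (n i p q a : ℕ) (hi : i ≤ n) (h : Dom n p q a) :
    lep (letC n i hi) [p, q, a] = lep (letC n i hi) (w3 (psi n p q a)) ∧
    lph (letC n i hi) [p, q, a] = lph (letC n i hi) (w3 (psi n p q a)) := by
  have E (x : ℕ) : (letC n i hi).ep x = vE n i x := rfl
  have F (x : ℕ) : (letC n i hi).ph x = vF n i x := rfl
  refine psi_cases n p q a h (fun r p' q' => lep (letC n i hi) [p, q, a] = lep (letC n i hi) [r, p', q'] ∧ lph (letC n i hi) [p, q, a] = lph (letC n i hi) [r, p', q']) ?_ ?_ ?_ ?_ <;>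
  intros <;> (try simp only [c1, c2, bar] at *) <;> simp only [Dom] at h <;>
  simp only [lep, lph, E, F] <;> clear E F
  · rcases v_cases n i p hi with ⟨h1, e1, f1⟩ | ⟨h1, e1, f1⟩ | ⟨h1, e1, f1⟩ <;>
    rcases v_cases n i q hi with ⟨h2, e2, f2⟩ | ⟨h2, e2, f2⟩ | ⟨h2, e2, f2⟩ <;> 
    simp only [e1, f1, e2, f2] <;> try (exfalso; clear e1 f1 e2 f2; omega)
    all_goals
      rcases v_cases n i (p-1) hi with ⟨h4, e4, f4⟩ | ⟨h4, e4, f4⟩ | ⟨h4, e4, f4⟩ <;> 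
      rcases v_cases n i (2 * n + 2 - p) hi with ⟨h5, e5, f5⟩ | ⟨h5, e5, f5⟩ | ⟨h5, e5, f5⟩ <;> 
      simp only [e4, f4, e5, f5] <;> first | done | (exfalso; clear e1 f1 e2 f2 e4 f4 e5 f5; omega) | skip
      all_goals 
      rcases v_cases n i a hi with ⟨h3, e3, f3⟩ | ⟨h3, e3, f3⟩ | ⟨h3, e3, f3⟩ <;> simp [e3, f3]
  · rcases v_cases n i a hi with ⟨h1, e1, f1⟩ | ⟨h1, e1, f1⟩ | ⟨h1, e1, f1⟩ <;>
    rcases v_cases n i q hi with ⟨h2, e2, f2⟩ | ⟨h2, e2, f2⟩ | ⟨h2, e2, f2⟩ <;> 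
    simp only [e1, f1, e2, f2] <;> try (exfalso; clear e1 f1 e2 f2; omega)
    all_goals
      rcases v_cases n i (a+1) hi with ⟨h4, e4, f4⟩ | ⟨h4, e4, f4⟩ | ⟨h4, e4, f4⟩ <;> 
      rcases v_cases n i (2 * n - a) hi with ⟨h5, e5, f5⟩ | ⟨h5, e5, f5⟩ | ⟨h5, e5, f5⟩ <;> 
      simp only [e4, f4, e5, f5] <;> first | done | (exfalso; clear e1 f1 e2 f2 e4 f4 e5 f5; omega) | skip
      all_goals 
      rcases v_cases n i p hi with ⟨h3, e3, f3⟩ | ⟨h3, e3, f3⟩ | ⟨h3, e3, f3⟩ <;> simp [e3, f3]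
  · rcases v_cases n i p hi with ⟨h1, e1, f1⟩ | ⟨h1, e1, f1⟩ | ⟨h1, e1, f1⟩ <;>
    rcases v_cases n i q hi with ⟨h2, e2, f2⟩ | ⟨h2, e2, f2⟩ | ⟨h2, e2, f2⟩ <;> 
    rcases v_cases n i a hi with ⟨h3, e3, f3⟩ | ⟨h3, e3, f3⟩ | ⟨h3, e3, f3⟩ <;> 
    simp [e1, f1, e2, f2, e3, f3] <;> (exfalso; clear e1 f1 e2 f2 e3 f3; omega)
  · rcases v_cases n i p hi with ⟨h1, e1, f1⟩ | ⟨h1, e1, f1⟩ | ⟨h1, e1, f1⟩ <;>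
    rcases v_cases n i q hi with ⟨h2, e2, f2⟩ | ⟨h2, e2, f2⟩ | ⟨h2, e2, f2⟩ <;> 
    rcases v_cases n i a hi with ⟨h3, e3, f3⟩ | ⟨h3, e3, f3⟩ | ⟨h3, e3, f3⟩ <;> 
    simp [e1, f1, e2, f2, e3, f3] <;> (exfalso; clear e1 f1 e2 f2 e3 f3; omega)

lemma leE3 (n i p q a : ℕ) (hi : i ≤ n) (t : List ℕ) (h : leE (letC n i hi) [p, q, a] = some t) :
   (vE n i q + (vE n i a - vF n i q) ≤ vF n i p ∧ vE n i p = 1 ∧ t = [p - 1, q, a]) ∨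
   (vF n i p < vE n i q + (vE n i a - vF n i q) ∧ vE n i a ≤ vF n i q ∧ vE n i q = 1 ∧ t = [p, q - 1, a]) ∨
   (vF n i p < vE n i q + (vE n i a - vF n i q) ∧ vF n i q < vE n i a ∧ vE n i a = 1 ∧ t = [p, q, a - 1]) := by
  have E (x : ℕ) : (letC n i hi).ep x = vE n i x := rfl
  have F (x : ℕ) : (letC n i hi).ph x = vF n i x := rfl
  have G (x : ℕ) : (letC n i hi).e x = if vE n i x = 1 then some (x - 1) else none := by
    simp [letC, vE]
  simp only [leE, lep, E, F, G] at h
  split_ifs at h <;> simp only [Option.map_some, Option.map_none, reduceCtorEq, Option.some.injEq] at h <;> subst h <;> simp <;> omega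

lemma leF3 (n i p q a : ℕ) (hi : i ≤ n) (t : List ℕ) : leF (letC n i hi) [p, q, a] = some t ↔
   (vE n i q + (vE n i a - vF n i q) < vF n i p ∧ vF n i p = 1 ∧ t = [p + 1, q, a]) ∨
   (vF n i p ≤ vE n i q + (vE n i a - vF n i q) ∧ vE n i a < vF n i q ∧ vF n i q = 1 ∧ t = [p, q + 1, a]) ∨
   (vF n i p ≤ vE n i q + (vE n i a - vF n i q) ∧ vF n i q ≤ vE n i a ∧ vF n i a = 1 ∧ t = [p, q, a + 1]) := by
  have E (x : ℕ) : (letC n i hi).ep x = vE n i x := rfl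
  have F (x : ℕ) : (letC n i hi).ph x = vF n i x := rfl
  have G (x : ℕ) : (letC n i hi).f x = if vF n i x = 1 then some (x + 1) else none := by
    simp [letC, vF]
  have V (x : ℕ) : vF n i x = 0 ∨ vF n i x = 1 := by have := v_cases n i x hi; omega
  have h1 := V p; have h2 := V q; have h3 := V a
  simp only [leF, lep, E, F, G]
  generalize vE n i q = eq at *
  generalize vE n i a = ea at *
  rcases h1 with h1 | h1 <;> rcases h2 with h2 | h2 <;> rcases h3 with h3 | h3 <;>
    simp only [h1, h2, h3] <;> simp <;> rcases eq with _ | _ | eq <;> rcases ea with _ | _ | ea <;> simp [eq_comm] <;> (try (intros; omega))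

lemma dom_e (n i p q a : ℕ) (hi : i ≤ n) (h : Dom n p q a) (t : List ℕ)
    (ht : leE (letC n i hi) [p, q, a] = some t) : ∃ p1 q1 a1, t = [p1, q1, a1] ∧ Dom n p1 q1 a1 := by
  have h1 := v_cases n i p hi
  have h2 := v_cases n i q hi
  have h3 := v_cases n i a hi
  simp only [Dom] at h
  rcases leE3 n i p q a hi t ht with ⟨k1, k2, rfl⟩ | ⟨k1, k2, k3, rfl⟩ | ⟨k1, k2, k3, rfl⟩ <;>
  refine ⟨_, _, _, rfl, ?_⟩ <;> simp only [Dom] <;> omega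


lemma psi_eq (n p q a r p' q' : ℕ) (h : a ≤ q)
   (hh : if c1 n p q a then (r = 2 * n + 1 - (p - 1) ∧ p' = p - 1 ∧ q' = a) else
     if c2 n p q a then (r = p ∧ p' = a + 1 ∧ q' = 2 * n + 1 - (a + 1)) else
     if a ≤ p then r = p ∧ p' = a ∧ q' = q else r = q ∧ p' = p ∧ q' = a) : w3 (psi n p q a) = [r, p', q'] := by
  unfold psi w3
  split_ifs at * <;> obtain ⟨rfl, rfl, rfl⟩ := hh <;> simp [bar]

lemma leF3' (n i p q a : ℕ) (hi : i ≤ n) (p' q' a' : ℕ) : leF (letC n i hi) [p, q, a] = some [p', q', a'] ↔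
   (vE n i q + (vE n i a - vF n i q) < vF n i p ∧ vF n i p = 1 ∧ p' = p + 1 ∧ q' = q ∧ a' = a) ∨
   (vF n i p ≤ vE n i q + (vE n i a - vF n i q) ∧ vE n i a < vF n i q ∧ vF n i q = 1 ∧ p' = p ∧ q' = q + 1 ∧ a' = a) ∨
   (vF n i p ≤ vE n i q + (vE n i a - vF n i q) ∧ vF n i q ≤ vE n i a ∧ vF n i a = 1 ∧ p' = p ∧ q' = q ∧ a' = a + 1) := by
  rw [leF3]; simp

set_option maxHeartbeats 2000000 in
lemma loc3_f (n i p q a : ℕ) (hi : i ≤ n) (h : Dom n p q a) (t : List ℕ)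
    (ht : leF (letC n i hi) [p, q, a] = some t) : ∃ p1 q1 a1, t = [p1, q1, a1] ∧ Dom n p1 q1 a1 ∧
      leF (letC n i hi) (w3 (psi n p q a)) = some (w3 (psi n p1 q1 a1)) := by
  have ht' := (leF3 n i p q a hi t).1 ht
  refine psi_cases n p q a h (fun r p' q' => ∃ p1 q1 a1, t = [p1, q1, a1] ∧ Dom n p1 q1 a1 ∧
      leF (letC n i hi) [r, p', q'] = some (w3 (psi n p1 q1 a1))) ?_ ?_ ?_ ?_ <;>
  intros <;> simp only [Dom] at h 
  · rcases v_cases n i (p) hi with ⟨h1, e1, f1⟩ | ⟨h1, e1, f1⟩ | ⟨h1, e1, f1⟩ <;>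
    rcases v_cases n i (q) hi with ⟨h2, e2, f2⟩ | ⟨h2, e2, f2⟩ | ⟨h2, e2, f2⟩ <;> (try (exfalso; clear e1 f1 e2 f2; omega))
    all_goals
      rcases v_cases n i (p - 1) hi with ⟨h4, e4, f4⟩ | ⟨h4, e4, f4⟩ | ⟨h4, e4, f4⟩ <;> (try (exfalso; clear e1 f1 e2 f2 e4 f4; omega))
      all_goals
        rcases v_cases n i (2 * n + 2 - p) hi with ⟨h5, e5, f5⟩ | ⟨h5, e5, f5⟩ | ⟨h5, e5, f5⟩ <;> (try (exfalso; clear e1 f1 e2 f2 e4 f4 e5 f5; omega))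
        all_goals
          rcases v_cases n i (a) hi with ⟨h3, e3, f3⟩ | ⟨h3, e3, f3⟩ | ⟨h3, e3, f3⟩ <;>
          simp [e1, f1, e2, f2, e3, f3] at ht' <;> subst ht' <;> refine ⟨_, _, _, rfl, ?_⟩ <;>
          clear ht <;>
          have L := leF3 n i (2 * n + 2 - p) (p - 1) (a) hi <;>
          simp only [e1, f1, e2, f2, e3, f3, e4, f4, e5, f5] at L <;> simp at L <;> (try rw [L]) <;>
          clear L e1 f1 e2 f2 e3 f3 e4 f4 e5 f5 <;>
          simp only [c1, c2, bar, Dom] at * <;>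
          first
          | (exfalso; omega)
          | (refine ⟨by omega, ?_⟩; apply psi_eq
             · omega
             · split_ifs <;> (try simp only [c1, c2, bar, and_true, true_and] at *) <;> omega)
  · rcases v_cases n i (a) hi with ⟨h1, e1, f1⟩ | ⟨h1, e1, f1⟩ | ⟨h1, e1, f1⟩ <;>
    rcases v_cases n i (q) hi with ⟨h2, e2, f2⟩ | ⟨h2, e2, f2⟩ | ⟨h2, e2, f2⟩ <;> (try (exfalso; clear e1 f1 e2 f2; omega))
    all_goals
      rcases v_cases n i (a + 1) hi with ⟨h4, e4, f4⟩ | ⟨h4, e4, f4⟩ | ⟨h4, e4, f4⟩ <;> (try (exfalso; clear e1 f1 e2 f2 e4 f4; omega))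
      all_goals
        rcases v_cases n i (2 * n - a) hi with ⟨h5, e5, f5⟩ | ⟨h5, e5, f5⟩ | ⟨h5, e5, f5⟩ <;> (try (exfalso; clear e1 f1 e2 f2 e4 f4 e5 f5; omega))
        all_goals
          rcases v_cases n i (p) hi with ⟨h3, e3, f3⟩ | ⟨h3, e3, f3⟩ | ⟨h3, e3, f3⟩ <;>
          simp [e1, f1, e2, f2, e3, f3] at ht' <;> subst ht' <;> refine ⟨_, _, _, rfl, ?_⟩ <;>
          clear ht <;>
          have L := leF3 n i (p) (a + 1) (2 * n - a) hi <;>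
          simp only [e1, f1, e2, f2, e3, f3, e4, f4, e5, f5] at L <;> simp at L <;> (try rw [L]) <;>
          clear L e1 f1 e2 f2 e3 f3 e4 f4 e5 f5 <;>
          simp only [c1, c2, bar, Dom] at * <;>
          first
          | (exfalso; omega)
          | (refine ⟨by omega, ?_⟩; apply psi_eq
             · omega
             · split_ifs <;> (try simp only [c1, c2, bar, and_true, true_and] at *) <;> omega)
  · rcases v_cases n i (p) hi with ⟨h1, e1, f1⟩ | ⟨h1, e1, f1⟩ | ⟨h1, e1, f1⟩ <;>
    rcases v_cases n i (q) hi with ⟨h2, e2, f2⟩ | ⟨h2, e2, f2⟩ | ⟨h2, e2, f2⟩ <;>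
    rcases v_cases n i (a) hi with ⟨h3, e3, f3⟩ | ⟨h3, e3, f3⟩ | ⟨h3, e3, f3⟩ <;>
    simp [e1, f1, e2, f2, e3, f3] at ht' <;> subst ht' <;> refine ⟨_, _, _, rfl, ?_⟩ <;>
    clear ht <;>
    have L := leF3 n i p a q hi <;>
    simp only [e1, f1, e2, f2, e3, f3] at L <;> simp at L <;> (try rw [L]) <;>
    clear L e1 f1 e2 f2 e3 f3 <;>
    simp only [c1, c2, bar, Dom] at * <;>
    first
    | (exfalso; omega)
    | (refine ⟨by omega, ?_⟩; apply psi_eq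
       · omega
       · split_ifs <;> (try simp only [c1, c2, bar, and_true, true_and] at *) <;> omega)
  · rcases v_cases n i (p) hi with ⟨h1, e1, f1⟩ | ⟨h1, e1, f1⟩ | ⟨h1, e1, f1⟩ <;>
    rcases v_cases n i (q) hi with ⟨h2, e2, f2⟩ | ⟨h2, e2, f2⟩ | ⟨h2, e2, f2⟩ <;>
    rcases v_cases n i (a) hi with ⟨h3, e3, f3⟩ | ⟨h3, e3, f3⟩ | ⟨h3, e3, f3⟩ <;>
    simp [e1, f1, e2, f2, e3, f3] at ht' <;> subst ht' <;> refine ⟨_, _, _, rfl, ?_⟩ <;>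
    clear ht <;>
    have L := leF3 n i q p a hi <;>
    simp only [e1, f1, e2, f2, e3, f3] at L <;> simp at L <;> (try rw [L]) <;>
    clear L e1 f1 e2 f2 e3 f3 <;>
    simp only [c1, c2, bar, Dom] at * <;>
    first
    | (exfalso; omega)
    | (refine ⟨by omega, ?_⟩; apply psi_eq
       · omega
       · split_ifs <;> (try simp only [c1, c2, bar, and_true, true_and] at *) <;> omega)


lemma loc3 (n i p q a : ℕ) (hi : i ≤ n) (b : Bool) (h : Dom n p q a) (t : List ℕ)
    (ht : (listC (letC n i hi)).op b [p, q, a] = some t) : ∃ p1 q1 a1, t = [p1, q1, a1] ∧ Dom n p1 q1 a1 ∧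
      (listC (letC n i hi)).op b (w3 (psi n p q a)) = some (w3 (psi n p1 q1 a1)) := by
  cases b
  · exact loc3_f n i p q a hi h t ht
  · change leE _ _ = _ at ht
    obtain ⟨p1, q1, a1, rfl, h1⟩ := dom_e n i p q a hi h t ht
    refine ⟨p1, q1, a1, rfl, h1, ?_⟩
    change leE _ _ = _
    rw [leEF] at ht ⊢
    obtain ⟨p2, q2, a2, h2, -, h3⟩ := loc3_f n i p1 q1 a1 hi h1 _ ht
    simp only [List.cons.injEq, and_true] at h2
    obtain ⟨rfl, rfl, rfl⟩ := h2
    exact h3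

lemma op_none {X : Type} (C : Cry X) (b : Bool) (x y : X) (h1 : C.ep x = C.ep y) (h2 : C.ph x = C.ph y)
    (h : C.op b x = none) : C.op b y = none := by
  cases b
  · change C.f x = none at h; change C.f y = none; rw [C.f_none] at *; omega
  · change C.e x = none at h; change C.e y = none; rw [C.e_none] at *; omega

lemma loc3' (n i p q a : ℕ) (hi : i ≤ n) (b : Bool) (h : Dom n p q a) (t : List ℕ)
    (ht : (listC (letC n i hi)).op b (w3 (psi n p q a)) = some t) : ∃ p1 q1 a1, t = w3 (psi n p1 q1 a1) ∧ Dom n p1 q1 a1 ∧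
      (listC (letC n i hi)).op b [p, q, a] = some [p1, q1, a1] := by
  have h0 := loc3_eps n i p q a hi h
  rcases hh : (listC (letC n i hi)).op b [p, q, a] with _ | s
  · have := op_none (listC (letC n i hi)) b [p, q, a] (w3 (psi n p q a)) h0.1 h0.2 hh
    rw [this] at ht; simp at ht
  · obtain ⟨p1, q1, a1, rfl, h2, h3⟩ := loc3 n i p q a hi b h s hh
    rw [h3] at ht
    exact ⟨p1, q1, a1, (Option.some.inj ht).symm, h2, rfl⟩

lemma loc2 (n i p a p1 a1 : ℕ) (hi : i ≤ n) (b : Bool)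
    (ht : (listC (letC n i hi)).op b [p, a] = some [p1, a1]) :
    (a ≤ p → a1 ≤ p1) ∧ (p < a ∧ a ≤ 2 * n + 1 ∧ (p ≠ 0 ∨ a ≠ 2 * n + 1) →
      p1 < a1 ∧ a1 ≤ 2 * n + 1 ∧ (p1 ≠ 0 ∨ a1 ≠ 2 * n + 1)) := by
  have E (x : ℕ) : (letC n i hi).ep x = vE n i x := rfl
  have F (x : ℕ) : (letC n i hi).ph x = vF n i x := rfl
  have G (x : ℕ) : (letC n i hi).f x = if vF n i x = 1 then some (x + 1) else none := by
    simp [letC, vF]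
  have G' (x : ℕ) : (letC n i hi).e x = if vE n i x = 1 then some (x - 1) else none := by
    simp [letC, vE]
  have h1 := v_cases n i p hi
  have h2 := v_cases n i a hi
  cases b
  · change leF _ _ = _ at ht
    simp only [leF, lep, E, F, G] at ht
    split_ifs at ht <;> simp at ht <;> omega
  · change leE _ _ = _ at ht
    simp only [leE, lep, E, F, G'] at ht
    split_ifs at ht <;> simp at ht <;> omega

/-- reading word -/
def rd : List (List ℕ) → List ℕ
  | [] => []
  | C :: rest => rd rest ++ C

lemma rd_append (A B : List (List ℕ)) : rd (A ++ B) = rd B ++ rd A := by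
  induction A with
  | nil => simp [rd]
  | cons C A ih => simp [rd, ih]

def shp (T : List (List ℕ)) : List ℕ := T.map List.length

lemma rd_len (T T1 : List (List ℕ)) (h : shp T1 = shp T) : (rd T1).length = (rd T).length := by
  have : ∀ T, (rd T).length = (shp T).sum := by
    intro T
    induction T with
    | nil => simp [rd, shp]
    | cons C T ih => simp only [rd, List.length_append, ih, shp, List.map_cons, List.sum_cons]; omega
  rw [this, this, h]

lemma shp_cons (C : List ℕ) (T T1 : List (List ℕ)) (h : shp T1 = shp (C :: T)) :
    ∃ C1 T2, T1 = C1 :: T2 ∧ C1.length = C.length ∧ shp T2 = shp T := by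
  cases T1 with
  | nil => simp [shp] at h
  | cons C1 T2 => simp only [shp, List.map_cons, List.cons.injEq] at h; exact ⟨C1, T2, rfl, h.1, h.2⟩

def Good (n : ℕ) : ℕ → List (List ℕ) → Prop
  | _, [] => True
  | a, [p] :: rest => (a ≤ p ∧ Good n p rest) ∨ (p < a ∧ a ≤ 2 * n + 1 ∧ (p ≠ 0 ∨ a ≠ 2 * n + 1))
  | a, [p, q] :: rest => Dom n p q a ∧ Good n (psi n p q a).1 rest
  | _, _ => False

lemma ins2 (n p q a : ℕ) (rest : List (List ℕ)) (h : Dom n p q a) :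
    insertLetter n a ([p, q] :: rest) = [(psi n p q a).2.1, (psi n p q a).2.2] :: insertLetter n (psi n p q a).1 rest := by
  have h3 := h.2.1
  by_cases k1 : c1 n p q a
  · simp only [psi, if_pos k1]
    simp only [insertLetter, if_pos (show p ≠ 0 ∧ p ≤ n ∧ q = bar n p ∧ p ≤ a ∧ a ≤ q from k1)]
  · have k1' : ¬ (p ≠ 0 ∧ p ≤ n ∧ q = bar n p ∧ p ≤ a ∧ a ≤ q) := k1
    by_cases k2 : c2 n p q a
    · simp only [psi, if_neg k1, if_pos k2]
      simp only [insertLetter, if_neg k1', if_pos (show n + 1 ≤ q ∧ bar n q < p ∧ p < q ∧ a = bar n q ∧ q ≠ n + 1 from k2)]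
    · have k2' : ¬ (n + 1 ≤ q ∧ bar n q < p ∧ p < q ∧ a = bar n q ∧ q ≠ n + 1) := k2
      simp only [psi, if_neg k1, if_neg k2]
      simp only [insertLetter, if_neg k1', if_neg k2']
      by_cases k3 : a ≤ p
      · simp only [if_pos k3]
      · simp only [if_neg k3, if_pos h3]
lemma ins1 (n p a : ℕ) (rest : List (List ℕ)) :
    insertLetter n a ([p] :: rest) = if a ≤ p then [a] :: insertLetter n p rest else [p, a] :: rest := by
  simp only [insertLetter]

section par
variable (n i : ℕ) (hi : i ≤ n) (b : Bool)

lemma ins_par : ∀ (T T1 : List (List ℕ)) (a a1 : ℕ) (R R1 : List ℕ), Good n a T → shp T1 = shp T →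
    (listC (letC n i hi)).op b (rd T ++ (a :: R)) = some (rd T1 ++ (a1 :: R1)) →
    Good n a1 T1 ∧ shp (insertLetter n a1 T1) = shp (insertLetter n a T) ∧
    (listC (letC n i hi)).op b (rd (insertLetter n a T) ++ R) = some (rd (insertLetter n a1 T1) ++ R1)
  | [], T1, a, a1, R, R1, _, hs, h => by
    have : T1 = [] := by cases T1 <;> simp [shp] at hs ⊢
    subst this
    exact ⟨trivial, rfl, h⟩
  | [p] :: rest, T1, a, a1, R, R1, hg, hs, h => by
    obtain ⟨C1, rest1, rfl, hC, hs'⟩ := shp_cons _ _ _ hs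
    obtain ⟨p1, rfl⟩ := List.length_eq_one_iff.1 hC
    have hl := rd_len _ _ hs'
    have key : (a ≤ p → a1 ≤ p1) ∧ (p < a ∧ a ≤ 2 * n + 1 ∧ (p ≠ 0 ∨ a ≠ 2 * n + 1) →
      p1 < a1 ∧ a1 ≤ 2 * n + 1 ∧ (p1 ≠ 0 ∨ a1 ≠ 2 * n + 1)) := by
      have := seg3 (letC n i hi) b (rd rest) [p, a] R (rd rest1) [p1, a1] R1 [p, a]
        (by simpa [rd] using h) hl rfl rfl rfl
      rcases this with ⟨h1, -⟩ | ⟨h1, -⟩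
      · simp only [List.cons.injEq, and_true] at h1
        obtain ⟨rfl, rfl⟩ := h1
        exact ⟨id, id⟩
      · exact loc2 n i p a p1 a1 hi b h1
    rw [ins1, ins1]
    rcases hg with ⟨h1, h2⟩ | h1
    · have := ins_par rest rest1 p p1 (a :: R) (a1 :: R1) h2 hs' (by simpa [rd] using h)
      rw [if_pos h1, if_pos (key.1 h1)]
      refine ⟨Or.inl ⟨key.1 h1, this.1⟩, ?_, ?_⟩
      · simp only [shp, List.map_cons] at this ⊢; rw [this.2.1]; simp
      · simpa [rd] using this.2.2
    · have k2 := key.2 h1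
      rw [if_neg (by omega), if_neg (by omega)]
      refine ⟨Or.inr k2, ?_, ?_⟩
      · simp only [shp, List.map_cons] at hs' ⊢; rw [hs']; simp
      · simpa [rd] using h
  | [p, q] :: rest, T1, a, a1, R, R1, hg, hs, h => by
    obtain ⟨C1, rest1, rfl, hC, hs'⟩ := shp_cons _ _ _ hs
    obtain ⟨p1, q1, rfl⟩ := List.length_eq_two.1 hC
    have hl := rd_len _ _ hs'
    obtain ⟨hd, hg⟩ := hg
    have h0 := loc3_eps n i p q a hi hd
    have key : Dom n p1 q1 a1 ∧ (listC (letC n i hi)).op b (rd rest ++ (w3 (psi n p q a) ++ R))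
       = some (rd rest1 ++ (w3 (psi n p1 q1 a1) ++ R1)) := by
      have := seg3 (letC n i hi) b (rd rest) [p, q, a] R (rd rest1) [p1, q1, a1] R1 (w3 (psi n p q a))
        (by simpa [rd] using h) hl rfl h0.1 h0.2
      rcases this with ⟨h1, h2⟩ | ⟨h1, h2⟩
      · simp only [List.cons.injEq, and_true] at h1
        obtain ⟨rfl, rfl, rfl⟩ := h1
        exact ⟨hd, h2⟩
      · obtain ⟨p2, q2, a2, h3, h4, h5⟩ := loc3 n i p q a hi b hd _ h1
        simp only [List.cons.injEq, and_true] at h3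
        obtain ⟨rfl, rfl, rfl⟩ := h3
        exact ⟨h4, h2 _ h5⟩
    have := ins_par rest rest1 (psi n p q a).1 (psi n p1 q1 a1).1 ((psi n p q a).2.1 :: (psi n p q a).2.2 :: R)
      ((psi n p1 q1 a1).2.1 :: (psi n p1 q1 a1).2.2 :: R1) hg hs' (by simpa [w3] using key.2)
    rw [ins2 _ _ _ _ _ hd, ins2 _ _ _ _ _ key.1]
    refine ⟨⟨key.1, this.1⟩, ?_, ?_⟩
    · simp only [shp, List.map_cons] at this ⊢; rw [this.2.1]; simp
    · simpa [rd] using this.2.2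
  | [] :: rest, T1, a, a1, R, R1, hg, hs, h => by simp [Good] at hg
  | (_ :: _ :: _ :: _) :: rest, T1, a, a1, R, R1, hg, hs, h => by simp [Good] at hg

def GoodW : List ℕ → List (List ℕ) → Prop
  | [], _ => True
  | a :: u, T => GoodW u T ∧ Good n a (insertWord n u T)

lemma insW_par : ∀ (u u1 : List ℕ) (T T1 : List (List ℕ)) (R R1 : List ℕ), GoodW n u T → shp T1 = shp T →
    u1.length = u.length →
    (listC (letC n i hi)).op b (rd T ++ (u.reverse ++ R)) = some (rd T1 ++ (u1.reverse ++ R1)) →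
    GoodW n u1 T1 ∧ shp (insertWord n u1 T1) = shp (insertWord n u T) ∧
    (listC (letC n i hi)).op b (rd (insertWord n u T) ++ R) = some (rd (insertWord n u1 T1) ++ R1)
  | [], u1, T, T1, R, R1, hg, hs, hu, h => by
    have : u1 = [] := by cases u1 <;> simp at hu ⊢
    subst this
    exact ⟨trivial, hs, by simpa [insertWord] using h⟩
  | a :: u, u1, T, T1, R, R1, hg, hs, hu, h => by
    cases u1 with
    | nil => simp at hu
    | cons a1 u1 =>
      have := insW_par u u1 T T1 (a :: R) (a1 :: R1) hg.1 hs (by simpa using hu) (by simpa using h)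
      have h2 := ins_par n i hi b _ _ a a1 R R1 hg.2 this.2.1 this.2.2
      exact ⟨⟨this.1, h2.1⟩, h2.2⟩

def GR (g : ℕ) (C : List ℕ) : Prop :=
  (∃ p, C = [p]) ∨ ∃ p q a, Dom n p q a ∧ g = (psi n p q a).1 ∧ C = [(psi n p q a).2.1, (psi n p q a).2.2]

def GoodRev (g : ℕ) : List (List ℕ) → Prop
  | [] => True
  | C :: rest => GoodRev g rest ∧ GR n (revPass n g rest).2 C

lemma rev_par : ∀ (T T1 : List (List ℕ)) (g g1 : ℕ) (L L1 R R1 : List ℕ), GoodRev n g T → shp T1 = shp T →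
    L1.length = L.length →
    (listC (letC n i hi)).op b (L ++ (g :: (rd T ++ R))) = some (L1 ++ (g1 :: (rd T1 ++ R1))) →
    GoodRev n g1 T1 ∧ shp (revPass n g1 T1).1 = shp (revPass n g T).1 ∧
    (listC (letC n i hi)).op b (L ++ (rd (revPass n g T).1 ++ ((revPass n g T).2 :: R))) =
       some (L1 ++ (rd (revPass n g1 T1).1 ++ ((revPass n g1 T1).2 :: R1)))
  | [], T1, g, g1, L, L1, R, R1, hg, hs, hL, h => by
    have : T1 = [] := by cases T1 <;> simp [shp] at hs ⊢
    subst this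
    exact ⟨trivial, rfl, by simpa [revPass, rd] using h⟩
  | C :: rest, T1, g, g1, L, L1, R, R1, hg, hs, hL, h => by
    obtain ⟨C1, rest1, rfl, hC, hs'⟩ := shp_cons _ _ _ hs
    obtain ⟨hg1, hg2⟩ := hg
    have ih := rev_par rest rest1 g g1 L L1 (C ++ R) (C1 ++ R1) hg1 hs' hL (by simpa [rd] using h)
    obtain ⟨i1, i2, i3⟩ := ih
    simp only [GoodRev, revPass]
    generalize (revPass n g rest).2 = r at *
    generalize (revPass n g1 rest1).2 = r1 at *
    generalize (revPass n g rest).1 = A at *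
    generalize (revPass n g1 rest1).1 = A1 at *
    have hl := rd_len _ _ i2
    rcases hg2 with ⟨p, rfl⟩ | ⟨p, q, a, hd, rfl, rfl⟩
    · obtain ⟨p1, rfl⟩ := List.length_eq_one_iff.1 hC
      refine ⟨⟨i1, Or.inl ⟨p1, rfl⟩⟩, ?_, ?_⟩
      · simp only [shp, List.map_cons, revStep] at i2 ⊢; rw [i2]; simp
      · simpa [revStep, rd] using i3
    · obtain ⟨p1, q1, rfl⟩ := List.length_eq_two.1 hC
      have h0 := loc3_eps n i p q a hi hd
      have := seg3 (letC n i hi) b (L ++ rd A) (w3 (psi n p q a)) R (L1 ++ rd A1) [r1, p1, q1] R1 [p, q, a]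
        (by simpa [w3] using i3) (by simp [hL, hl]) rfl h0.1.symm h0.2.symm
      have key : ∃ p2 q2 a2, Dom n p2 q2 a2 ∧ r1 = (psi n p2 q2 a2).1 ∧ [p1, q1] = [(psi n p2 q2 a2).2.1, (psi n p2 q2 a2).2.2] ∧
          (listC (letC n i hi)).op b ((L ++ rd A) ++ ([p, q, a] ++ R)) = some ((L1 ++ rd A1) ++ ([p2, q2, a2] ++ R1)) := by
        rcases this with ⟨h1, h2⟩ | ⟨h1, h2⟩
        · simp only [List.cons.injEq, and_true, w3] at h1
          obtain ⟨rfl, rfl, rfl⟩ := h1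
          exact ⟨p, q, a, hd, rfl, rfl, h2⟩
        · obtain ⟨p2, q2, a2, h3, h4, h5⟩ := loc3' n i p q a hi b hd _ h1
          simp only [List.cons.injEq, and_true, w3] at h3
          obtain ⟨rfl, rfl, rfl⟩ := h3
          exact ⟨p2, q2, a2, h4, rfl, rfl, h2 _ h5⟩
      obtain ⟨p2, q2, a2, hd2, rfl, e2, hop⟩ := key
      have r1 := (psi_inv n p q a hd).2.2.2.2
      have r2 := (psi_inv n p2 q2 a2 hd2).2.2.2.2
      refine ⟨⟨i1, Or.inr ⟨p2, q2, a2, hd2, rfl, e2⟩⟩, ?_, ?_⟩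
      · rw [e2, r1, r2]
        simp only [shp, List.map_cons] at i2 ⊢; rw [i2]; simp
      · rw [e2, r1, r2]
        simpa [rd] using hop
end par


def G1 (n : ℕ) (T : List (List ℕ)) : Prop := ∃ T0 a, T = T0 ++ [[a]] ∧ GoodRev n a T0
def G2 (n : ℕ) (T : List (List ℕ)) : Prop :=
  ∃ A a c B, T = A ++ [a, c] :: B ∧ numTwoCols T = A.length + 1 ∧ GoodRev n c A

lemma shp_append (A B T1 : List (List ℕ)) (h : shp T1 = shp (A ++ B)) :
    ∃ A1 B1, T1 = A1 ++ B1 ∧ shp A1 = shp A ∧ shp B1 = shp B := by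
  simp only [shp, List.map_append] at h
  obtain ⟨A1, B1, rfl, h1, h2⟩ := List.map_eq_append_iff.1 h
  exact ⟨A1, B1, rfl, h1, h2⟩

lemma ntc_shp : ∀ (T T1 : List (List ℕ)), shp T1 = shp T → numTwoCols T1 = numTwoCols T
  | [], T1, h => by
    have : T1 = [] := by cases T1 <;> simp [shp] at h ⊢
    rw [this]
  | C :: T, T1, h => by
    obtain ⟨C1, T2, rfl, h1, h2⟩ := shp_cons _ _ _ h
    have := ntc_shp T T2 h2
    simp only [numTwoCols, List.filter_cons, h1] at this ⊢
    split_ifs <;> simp [this]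

lemma rbFirst_eq (n a : ℕ) (T0 : List (List ℕ)) : rbFirst n (T0 ++ [[a]]) = revPass n a T0 := by
  simp [rbFirst]

lemma rbSecond_eq (n a c : ℕ) (A B : List (List ℕ)) (h : numTwoCols (A ++ [a, c] :: B) = A.length + 1) :
    rbSecond n (A ++ [a, c] :: B) = ((revPass n c A).1 ++ [a] :: B, (revPass n c A).2) := by
  have e1 : List.drop A.length (A ++ [a, c] :: B) = [a, c] :: B := by simp
  have e2 : List.take A.length (A ++ [a, c] :: B) = A := by simp
  have e3 : List.drop (A.length + 1) (A ++ [a, c] :: B) = B := by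
    rw [← List.drop_drop, e1]; simp
  simp only [rbSecond, h, Nat.add_sub_cancel, e1, e2, e3, List.head?_cons]

def GI (step : List (List ℕ) → List (List ℕ) × ℕ) (G : List (List ℕ) → Prop) : ℕ → List (List ℕ) → Prop
  | 0, _ => True
  | c + 1, T => G T ∧ GI step G c (step T).1

section par
variable (n i : ℕ) (hi : i ≤ n) (b : Bool)

def SP (step : List (List ℕ) → List (List ℕ) × ℕ) (G : List (List ℕ) → Prop) : Prop :=
  ∀ (T T1 : List (List ℕ)) (R R1 : List ℕ), G T → shp T1 = shp T →
    (listC (letC n i hi)).op b (rd T ++ R) = some (rd T1 ++ R1) →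
    G T1 ∧ shp (step T1).1 = shp (step T).1 ∧
    (listC (letC n i hi)).op b (rd (step T).1 ++ ((step T).2 :: R)) = some (rd (step T1).1 ++ ((step T1).2 :: R1))

lemma SP1 : SP n i hi b (rbFirst n) (G1 n) := by
  rintro T T1 R R1 ⟨T0, a, rfl, hg⟩ hs h
  obtain ⟨A1, B1, rfl, h1, h2⟩ := shp_append _ _ _ hs
  obtain ⟨C1, B2, rfl, h3, h4⟩ := shp_cons _ _ _ h2
  have : B2 = [] := by cases B2 <;> simp [shp] at h4 ⊢
  subst this
  obtain ⟨a1, rfl⟩ := List.length_eq_one_iff.1 h3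
  rw [rbFirst_eq, rbFirst_eq]
  have := rev_par n i hi b T0 A1 a a1 [] [] R R1 hg h1 rfl (by simpa [rd_append, rd] using h)
  exact ⟨⟨A1, a1, rfl, this.1⟩, this.2.1, by simpa using this.2.2⟩

lemma SP2 : SP n i hi b (rbSecond n) (G2 n) := by
  rintro T T1 R R1 ⟨A, a, c, B, rfl, hn, hg⟩ hs h
  have hn1 := ntc_shp _ _ hs
  obtain ⟨A1, B1, rfl, h1, h2⟩ := shp_append _ _ _ hs
  obtain ⟨C1, B2, rfl, h3, h4⟩ := shp_cons _ _ _ h2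
  obtain ⟨a1, c1, rfl⟩ := List.length_eq_two.1 h3
  have hA : A1.length = A.length := by simpa [shp] using congrArg List.length h1
  have hn2 : numTwoCols (A1 ++ [a1, c1] :: B2) = A1.length + 1 := by omega
  rw [rbSecond_eq _ _ _ _ _ hn, rbSecond_eq _ _ _ _ _ hn2]
  have := rev_par n i hi b A A1 c c1 (rd B ++ [a]) (rd B2 ++ [a1]) R R1 hg h1
    (by simp [rd_len _ _ h4]) (by simpa [rd_append, rd] using h)
  refine ⟨⟨A1, a1, c1, B2, rfl, hn2, this.1⟩, ?_, by simpa [rd_append, rd] using this.2.2⟩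
  have h5 := this.2.1
  simp only [shp, List.map_append, List.map_cons] at h5 h4 ⊢
  rw [h5, h4]; simp

lemma iter_par (step : List (List ℕ) → List (List ℕ) × ℕ) (G : List (List ℕ) → Prop) (hsp : SP n i hi b step G) :
   ∀ (c : ℕ) (T T1 : List (List ℕ)) (R R1 : List ℕ), GI step G c T → shp T1 = shp T →
    (listC (letC n i hi)).op b (rd T ++ R) = some (rd T1 ++ R1) →
    GI step G c T1 ∧ shp (rbIter step c T1).1 = shp (rbIter step c T).1 ∧
    (listC (letC n i hi)).op b (rd (rbIter step c T).1 ++ ((rbIter step c T).2.reverse ++ R)) =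
      some (rd (rbIter step c T1).1 ++ ((rbIter step c T1).2.reverse ++ R1))
  | 0, T, T1, R, R1, _, hs, h => ⟨trivial, hs, by simpa [rbIter] using h⟩
  | c + 1, T, T1, R, R1, hg, hs, h => by
    have h1 := hsp T T1 R R1 hg.1 hs h
    have h2 := iter_par step G hsp c _ _ _ _ hg.2 h1.2.1 h1.2.2
    refine ⟨⟨h1.1, h2.1⟩, h2.2.1, ?_⟩
    simpa [rbIter] using h2.2.2
end par

lemma rbIter_len (step : List (List ℕ) → List (List ℕ) × ℕ) : ∀ c T, (rbIter step c T).2.length = c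
  | 0, T => rfl
  | c + 1, T => by simp [rbIter, rbIter_len step c]

/-- The whole run. -/
def PP (n : ℕ) (w1 w2 : List ℕ) : List (List ℕ) := insertWord n w2 (rowCols w1)
def QQ1 (n m : ℕ) (w1 w2 : List ℕ) := rbIter (rbFirst n) (w1.length - m) (PP n w1 w2)
def QQ2 (n m : ℕ) (w1 w2 : List ℕ) := rbIter (rbSecond n) m (QQ1 n m w1 w2).1

def Run (n m : ℕ) (w1 w2 : List ℕ) : Prop :=
  GoodW n w2 (rowCols w1) ∧ numTwoCols (PP n w1 w2) = m ∧ m ≤ w1.length ∧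
  GI (rbFirst n) (G1 n) (w1.length - m) (PP n w1 w2) ∧
  GI (rbSecond n) (G2 n) m (QQ1 n m w1 w2).1 ∧
  shp (QQ2 n m w1 w2).1 = List.replicate w2.length 1

def outw (n m : ℕ) (w1 w2 : List ℕ) : List ℕ :=
  rd (QQ2 n m w1 w2).1 ++ ((QQ1 n m w1 w2).2 ++ (QQ2 n m w1 w2).2).reverse

lemma rd_rowCols (w : List ℕ) : rd (rowCols w) = w.reverse := by
  induction w with
  | nil => rfl
  | cons a w ih => simp only [rowCols] at ih; simp [rowCols, rd, ih]

lemma run_par (n i : ℕ) (hi : i ≤ n) (b : Bool) (m : ℕ) (w1 w2 v1 v2 : List ℕ)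
    (h1 : v1.length = w1.length) (h2 : v2.length = w2.length) (hr : Run n m w1 w2)
    (h : (listC (letC n i hi)).op b (w1.reverse ++ w2.reverse) = some (v1.reverse ++ v2.reverse)) :
    Run n m v1 v2 ∧ (listC (letC n i hi)).op b (outw n m w1 w2) = some (outw n m v1 v2) := by
  obtain ⟨r1, r2, r3, r4, r5, r6⟩ := hr
  have s1 : shp (rowCols v1) = shp (rowCols w1) := by
    simp only [shp, rowCols, List.map_map, Function.comp_def, List.length_singleton, List.map_const', h1]
  have a1 := insW_par n i hi b w2 v2 (rowCols w1) (rowCols v1) [] [] r1 s1 h2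
    (by simpa [rd_rowCols] using h)
  have a2 := iter_par n i hi b _ _ (SP1 n i hi b) _ _ _ _ _ r4 a1.2.1 a1.2.2
  have a3 := iter_par n i hi b _ _ (SP2 n i hi b) _ _ _ _ _ r5 a2.2.1 a2.2.2
  refine ⟨⟨a1.1, ?_, by omega, ?_, ?_, ?_⟩, ?_⟩
  · rw [← r2]; exact ntc_shp _ _ a1.2.1
  · rw [h1]; exact a2.1
  · unfold QQ1; rw [h1]; exact a3.1
  · rw [h2, ← r6]; unfold QQ2 QQ1; rw [h1]; exact a3.2.1
  · simpa [outw, QQ2, QQ1, PP, h1] using a3.2.2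

lemma rd_singles : ∀ (T : List (List ℕ)) (k : ℕ), shp T = List.replicate k 1 →
    (colsWord T).reverse = rd T ∧ (colsWord T).length = k
  | [], k, h => by
    have : k = 0 := by simpa [shp] using (congrArg List.length h).symm
    simp [colsWord, rd, this]
  | C :: T, k, h => by
    cases k with
    | zero => simp [shp] at h
    | succ k =>
      simp only [shp, List.map_cons, List.replicate_succ, List.cons.injEq] at h
      obtain ⟨a, rfl⟩ := List.length_eq_one_iff.1 h.1
      have := rd_singles T k h.2
      simp only [colsWord] at this ⊢
      simp only [List.foldr_cons, rd, ← this.1, List.reverse_append, List.length_append, this.2]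
      simp; omega

/-- What a good run gives in terms of the output word. -/
lemma run_out (n m : ℕ) (w1 w2 c1 c2 : List ℕ) (hr : Run n m w1 w2) (h1 : c1.length = w1.length)
    (h2 : c2.length = w2.length) (h : outw n m w1 w2 = c2.reverse ++ c1.reverse) :
    colsWord (QQ2 n m w1 w2).1 = c2 ∧ (QQ1 n m w1 w2).2 ++ (QQ2 n m w1 w2).2 = c1 := by
  obtain ⟨r1, r2, r3, r4, r5, r6⟩ := hr
  have := rd_singles _ _ r6
  unfold outw at h
  rw [← this.1] at h
  obtain ⟨e1, e2⟩ := List.append_inj h (by simp [this.2, h2])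
  exact ⟨List.reverse_injective e1, List.reverse_injective e2⟩

/-! top element -/
lemma psi010 (n : ℕ) (hn : 2 ≤ n) : psi n 0 1 0 = (0, 0, 1) := by
  unfold psi
  rw [if_neg (by simp only [c1, bar]; omega), if_neg (by simp only [c2, bar]; omega), if_pos (by omega)]
lemma psi011 (n : ℕ) (hn : 2 ≤ n) : psi n 0 1 1 = (1, 0, 1) := by
  unfold psi
  rw [if_neg (by simp only [c1, bar]; omega), if_neg (by simp only [c2, bar]; omega), if_neg (by omega)]

lemma ins0_pair (n : ℕ) (hn : 2 ≤ n) (m r : ℕ) :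
    insertLetter n 0 (List.replicate m [0, 1] ++ List.replicate r [0]) =
      List.replicate m [0, 1] ++ List.replicate (r + 1) [0] ∧ 
      Good n 0 (List.replicate m [0, 1] ++ List.replicate r [0]) := by
  induction m with
  | zero =>
    induction r with
    | zero => exact ⟨rfl, trivial⟩
    | succ r ih =>
      simp only [List.replicate_zero, List.nil_append] at ih ⊢
      rw [List.replicate_succ]
      exact ⟨by rw [ins1, if_pos (le_refl _), ih.1]; rfl, Or.inl ⟨le_refl _, ih.2⟩⟩
  | succ m ih =>
    have hd : Dom n 0 1 0 := by simp only [Dom]; omega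
    have hp := psi010 n hn
    rw [List.replicate_succ, List.cons_append]
    refine ⟨?_, hd, ?_⟩
    · rw [ins2 _ _ _ _ _ hd, hp, ih.1]; rfl
    · rw [hp]; exact ih.2

lemma ins1_pair (n : ℕ) (hn : 2 ≤ n) (m r : ℕ) :
    insertLetter n 1 (List.replicate m [0, 1] ++ List.replicate (r + 1) [0]) =
      List.replicate (m + 1) [0, 1] ++ List.replicate r [0] ∧ 
      Good n 1 (List.replicate m [0, 1] ++ List.replicate (r + 1) [0]) := by
  induction m with
  | zero =>
    simp only [List.replicate_zero, List.nil_append]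
    rw [List.replicate_succ]
    exact ⟨by rw [ins1, if_neg (by omega)]; rfl, Or.inr ⟨by omega, by omega, by omega⟩⟩
  | succ m ih =>
    have hd : Dom n 0 1 1 := by simp only [Dom]; omega
    have hp := psi011 n hn
    rw [List.replicate_succ, List.cons_append]
    refine ⟨?_, hd, ?_⟩
    · rw [ins2 _ _ _ _ _ hd, hp, ih.1]; rfl
    · rw [hp]; exact ih.2

lemma rev0_pair (n : ℕ) (hn : 2 ≤ n) (m r : ℕ) :
    revPass n 0 (List.replicate m [0, 1] ++ List.replicate r [0]) =
      (List.replicate m [0, 1] ++ List.replicate r [0], 0) ∧ 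
      GoodRev n 0 (List.replicate m [0, 1] ++ List.replicate r [0]) := by
  induction m with
  | zero =>
    induction r with
    | zero => exact ⟨rfl, trivial⟩
    | succ r ih =>
      simp only [List.replicate_zero, List.nil_append] at ih ⊢
      rw [List.replicate_succ]
      exact ⟨by rw [revPass, ih.1]; rfl, ih.2, Or.inl ⟨0, rfl⟩⟩
  | succ m ih =>
    have hd : Dom n 0 1 0 := by simp only [Dom]; omega
    have hp := psi010 n hn
    have hv := (psi_inv n 0 1 0 hd).2.2.2.2
    rw [hp] at hv
    rw [List.replicate_succ, List.cons_append]
    refine ⟨?_, ih.2, Or.inr ⟨0, 1, 0, hd, ?_, ?_⟩⟩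
    · rw [revPass, ih.1]; dsimp only at hv ⊢; rw [hv]
    · rw [hp, ih.1]
    · rw [hp]

lemma rev1_pair (n : ℕ) (hn : 2 ≤ n) (m : ℕ) :
    revPass n 1 (List.replicate m [0, 1]) = (List.replicate m [0, 1], 1) ∧ 
      GoodRev n 1 (List.replicate m [0, 1]) := by
  induction m with
  | zero => exact ⟨rfl, trivial⟩
  | succ m ih =>
    have hd : Dom n 0 1 1 := by simp only [Dom]; omega
    have hp := psi011 n hn
    have hv := (psi_inv n 0 1 1 hd).2.2.2.2
    rw [hp] at hv
    rw [List.replicate_succ]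
    refine ⟨?_, ih.2, Or.inr ⟨0, 1, 1, hd, ?_, ?_⟩⟩
    · rw [revPass, ih.1]; dsimp only at hv ⊢; rw [hv]
    · rw [hp, ih.1]
    · rw [hp]

lemma insW0 (n : ℕ) (hn : 2 ≤ n) (k m r : ℕ) (T : List (List ℕ)) (hT : T = List.replicate m [0, 1] ++ List.replicate r [0]) :
    insertWord n (List.replicate k 0) T = List.replicate m [0, 1] ++ List.replicate (r + k) [0] ∧
    GoodW n (List.replicate k 0) T := by
  induction k with
  | zero => exact ⟨hT, trivial⟩
  | succ k ih =>
    rw [List.replicate_succ]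
    have e : insertWord n (0 :: List.replicate k 0) T = insertLetter n 0 (insertWord n (List.replicate k 0) T) := rfl
    have := ins0_pair n hn m (r + k)
    refine ⟨?_, ih.2, ?_⟩
    · rw [e, ih.1, this.1]; rfl
    · rw [ih.1]; exact this.2

lemma insW1 (n : ℕ) (hn : 2 ≤ n) (k r : ℕ) (h : k ≤ r) :
    insertWord n (List.replicate k 1) (List.replicate r [0]) = List.replicate k [0, 1] ++ List.replicate (r - k) [0] ∧
    GoodW n (List.replicate k 1) (List.replicate r [0]) := by
  induction k with
  | zero => exact ⟨rfl, trivial⟩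
  | succ k ih =>
    have ih := ih (by omega)
    rw [List.replicate_succ]
    have e : insertWord n (1 :: List.replicate k 1) (List.replicate r [0]) = insertLetter n 1 (insertWord n (List.replicate k 1) (List.replicate r [0])) := rfl
    have := ins1_pair n hn k (r - (k + 1))
    rw [show r - (k + 1) + 1 = r - k by omega] at this
    refine ⟨?_, ih.2, ?_⟩
    · rw [e, ih.1, this.1]
    · rw [ih.1]; exact this.2

lemma GoodW_append (n : ℕ) (u v : List ℕ) (T : List (List ℕ)) (h1 : GoodW n v T) (h2 : GoodW n u (insertWord n v T)) :
    GoodW n (u ++ v) T := by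
  induction u with
  | nil => exact h1
  | cons a u ih =>
    refine ⟨ih h2.1, ?_⟩
    have : insertWord n (u ++ v) T = insertWord n u (insertWord n v T) := by simp [insertWord]
    show Good n a (insertWord n (u ++ v) T)
    rw [this]; exact h2.2

lemma iter0 (n : ℕ) (hn : 2 ≤ n) (m c r : ℕ) :
    rbIter (rbFirst n) c (List.replicate m [0, 1] ++ List.replicate (r + c) [0]) =
      (List.replicate m [0, 1] ++ List.replicate r [0], List.replicate c 0) ∧
    GI (rbFirst n) (G1 n) c (List.replicate m [0, 1] ++ List.replicate (r + c) [0]) := by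
  induction c with
  | zero => exact ⟨rfl, trivial⟩
  | succ c ih =>
    have e : List.replicate m [0, 1] ++ List.replicate (r + (c + 1)) [0] =
      (List.replicate m [0, 1] ++ List.replicate (r + c) [0]) ++ [[0]] := by
      rw [← add_assoc, List.replicate_succ', List.append_assoc]
    have h := rev0_pair n hn m (r + c)
    have e2 : rbFirst n (List.replicate m [0, 1] ++ List.replicate (r + (c + 1)) [0]) =
       (List.replicate m [0, 1] ++ List.replicate (r + c) [0], 0) := by rw [e, rbFirst_eq, h.1]
    refine ⟨?_, ⟨_, _, e, h.2⟩, ?_⟩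
    · simp only [rbIter, e2, ih.1]; rfl
    · rw [e2]; exact ih.2

lemma ntc_pair (m r : ℕ) : numTwoCols (List.replicate m [0, 1] ++ List.replicate r [0]) = m := by
  simp [numTwoCols]

lemma iter1 (n : ℕ) (hn : 2 ≤ n) (c r : ℕ) :
    rbIter (rbSecond n) c (List.replicate c [0, 1] ++ List.replicate r [0]) =
      (List.replicate (r + c) [0], List.replicate c 1) ∧
    GI (rbSecond n) (G2 n) c (List.replicate c [0, 1] ++ List.replicate r [0]) := by
  induction c generalizing r with
  | zero => exact ⟨rfl, trivial⟩
  | succ c ih =>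
    have e : List.replicate (c + 1) [0, 1] ++ List.replicate r [0] =
      List.replicate c [0, 1] ++ [0, 1] :: List.replicate r [0] := by
      rw [List.replicate_succ', List.append_assoc]; rfl
    have h := rev1_pair n hn c
    have hn2 := ntc_pair (c + 1) r
    have hn3 : numTwoCols (List.replicate c [0, 1] ++ [0, 1] :: List.replicate r [0]) = (List.replicate c [0, 1]).length + 1 := by
      rw [← e, hn2]; simp
    have e2 : rbSecond n (List.replicate (c + 1) [0, 1] ++ List.replicate r [0]) =
       (List.replicate c [0, 1] ++ List.replicate (r + 1) [0], 1) := by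
      rw [e, rbSecond_eq _ _ _ _ _ hn3, h.1]; rfl
    refine ⟨?_, ⟨_, _, _, _, e, ?_, h.2⟩, ?_⟩
    · simp only [rbIter, e2, (ih (r + 1)).1]
      rw [show r + 1 + c = r + (c + 1) by omega]; rfl
    · rw [e]; exact hn3
    · rw [e2]; exact (ih (r + 1)).2

lemma run_top (n : ℕ) (hn : 2 ≤ n) (l k m : ℕ) (hl : m ≤ l) (hk : m ≤ k) :
    Run n m (List.replicate l 0) (List.replicate (k - m) 0 ++ List.replicate m 1) ∧
    outw n m (List.replicate l 0) (List.replicate (k - m) 0 ++ List.replicate m 1) =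
      (List.replicate k 0).reverse ++ (List.replicate (l - m) 0 ++ List.replicate m 1).reverse := by
  have a1 := insW1 n hn m l hl
  have a2 := insW0 n hn (k - m) m (l - m) _ rfl
  have eP : PP n (List.replicate l 0) (List.replicate (k - m) 0 ++ List.replicate m 1) =
      List.replicate m [0, 1] ++ List.replicate ((k - m) + (l - m)) [0] := by
    have : ∀ u v T, insertWord n (u ++ v) T = insertWord n u (insertWord n v T) := by
      intros; simp [insertWord]
    unfold PP
    rw [this, show rowCols (List.replicate l 0) = List.replicate l [0] by simp [rowCols], a1.1, a2.1, Nat.add_comm]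
  have a3 := iter0 n hn m (l - m) (k - m)
  have a4 := iter1 n hn m (k - m)
  have e1 : QQ1 n m (List.replicate l 0) (List.replicate (k - m) 0 ++ List.replicate m 1) = 
     (List.replicate m [0, 1] ++ List.replicate (k - m) [0], List.replicate (l - m) 0) := by
    unfold QQ1; rw [eP, List.length_replicate]; exact a3.1
  have e2 : QQ2 n m (List.replicate l 0) (List.replicate (k - m) 0 ++ List.replicate m 1) = 
     (List.replicate k [0], List.replicate m 1) := by
    unfold QQ2; rw [e1, a4.1]; congr 2; omega
  refine ⟨⟨?_, ?_, by simpa, ?_, ?_, ?_⟩, ?_⟩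
  · apply GoodW_append
    · simpa [rowCols] using a1.2
    · have : rowCols (List.replicate l 0) = List.replicate l [0] := by simp [rowCols]
      rw [this, a1.1]; exact a2.2
  · rw [eP]; exact ntc_pair _ _
  · rw [eP, List.length_replicate]; exact a3.2
  · rw [e1]; exact a4.2
  · rw [e2]; simp [shp]; omega
  · unfold outw; rw [e1, e2]
    rw [show List.replicate k [0] = rowCols (List.replicate k 0) by simp [rowCols], rd_rowCols]


abbrev Row := ℕ → ℕ
def mv (a b : ℕ) (c : Row) : Row := fun j => if j = b then c j + 1 else if j = a then c j - 1 else c j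

lemma mv_mv (a b : ℕ) (c : Row) (h : a ≠ b) (h1 : 0 < c a) : mv b a (mv a b c) = c := by
  funext j; simp only [mv]
  split_ifs <;> subst_vars <;> first | rfl | omega

def twoC (a b : ℕ) (h : a ≠ b) : Cry Row where
  e c := if 0 < c b then some (mv b a c) else none
  f c := if 0 < c a then some (mv a b c) else none
  ep c := c b
  ph c := c a
  ef := by
    intro x y
    split_ifs with h1 h2 h2 <;> simp only [Option.some.injEq, reduceCtorEq, false_iff, iff_false]
    · constructor
      · rintro rfl; exact mv_mv _ _ _ h.symm h1
      · rintro rfl; exact mv_mv _ _ _ h h2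
    · rintro rfl; simp [mv] at h2
    · rintro rfl; simp [mv] at h1
  e_none := by intro x; split_ifs <;> simp <;> omega
  f_none := by intro x; split_ifs <;> simp <;> omega
  e_ep := by
    intro x y
    split_ifs with h1 <;> simp only [Option.some.injEq, reduceCtorEq, IsEmpty.forall_iff]
    rintro rfl; simp [mv, h.symm]; omega

def fourC (p q r s : ℕ) (h : p ≠ q ∧ p ≠ r ∧ p ≠ s ∧ q ≠ r ∧ q ≠ s ∧ r ≠ s) : Cry Row where
  e c := if c r < c q then some (mv q p c) else if 0 < c s then some (mv s r c) else none
  f c := if c r ≤ c q then (if 0 < c p then some (mv p q c) else none) else some (mv r s c)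
  ep c := c s + (c q - c r)
  ph c := c p + (c r - c q)
  ef := by
    obtain ⟨a1, a2, a3, a4, a5, a6⟩ := h
    have b1 := a1.symm; have b2 := a2.symm; have b3 := a3.symm; have b4 := a4.symm
    have b5 := a5.symm; have b6 := a6.symm
    intro x y
    constructor
    · intro h
      split_ifs at h with h1 h2 <;> simp only [Option.some.injEq, reduceCtorEq] at h <;> subst h
      · rw [if_pos (by simp only [mv, if_pos, if_neg, *, ne_eq, not_false_eq_true]; omega), if_pos (by simp [mv]), mv_mv _ _ _ b1 (by omega)]
      · rw [if_neg (by simp only [mv, if_pos, if_neg, *, ne_eq, not_false_eq_true]; omega), mv_mv _ _ _ b6 (by omega)]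
    · intro h
      split_ifs at h with h1 h2 <;> simp only [Option.some.injEq, reduceCtorEq] at h <;> subst h
      · rw [if_pos (by simp only [mv, if_pos, if_neg, *, ne_eq, not_false_eq_true]; omega), mv_mv _ _ _ a1 (by omega)]
      · rw [if_neg (by simp only [mv, if_pos, if_neg, *, ne_eq, not_false_eq_true]; omega), if_pos (by simp [mv]), mv_mv _ _ _ a6 (by omega)]
  e_none := by intro x; split_ifs <;> simp <;> omega
  f_none := by intro x; split_ifs <;> simp <;> omega
  e_ep := by
    obtain ⟨a1, a2, a3, a4, a5, a6⟩ := h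
    have b1 := a1.symm; have b2 := a2.symm; have b3 := a3.symm; have b4 := a4.symm
    have b5 := a5.symm; have b6 := a6.symm
    intro x y h
    split_ifs at h with h1 h2 <;> simp only [Option.some.injEq, reduceCtorEq] at h <;> subst h <;>
     simp only [mv, if_pos, if_neg, *, ne_eq, not_false_eq_true] <;> omega

def rowC (n i : ℕ) (hi : i ≤ n) : Cry Row :=
  if h : i = n then twoC n (n + 1) (by omega)
  else fourC i (i + 1) (2 * n - i) (2 * n + 1 - i) (by omega)

/-- affine zero operator -/
def affC (n : ℕ) (hn : 2 ≤ n) : Cry Row where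
  e c := if c (2 * n) + 2 ≤ c 1 then some (mv 1 0 (mv 1 (2 * n + 1) c))
    else if c 1 = c (2 * n) + 1 then some (mv 1 (2 * n) c)
    else if 0 < min (c 0) (c (2 * n + 1)) then some (mv 0 (2 * n) (mv (2 * n + 1) (2 * n) c)) else none
  f c := if c (2 * n) ≤ c 1 then
      (if 0 < min (c 0) (c (2 * n + 1)) then some (mv (2 * n + 1) 1 (mv 0 1 c)) else none)
    else if c 1 + 1 = c (2 * n) then some (mv (2 * n) 1 c)
    else some (mv (2 * n) (2 * n + 1) (mv (2 * n) 0 c))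
  ep c := min (c 0) (c (2 * n + 1)) + (c 1 - c (2 * n))
  ph c := min (c 0) (c (2 * n + 1)) + (c (2 * n) - c 1)
  ef := by
    have e1 : 2 * n ≠ 0 := by omega
    have e2 : 2 * n ≠ 1 := by omega
    have e3 : 2 * n + 1 ≠ 1 := by omega
    have e4 : 2 * n + 1 ≠ 2 * n := by omega
    have e5 : 1 ≠ 2 * n := by omega
    have e6 : 1 ≠ 2 * n + 1 := by omega
    have e7 : 0 ≠ 2 * n := by omega
    have e8 : 0 ≠ 2 * n + 1 := by omega
    have e9 : 2 * n + 1 ≠ 0 := by omega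
    have e10 : 2 * n ≠ 2 * n + 1 := by omega
    intro x y
    constructor
    · intro h
      split_ifs at h with h1 h2 h3 <;> simp only [Option.some.injEq, reduceCtorEq] at h <;> subst h
      · rw [if_pos (by simp [mv, *]; omega), if_pos (by simp [mv, *])]
        rw [mv_mv _ _ _ (by omega) (by simp [mv, *]; omega), mv_mv _ _ _ (by omega) (by omega)]
      · rw [if_neg (by simp [mv, *]), if_pos (by simp [mv, *]), mv_mv _ _ _ (by omega) (by omega)]
      · rw [if_neg (by simp [mv, *] <;> omega), if_neg (by simp [mv, *] <;> omega)]
        rw [mv_mv _ _ _ (by omega) (by simp [mv, *]; omega), mv_mv _ _ _ (by omega) (by omega)]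
    · intro h
      split_ifs at h with h1 h2 h3 <;> simp only [Option.some.injEq, reduceCtorEq] at h <;> subst h
      · rw [if_pos (by simp [mv, *])]
        rw [mv_mv _ _ _ (by omega) (by simp [mv, *]; omega), mv_mv _ _ _ (by omega) (by omega)]
      · rw [if_neg (by simp [mv, *]; omega), if_pos (by simp [mv, *]; omega), mv_mv _ _ _ (by omega) (by omega)]
      · rw [if_neg (by simp [mv, *]; omega), if_neg (by simp [mv, *]; omega), if_pos (by simp [mv, *])]
        rw [mv_mv _ _ _ (by omega) (by simp [mv, *]; omega), mv_mv _ _ _ (by omega) (by omega)]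
  e_none := by intro x; split_ifs <;> simp only [reduceCtorEq, true_iff, false_iff] <;> omega
  f_none := by intro x; split_ifs <;> simp only [reduceCtorEq, true_iff, false_iff] <;> omega
  e_ep := by
    have e1 : 2 * n ≠ 0 := by omega
    have e2 : 2 * n ≠ 1 := by omega
    have e3 : 2 * n + 1 ≠ 1 := by omega
    have e4 : 2 * n + 1 ≠ 2 * n := by omega
    have e5 : 1 ≠ 2 * n := by omega
    have e6 : 1 ≠ 2 * n + 1 := by omega
    have e7 : 0 ≠ 2 * n := by omega
    have e8 : 0 ≠ 2 * n + 1 := by omega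
    have e9 : 2 * n + 1 ≠ 0 := by omega
    have e10 : 2 * n ≠ 2 * n + 1 := by omega
    intro x y h
    split_ifs at h with h1 h2 h3 <;> simp only [Option.some.injEq, reduceCtorEq] at h <;> subst h <;>
     simp [mv, *] <;> omega

/-! words -/
def seg (c : Row) : ℕ → List ℕ
  | 0 => []
  | m + 1 => List.replicate (c m) m ++ seg c m

lemma seg_congr (c d : Row) (m : ℕ) (h : ∀ j < m, c j = d j) : seg c m = seg d m := by
  induction m with
  | zero => rfl
  | succ m ih => rw [seg, seg, h m (by omega), ih (fun j hj => h j (by omega))]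

section w
variable (n i : ℕ) (hi : i ≤ n)

lemma rep_ep (c a : ℕ) : lep (letC n i hi) (List.replicate c a) = (if lE n i a then c else 0) ∧
    lph (letC n i hi) (List.replicate c a) = (if lF n i a then c else 0) := by
  induction c with
  | zero => simp [lep, lph]
  | succ c ih =>
    simp only [List.replicate_succ, lep, lph, ih.1, ih.2]
    simp only [letC, lE, lF, decide_eq_true_eq]
    split_ifs <;> omega

lemma seg_ep_n (c : Row) (m : ℕ) : lep (letC n n le_rfl) (seg c m) = (if m ≤ n + 1 then 0 else c (n + 1)) ∧
    lph (letC n n le_rfl) (seg c m) = (if m ≤ n then 0 else c n) := by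
  induction m with
  | zero => simp [seg, lep, lph]
  | succ m ih =>
    rw [seg, lep_append, lph_append, ih.1, ih.2, (rep_ep _ _ _ _ _).1, (rep_ep _ _ _ _ _).2]
    simp only [lE, lF, decide_eq_true_eq]
    rcases Nat.lt_trichotomy m n with h | h | h
    · split_ifs <;> omega
    · subst h; split_ifs <;> omega
    · by_cases h2 : m = n + 1
      · subst h2; split_ifs <;> omega
      · split_ifs <;> omega

lemma seg_ep (hi2 : i < n) (c : Row) (m : ℕ) : lep (letC n i hi) (seg c m) =
      (if m ≤ i + 1 then 0 else if m ≤ 2 * n - i then c (i + 1) else if m ≤ 2 * n + 1 - i then c (i + 1) - c (2 * n - i)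
        else c (2 * n + 1 - i) + (c (i + 1) - c (2 * n - i))) ∧
    lph (letC n i hi) (seg c m) = (if m ≤ i then 0 else if m ≤ 2 * n - i then c i else c i + (c (2 * n - i) - c (i + 1))) := by
  induction m with
  | zero => simp [seg, lep, lph]
  | succ m ih =>
    have e1 : lep (letC n i hi) (seg c (m + 1)) = (if lE n i m then c m else 0) +
        (lep (letC n i hi) (seg c m) - (if lF n i m then c m else 0)) := by
      rw [seg, lep_append, (rep_ep _ _ _ _ _).1, (rep_ep _ _ _ _ _).2]
    have e2 : lph (letC n i hi) (seg c (m + 1)) = lph (letC n i hi) (seg c m) +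
        ((if lF n i m then c m else 0) - lep (letC n i hi) (seg c m)) := by
      rw [seg, lph_append, (rep_ep _ _ _ _ _).2]
    rw [e1, e2, ih.1, ih.2]
    clear e1 e2 ih
    by_cases h1 : m = i
    · subst h1
      have a1 : lE n m m = false := by simp only [lE, decide_eq_false_iff_not]; omega
      have a2 : lF n m m = true := by simp [lF]
      rw [a1, a2]; simp only [if_true, Bool.false_eq_true, if_false]
      constructor <;> split_ifs <;> omega
    by_cases h2 : m = i + 1
    · subst h2
      have a1 : lE n i (i + 1) = true := by simp [lE]
      have a2 : lF n i (i + 1) = false := by simp only [lF, decide_eq_false_iff_not]; omega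
      rw [a1, a2]; simp only [if_true, Bool.false_eq_true, if_false]
      constructor <;> split_ifs <;> omega
    by_cases h3 : m = 2 * n - i
    · have a1 : lE n i m = false := by simp only [lE, decide_eq_false_iff_not]; omega
      have a2 : lF n i m = true := by simp only [lF, decide_eq_true_eq]; omega
      rw [a1, a2]; simp only [if_true, Bool.false_eq_true, if_false]
      subst h3
      constructor <;> split_ifs <;> omega
    by_cases h4 : m = 2 * n + 1 - i
    · have a1 : lE n i m = true := by simp only [lE, decide_eq_true_eq]; omega
      have a2 : lF n i m = false := by simp only [lF, decide_eq_false_iff_not]; omega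
      rw [a1, a2]; simp only [if_true, Bool.false_eq_true, if_false]
      subst h4
      constructor <;> split_ifs <;> omega
    have a1 : lE n i m = false := by simp only [lE, decide_eq_false_iff_not]; omega
    have a2 : lF n i m = false := by simp only [lF, decide_eq_false_iff_not]; omega
    rw [a1, a2]; simp only [Bool.false_eq_true, if_false]
    constructor <;> split_ifs <;> omega

lemma leE_rep (c p : ℕ) (h : lE n i p = true) : leE (letC n i hi) (List.replicate (c + 1) p) =
    some (List.replicate c p ++ [p - 1]) := by
  induction c with
  | zero => simp [leE, lep, letC, h]
  | succ c ih =>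
    have hf : lF n i p = false := by
      simp only [lE, lF, decide_eq_true_eq, decide_eq_false_iff_not] at h ⊢; omega
    rw [List.replicate_succ, leE, if_neg (by rw [(rep_ep _ _ _ _ _).1]; simp [letC, h, hf]), ih]; rfl

lemma seg_e (c : Row) (p : ℕ) (hp : 0 < p) (h : lE n i p = true) (h1 : 0 < c p) (h0 : lep (letC n i hi) (seg c p) = 0) (m : ℕ)
    (hm : p < m) (h2 : ∀ j, p < j → j < m → (if lF n i j then c j else 0) < lep (letC n i hi) (seg c j)) :
    leE (letC n i hi) (seg c m) = some (seg (mv p (p - 1) c) m) := by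
  induction m with
  | zero => omega
  | succ m ih =>
    rw [seg, leE_append, (rep_ep _ _ _ _ _).2]
    by_cases hpm : p = m
    · subst hpm
      rw [if_pos (by omega)]
      obtain ⟨q, rfl⟩ : ∃ q, p = q + 1 := ⟨p - 1, by omega⟩
      obtain ⟨r, hr⟩ : ∃ r, c (q + 1) = r + 1 := ⟨c (q + 1) - 1, by omega⟩
      rw [hr, leE_rep _ _ _ _ _ h]
      have : seg (mv (q + 1) q c) q = seg c q := by
        apply seg_congr; intro j hj; simp only [mv]; rw [if_neg (by omega), if_neg (by omega)]
      simp only [seg, Nat.add_sub_cancel, this, Option.map_some, mv, hr, if_pos]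
      rw [if_neg (by omega)]
      simp [List.replicate_succ]
    · rw [if_neg (by have := h2 m (by omega) (by omega); omega), ih (by omega) (fun j a b => h2 j a (by omega))]
      simp only [seg, Option.map_some, mv]
      rw [if_neg (by omega), if_neg (by omega)]
end w

/-- morphisms -/
structure Mor {X Y : Type} (C : Cry X) (D : Cry Y) (φ : X → Y) : Prop where
  ep : ∀ x, D.ep (φ x) = C.ep x
  ph : ∀ x, D.ph (φ x) = C.ph x
  e : ∀ x y, C.e x = some y → D.e (φ x) = some (φ y)

lemma Mor.f {X Y : Type} {C : Cry X} {D : Cry Y} {φ : X → Y} (h : Mor C D φ) (x y : X) (hx : C.f x = some y) :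
    D.f (φ x) = some (φ y) := (D.ef _ _).1 (h.e _ _ ((C.ef _ _).2 hx))

lemma Mor.op {X Y : Type} {C : Cry X} {D : Cry Y} {φ : X → Y} (h : Mor C D φ) (b : Bool) (x y : X) (hx : C.op b x = some y) :
    D.op b (φ x) = some (φ y) := by
  cases b
  · exact h.f x y hx
  · exact h.e x y hx

lemma Mor.ten {X Y X' : Type} {C : Cry X} {C' : Cry X'} {D : Cry Y} {φ : X → List Y} {ψ : X' → List Y}
    (h : Mor C (listC D) φ) (h' : Mor C' (listC D) ψ) : Mor (ten C C') (listC D) (fun u => φ u.1 ++ ψ u.2) where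
  ep u := by
    show lep D _ = _
    rw [lep_append]
    have := h.ep u.1; have := h.ph u.1; have := h'.ep u.2
    simp only [listC, KTT.ten] at *; omega
  ph u := by
    show lph D _ = _
    rw [lph_append]
    have := h.ph u.1; have := h'.ph u.2; have := h'.ep u.2
    simp only [listC, KTT.ten] at *; omega
  e := by
    rintro ⟨x, y⟩ v hv
    show leE D _ = _
    rw [leE_append]
    have h1 := h.ph x; have h2 := h'.ep y
    have h3 := h.e x; have h4 := h'.e y
    simp only [listC, KTT.ten, tenE] at *
    rw [h1, h2]
    split_ifs at hv ⊢
    · obtain ⟨c, hc, rfl⟩ := Option.map_eq_some_iff.1 hv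
      rw [h3 _ hc]; rfl
    · obtain ⟨c, hc, rfl⟩ := Option.map_eq_some_iff.1 hv
      rw [h4 _ hc]; rfl

def rdw (n : ℕ) (c : Row) : List ℕ := seg c (2 * n + 2)

lemma rdw_mor (n i : ℕ) (hi : i ≤ n) : Mor (rowC n i hi) (listC (letC n i hi)) (rdw n) := by
  unfold rowC
  split_ifs with h
  · subst h
    refine ⟨?_, ?_, ?_⟩
    · intro x; show lep _ _ = _; rw [rdw, (seg_ep_n _ _ _).1, if_neg (by omega)]; rfl
    · intro x; show lph _ _ = _; rw [rdw, (seg_ep_n _ _ _).2, if_neg (by omega)]; rfl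
    · intro x y h
      simp only [twoC] at h
      split_ifs at h with h1
      simp only [Option.some.injEq] at h; subst h
      show leE _ _ = _
      refine seg_e i i hi x (i + 1) (by omega) (by simp [lE]) h1 ?_ _ (by omega) ?_
      · rw [(seg_ep_n _ _ _).1, if_pos (by omega)]
      · intro j a b
        rw [(seg_ep_n _ _ _).1]; simp only [lF, decide_eq_true_eq]
        rw [if_neg (by omega), if_neg (by omega)]; exact h1
  · have hlt : i < n := by omega
    refine ⟨?_, ?_, ?_⟩
    · intro x; show lep _ _ = _; rw [rdw, (seg_ep _ _ _ hlt _ _).1, if_neg (by omega), if_neg (by omega), if_neg (by omega)]; rfl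
    · intro x; show lph _ _ = _; rw [rdw, (seg_ep _ _ _ hlt _ _).2, if_neg (by omega), if_neg (by omega)]; rfl
    · intro x y h
      simp only [fourC] at h
      split_ifs at h with h1 h2 <;>
      simp only [Option.some.injEq] at h <;> subst h <;> show leE _ _ = _
      · refine seg_e n i hi x (i + 1) (by omega) (by simp [lE]) (by omega) ?_ _ (by omega) ?_
        · rw [(seg_ep _ _ _ hlt _ _).1, if_pos (by omega)]
        · intro j a b
          rw [(seg_ep _ _ _ hlt _ _).1]; simp only [lF, decide_eq_true_eq]
          by_cases hj : j = 2 * n - i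
          · subst hj; split_ifs <;> omega
          · split_ifs <;> omega
      · have := seg_e n i hi x (2 * n + 1 - i) (by omega) (by simp [lE]; omega) (by omega) ?_ (2 * n + 2) (by omega) ?_
        · rw [show 2 * n + 1 - i - 1 = 2 * n - i by omega] at this; exact this
        · rw [(seg_ep _ _ _ hlt _ _).1]; split_ifs <;> omega
        · intro j a b
          rw [(seg_ep _ _ _ hlt _ _).1]; simp only [lF, decide_eq_true_eq]
          split_ifs <;> omega

/-- word of a pair -/
def wp (n : ℕ) (u : Row × Row) : List ℕ := rdw n u.1 ++ rdw n u.2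
def pC (n i : ℕ) (hi : i ≤ n) : Cry (Row × Row) := ten (rowC n i hi) (rowC n i hi)
lemma wp_mor (n i : ℕ) (hi : i ≤ n) : Mor (pC n i hi) (listC (letC n i hi)) (wp n) :=
  Mor.ten (rdw_mor n i hi) (rdw_mor n i hi)


section st
variable {X Y : Type} (C : Cry X) (D : Cry Y)
def Cry.st (b : Bool) : ℕ → X → Option X
  | 0, x => some x
  | m + 1, x => (C.op b x).bind (Cry.st b m)

lemma st_add (b : Bool) (m k : ℕ) (x : X) : C.st b (m + k) x = (C.st b m x).bind (C.st b k) := by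
  induction m generalizing x with
  | zero => simp [Cry.st]
  | succ m ih =>
    rw [show m + 1 + k = (m + k) + 1 by omega, Cry.st, Cry.st]
    cases h : C.op b x with
    | none => rfl
    | some y => simp [ih]

lemma st_one (b : Bool) (x : X) : C.st b 1 x = C.op b x := by
  simp only [Cry.st]; cases C.op b x <;> rfl

lemma st_succ (b : Bool) (m : ℕ) (x : X) : C.st b (m + 1) x = (C.st b m x).bind (C.op b) := by
  rw [st_add]; congr 1; funext y; exact st_one C b y

lemma st_trans (b : Bool) (m k : ℕ) (x y z : X) (h1 : C.st b m x = some y) (h2 : C.st b k y = some z) :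
    C.st b (m + k) x = some z := by rw [st_add, h1]; exact h2

lemma op_ef (x y : X) : C.op true x = some y ↔ C.op false y = some x := C.ef x y

lemma st_rev (m : ℕ) (x y : X) : C.st true m x = some y → C.st false m y = some x := by
  induction m generalizing x with
  | zero => simp only [Cry.st, Option.some.injEq]; exact Eq.symm
  | succ m ih =>
    intro h
    rw [Cry.st] at h
    obtain ⟨z, hz, h⟩ := Option.bind_eq_some_iff.1 h
    rw [st_succ, ih _ h]; exact (op_ef C _ _).1 hz
lemma st_rev' (m : ℕ) (x y : X) : C.st false m x = some y → C.st true m y = some x := by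
  induction m generalizing x with
  | zero => simp only [Cry.st, Option.some.injEq]; exact Eq.symm
  | succ m ih =>
    intro h
    rw [Cry.st] at h
    obtain ⟨z, hz, h⟩ := Option.bind_eq_some_iff.1 h
    rw [st_succ, ih _ h]; exact (op_ef C _ _).2 hz

lemma st_val (m : ℕ) (x y : X) (h : C.st true m x = some y) : C.ep x = C.ep y + m ∧ C.ph y = C.ph x + m := by
  induction m generalizing x with
  | zero => simp only [Cry.st, Option.some.injEq] at h; subst h; simp
  | succ m ih =>
    rw [Cry.st] at h
    obtain ⟨z, hz, h⟩ := Option.bind_eq_some_iff.1 h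
    have := ih _ h
    have := C.e_ep _ _ hz
    omega

lemma st_ex (m : ℕ) (x : X) : (∃ y, C.st true m x = some y) ↔ m ≤ C.ep x := by
  constructor
  · rintro ⟨y, h⟩; have := st_val C m x y h; omega
  · induction m generalizing x with
    | zero => intro; exact ⟨x, rfl⟩
    | succ m ih =>
      intro h
      cases hz : C.op true x with
      | none => have := (C.e_none x).1 hz; omega
      | some z =>
        have := C.e_ep x z hz
        obtain ⟨y, hy⟩ := ih z (by omega)
        exact ⟨y, by rw [Cry.st, hz]; exact hy⟩

lemma st_exf (m : ℕ) (x : X) : (∃ y, C.st false m x = some y) ↔ m ≤ C.ph x := by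
  constructor
  · rintro ⟨y, h⟩; have := st_val C m y x (st_rev' C _ _ _ h); omega
  · induction m generalizing x with
    | zero => intro; exact ⟨x, rfl⟩
    | succ m ih =>
      intro h
      cases hz : C.op false x with
      | none => have := (C.f_none x).1 hz; omega
      | some z =>
        have := C.e_ep z x ((op_ef C _ _).2 hz)
        obtain ⟨y, hy⟩ := ih z (by omega)
        exact ⟨y, by rw [Cry.st, hz]; exact hy⟩

lemma ten_st2 (M : ℕ) (x : X) (y y' : Y) (h1 : C.ph x + M ≤ D.ep y) (h2 : D.st true M y = some y') :
    (ten C D).st true M (x, y) = some (x, y') := by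
  induction M generalizing y with
  | zero => simp only [Cry.st, Option.some.injEq] at h2 ⊢; rw [h2]
  | succ m ih =>
    rw [Cry.st] at h2
    obtain ⟨z, hz, h⟩ := Option.bind_eq_some_iff.1 h2
    have h3 := D.e_ep _ _ hz
    have : (ten C D).op true (x, y) = some (x, z) := by
      show tenE C D (x, y) = _
      simp only [tenE]; rw [if_neg (by omega)]
      have : D.e y = some z := hz
      rw [this]; rfl
    rw [Cry.st, this]; exact ih z (by omega) h

lemma ten_st1 (N : ℕ) (x x' : X) (y : Y) (h1 : D.ep y ≤ C.ph x) (h2 : C.st true N x = some x') :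
    (ten C D).st true N (x, y) = some (x', y) := by
  induction N generalizing x with
  | zero => simp only [Cry.st, Option.some.injEq] at h2 ⊢; rw [h2]
  | succ m ih =>
    rw [Cry.st] at h2
    obtain ⟨z, hz, h⟩ := Option.bind_eq_some_iff.1 h2
    have h3 := C.e_ep _ _ hz
    have : (ten C D).op true (x, y) = some (z, y) := by
      show tenE C D (x, y) = _
      simp only [tenE]; rw [if_pos (by omega)]
      have : C.e x = some z := hz
      rw [this]; rfl
    rw [Cry.st, this]; exact ih z (by omega) h

lemma ten_st (M N : ℕ) (x x' : X) (y y' : Y) (hM : M = D.ep y - C.ph x)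
    (h1 : C.st true N x = some x') (h2 : D.st true M y = some y') :
    (ten C D).st true (M + N) (x, y) = some (x', y') := by
  by_cases h : D.ep y ≤ C.ph x
  · have : M = 0 := by omega
    subst this
    simp only [Cry.st, Option.some.injEq] at h2; subst h2
    rw [Nat.zero_add]; exact ten_st1 C D N x x' y h h1
  · have e := st_val D M y y' h2
    exact st_trans _ _ _ _ _ _ _ (ten_st2 C D M x y y' (by omega) h2) (ten_st1 C D N x x' y' (by omega) h1)

def MaxSt (u v : X) : Prop := C.st true (C.ep u) u = some v

lemma ten_max (x x' : X) (y y' : Y) (h1 : MaxSt C x x') (h2 : D.st true (D.ep y - C.ph x) y = some y') :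
    MaxSt (ten C D) (x, y) (x', y') := by
  have := ten_st C D _ _ x x' y y' rfl h1 h2
  unfold MaxSt
  rw [← this]; congr 1; simp only [ten]; omega
end st

lemma Mor.st {X Y : Type} {C : Cry X} {D : Cry Y} {φ : X → Y} (h : Mor C D φ) (b : Bool) (m : ℕ) (x y : X)
    (hx : C.st b m x = some y) : D.st b m (φ x) = some (φ y) := by
  induction m generalizing x with
  | zero => simp only [Cry.st, Option.some.injEq] at hx ⊢; rw [hx]
  | succ m ih =>
    rw [Cry.st] at hx
    obtain ⟨z, hz, hx⟩ := Option.bind_eq_some_iff.1 hx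
    rw [Cry.st, h.op b _ _ hz]; exact ih z hx

/-! closed forms -/
lemma four_st (p q r s : ℕ) (h : p ≠ q ∧ p ≠ r ∧ p ≠ s ∧ q ≠ r ∧ q ≠ s ∧ r ≠ s) (M : ℕ) (c : Row)
    (hM : M ≤ c s + (c q - c r)) : (fourC p q r s h).st true M c = some (fun j =>
      if j = p then c p + min M (c q - c r) else if j = q then c q - min M (c q - c r)
      else if j = r then c r + (M - (c q - c r)) else if j = s then c s - (M - (c q - c r)) else c j) := by
  induction M with
  | zero =>
    simp only [Cry.st, Option.some.injEq]; funext j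
    split_ifs <;> subst_vars <;> simp
  | succ M ih =>
    rw [st_succ, ih (by omega)]
    obtain ⟨a1, a2, a3, a4, a5, a6⟩ := h
    have b1 := a1.symm; have b2 := a2.symm; have b3 := a3.symm; have b4 := a4.symm
    have b5 := a5.symm; have b6 := a6.symm
    simp only [Option.bind_some, Cry.op, fourC, if_true, if_neg b4, if_neg b5, if_neg b6, if_neg b1, if_neg b2, if_neg b3]
    by_cases hh : M < c q - c r
    · rw [if_pos (by omega)]
      congr 1; funext j; simp only [mv]
      by_cases j1 : j = p
      · subst j1; simp only [if_pos]; omega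
      by_cases j2 : j = q
      · subst j2; simp only [if_pos, if_neg b1]; omega
      by_cases j3 : j = r
      · subst j3; simp only [if_pos, if_neg b2, if_neg b4]; omega
      by_cases j4 : j = s
      · subst j4; simp only [if_pos, if_neg b3, if_neg b5, if_neg b6]; omega
      simp only [if_neg j1, if_neg j2, if_neg j3, if_neg j4]
    · rw [if_neg (by omega), if_pos (by omega)]
      congr 1; funext j; simp only [mv]
      by_cases j1 : j = p
      · subst j1; simp only [if_pos, if_neg a2, if_neg a3]; omega
      by_cases j2 : j = q
      · subst j2; simp only [if_pos, if_neg b1, if_neg a4, if_neg a5]; omega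
      by_cases j3 : j = r
      · subst j3; simp only [if_pos, if_neg b2, if_neg b4]; omega
      by_cases j4 : j = s
      · subst j4; simp only [if_pos, if_neg b3, if_neg b5, if_neg b6]; omega
      simp only [if_neg j1, if_neg j2, if_neg j3, if_neg j4]

lemma two_st (a b : ℕ) (h : a ≠ b) (M : ℕ) (c : Row) (hM : M ≤ c b) :
   (twoC a b h).st true M c = some (fun j => if j = a then c a + M else if j = b then c b - M else c j) := by
  induction M with
  | zero =>
    simp only [Cry.st, Option.some.injEq]; funext j
    split_ifs <;> subst_vars <;> simp
  | succ M ih =>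
    rw [st_succ, ih (by omega)]
    simp only [Option.bind_some, Cry.op, twoC, if_true, if_neg h.symm]
    rw [if_pos (by omega)]
    congr 1; funext j; simp only [mv]
    split_ifs <;> omega

def mk (n A B t C D E : ℕ) : Row := fun j =>
  if j = 0 then A else if j = 1 then B else if j = t then C else if j = 2 * n then D
  else if j = 2 * n + 1 then E else 0

section mk
variable (n : ℕ) (hn : 2 ≤ n) (A B t C D E : ℕ) (ht : 2 ≤ t ∧ t < 2 * n)
lemma mk0 : mk n A B t C D E 0 = A := rfl
lemma mk1 : mk n A B t C D E 1 = B := rfl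
include ht
lemma mkt : mk n A B t C D E t = C := by simp only [mk]; rw [if_neg (by omega), if_neg (by omega), if_pos trivial]
lemma mkD : mk n A B t C D E (2 * n) = D := by
  simp only [mk]; rw [if_neg (by omega), if_neg (by omega), if_neg (by omega), if_pos trivial]
lemma mkE : mk n A B t C D E (2 * n + 1) = E := by
  simp only [mk]; rw [if_neg (by omega), if_neg (by omega), if_neg (by omega), if_neg (by omega), if_pos trivial]
lemma mkz (j : ℕ) (h : 2 ≤ j) (h1 : j < 2 * n) (h2 : j ≠ t) : mk n A B t C D E j = 0 := by
  simp only [mk]; rw [if_neg (by omega), if_neg (by omega), if_neg (by omega), if_neg (by omega), if_neg (by omega)]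

include hn
lemma rw0_ep : (rowC n 0 (Nat.zero_le n)).ep (mk n A B t C D E) = E + (B - D) ∧
    (rowC n 0 (Nat.zero_le n)).ph (mk n A B t C D E) = A + (D - B) := by
  rw [rowC, dif_neg (by omega)]
  simp only [fourC, Nat.sub_zero, Nat.zero_add, mk0, mk1, mkD n A B t C D E ht, mkE n A B t C D E ht]
  simp

lemma rw0_st (M : ℕ) (hM : M ≤ E + (B - D)) : (rowC n 0 (Nat.zero_le n)).st true M (mk n A B t C D E) =
   some (mk n (A + min M (B - D)) (B - min M (B - D)) t C (D + (M - (B - D))) (E - (M - (B - D)))) := by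
  rw [rowC, dif_neg (by omega), four_st _ _ _ _ _ _ _
    (by simp only [Nat.sub_zero, Nat.zero_add, mk0, mk1, mkD n A B t C D E ht, mkE n A B t C D E ht]; exact hM)]
  simp only [Nat.sub_zero, Nat.zero_add, mk0, mk1, mkD n A B t C D E ht, mkE n A B t C D E ht]
  congr 1; funext j; simp only [mk]
  split_ifs <;> omega

lemma aff_ep (h : A = E) : (affC n hn).ep (mk n A B t C D E) = A + (B - D) ∧
    (affC n hn).ph (mk n A B t C D E) = A + (D - B) := by
  subst h
  simp only [affC, mk0, mk1, mkD n A B t C D A ht, mkE n A B t C D A ht, min_self, and_self]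

lemma aff_st1 (M : ℕ) (hM : M ≤ A) : (affC n hn).st true M (mk n A 0 t C D A) =
   some (mk n (A - M) 0 t C (D + 2 * M) (A - M)) := by
  induction M with
  | zero => rfl
  | succ M ih =>
    rw [st_succ, ih (by omega)]
    simp only [Option.bind_some, Cry.op, affC, if_true]
    rw [mk0, mk1, mkD n _ _ t _ _ _ ht, mkE n _ _ t _ _ _ ht, if_neg (by omega), if_neg (by omega), if_pos (by omega)]
    congr 1; funext j; simp only [mk, mv]
    split_ifs <;> omega
lemma aff_st2 (M : ℕ) (hM : 2 * M ≤ B) : (affC n hn).st true M (mk n A B t C 0 E) =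
   some (mk n (A + M) (B - 2 * M) t C 0 (E + M)) := by
  induction M with
  | zero => rfl
  | succ M ih =>
    rw [st_succ, ih (by omega)]
    simp only [Option.bind_some, Cry.op, affC, if_true]
    rw [mk0, mk1, mkD n _ _ t _ _ _ ht, if_pos (by omega)]
    congr 1; funext j; simp only [mk, mv]
    split_ifs <;> omega
lemma aff_st3 : (affC n hn).st true 1 (mk n A 1 t C 0 A) = some (mk n A 0 t C 1 A) := by
  rw [st_one]
  simp only [Cry.op, affC, if_true]
  rw [mk0, mk1, mkD n _ _ t _ _ _ ht, if_neg (by omega), if_pos (by omega)]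
  congr 1; funext j; simp only [mk, mv]
  split_ifs <;> omega
lemma aff_st4 : (affC n hn).st true (A + B) (mk n A B t C 0 A) = some (mk n 0 0 t C (B + 2 * A) 0) := by
  have h2 := aff_st2 n hn A B t C A ht (B / 2) (by omega)
  rcases Nat.mod_two_eq_zero_or_one B with h | h
  · rw [show B - 2 * (B / 2) = 0 by omega] at h2
    have h1 := aff_st1 n hn (A + B / 2) t C 0 ht (A + B / 2) le_rfl
    have := st_trans _ _ _ _ _ _ _ h2 h1
    rw [show B / 2 + (A + B / 2) = A + B by omega] at this
    rw [this]; congr 2 <;> omega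
  · rw [show B - 2 * (B / 2) = 1 by omega] at h2
    have h3 := aff_st3 n hn (A + B / 2) t C ht
    have h1 := aff_st1 n hn (A + B / 2) t C 1 ht (A + B / 2) le_rfl
    have := st_trans _ _ _ _ _ _ _ (st_trans _ _ _ _ _ _ _ h2 h3) h1
    rw [show B / 2 + 1 + (A + B / 2) = A + B by omega] at this
    rw [this]; congr 2 <;> omega

lemma rwt_st (i : ℕ) (hi : i ≤ n) (ht : 3 ≤ t ∧ t < 2 * n) (h : t = i + 1 ∨ t + i = 2 * n + 1) :
    (rowC n i hi).st true C (mk n A B t C D E) = some (mk n A B (t - 1) C D E) ∧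
    (rowC n i hi).ep (mk n A B t C D E) = C ∧ (rowC n i hi).ph (mk n A B t C D E) = 0 := by
  rw [rowC]
  have ht' : 2 ≤ t ∧ t < 2 * n := by omega
  split_ifs with hin
  · subst hin
    have e : i + 1 = t := by omega
    have e1 := mkt i A B t C D E ht'
    have e2 := mkz i A B t C D E ht' i (by omega) (by omega) (by omega)
    rw [← e] at e1 e2 ⊢
    rw [two_st _ _ _ _ _ (by rw [e1])]
    simp only [twoC]
    refine ⟨?_, e1, e2⟩
    rw [e1, e2]
    congr 1; funext j; simp only [mk]
    split_ifs <;> omega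
  · rcases h with h | h
    · subst h
      have e1 := mkt n A B _ C D E ht'
      have e2 := mkz n A B _ C D E ht' i (by omega) (by omega) (by omega)
      have e3 := mkz n A B _ C D E ht' (2 * n - i) (by omega) (by omega) (by omega)
      have e4 := mkz n A B _ C D E ht' (2 * n + 1 - i) (by omega) (by omega) (by omega)
      rw [four_st _ _ _ _ _ _ _ (by rw [e1, e3]; omega)]
      simp only [fourC]
      rw [e1, e2, e3, e4]
      refine ⟨?_, by omega, by omega⟩
      congr 1; funext j; simp only [mk]; clear e1 e2 e3 e4; clear ht'
      grind
    · have e : 2 * n + 1 - i = t := by omega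
      have e1 := mkt n A B _ C D E ht'
      have e2 := mkz n A B _ C D E ht' i (by omega) (by omega) (by omega)
      have e3 := mkz n A B _ C D E ht' (2 * n - i) (by omega) (by omega) (by omega)
      have e4 := mkz n A B _ C D E ht' (i + 1) (by omega) (by omega) (by omega)
      rw [four_st _ _ _ _ _ _ _ (by rw [e, e1]; omega)]
      simp only [fourC]
      rw [e, e1, e2, e3, e4]
      refine ⟨?_, by omega, by omega⟩
      congr 1; funext j; simp only [mk]; clear e1 e2 e3 e4; clear ht'
      grind
end mk
section mk1
variable (n : ℕ) (hn : 2 ≤ n) (A B C D E : ℕ)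
include hn
lemma rw1_ep : (rowC n 1 (by omega)).ep (mk n A B 2 C D E) = D + C ∧
    (rowC n 1 (by omega)).ph (mk n A B 2 C D E) = B := by
  rw [rowC, dif_neg (by omega)]
  have e1 : mk n A B 2 C D E (1 + 1) = C := mkt n A B 2 C D E (by omega)
  have e2 := mkz n A B 2 C D E (by omega) (2 * n - 1) (by omega) (by omega) (by omega)
  have e3 := mkD n A B 2 C D E (by omega)
  simp only [fourC]
  rw [show 2 * n + 1 - 1 = 2 * n by omega, e1, e2, e3, mk1]; omega

lemma rw1_sta (M : ℕ) (hM : M ≤ C) : (rowC n 1 (by omega)).st true M (mk n A B 2 C D E) =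
   some (mk n A (B + M) 2 (C - M) D E) := by
  rw [rowC, dif_neg (by omega)]
  have e1 : mk n A B 2 C D E (1 + 1) = C := mkt n A B 2 C D E (by omega)
  have e2 := mkz n A B 2 C D E (by omega) (2 * n - 1) (by omega) (by omega) (by omega)
  have e3 := mkD n A B 2 C D E (by omega)
  rw [four_st _ _ _ _ _ _ _ (by rw [e1, e2]; omega)]
  rw [show 2 * n + 1 - 1 = 2 * n by omega, e1, e2, e3, mk1]
  congr 1; funext j; simp only [mk]
  split_ifs <;> omega
lemma rw1_stb : (rowC n 1 (by omega)).st true (D + C) (mk n A B 2 C D E) =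
   some (mk n A (B + C) (2 * n - 1) D 0 E) := by
  rw [rowC, dif_neg (by omega)]
  have e1 : mk n A B 2 C D E (1 + 1) = C := mkt n A B 2 C D E (by omega)
  have e2 := mkz n A B 2 C D E (by omega) (2 * n - 1) (by omega) (by omega) (by omega)
  have e3 := mkD n A B 2 C D E (by omega)
  rw [four_st _ _ _ _ _ _ _ (by rw [show 2 * n + 1 - 1 = 2 * n by omega, e1, e2, e3]; omega)]
  rw [show 2 * n + 1 - 1 = 2 * n by omega, e1, e2, e3, mk1]
  congr 1; funext j; simp only [mk]
  split_ifs <;> omega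
end mk1


def aC (n : ℕ) (hn : 2 ≤ n) : Cry (Row × Row) := ten (affC n hn) (affC n hn)

def HH (n a p d e f g : ℕ) : Row × Row := (mk n a (f + g + p) 2 0 0 a, mk n d e 2 f g d)
def VV (n a p d e f g : ℕ) : Row × Row := (mk n a (f + g) 2 p 0 a, mk n d 0 2 (e + f) g d)

section path
variable (n : ℕ) (hn : 2 ≤ n)
include hn
lemma one_le : 1 ≤ n := by omega

lemma S0 (a p d e f g : ℕ) : (pC n 1 (one_le n hn)).st true (e + p) (VV n a p d e f g) = some (HH n a p d e f g) := by
  refine ten_st _ _ e p _ _ _ _ ?_ ?_ ?_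
  · rw [(rw1_ep n hn _ _ _ _ _).1, (rw1_ep n hn _ _ _ _ _).2]; omega
  · rw [rw1_sta n hn _ _ _ _ _ p le_rfl, Nat.sub_self]
  · rw [rw1_sta n hn _ _ _ _ _ e (by omega), Nat.zero_add, Nat.add_sub_cancel_left]

lemma S0ep (a p d e f g : ℕ) : (pC n 1 (one_le n hn)).ep (VV n a p d e f g) = e + p := by
  show (rowC n 1 _).ep _ + ((rowC n 1 _).ep _ - (rowC n 1 _).ph _) = _
  rw [VV, (rw1_ep n hn _ _ _ _ _).1, (rw1_ep n hn _ _ _ _ _).2, (rw1_ep n hn _ _ _ _ _).1]; omega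

lemma S1 (a p d e f g : ℕ) (h : a = 0 ∨ d = 0) : (pC n 0 (Nat.zero_le n)).st true (d + (a + f + g)) (VV n a p d e f g) =
    some (mk n (a + f + g) 0 2 p a 0, mk n d 0 2 (e + f) (g + d) 0) := by
  refine ten_st _ _ _ _ _ _ _ _ ?_ ?_ ?_
  · rw [(rw0_ep n hn _ _ _ _ _ _ (by omega)).1, (rw0_ep n hn _ _ _ _ _ _ (by omega)).2]; omega
  · rw [rw0_st n hn _ _ _ _ _ _ (by omega) _ (by omega)]; congr 2 <;> omega
  · rw [rw0_st n hn _ _ _ _ _ _ (by omega) _ (by omega)]; congr 2 <;> omega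

/-- full `e_1` -/
lemma S2 (A1 C1 D1 E1 A2 B2 C2 D2 E2 : ℕ) : 
    MaxSt (pC n 1 (one_le n hn)) (mk n A1 0 2 C1 D1 E1, mk n A2 B2 2 C2 D2 E2)
    (mk n A1 C1 (2 * n - 1) D1 0 E1, mk n A2 (B2 + C2) (2 * n - 1) D2 0 E2) ∧
    (pC n 1 (one_le n hn)).ep (mk n A1 0 2 C1 D1 E1, mk n A2 B2 2 C2 D2 E2) = C1 + D1 + C2 + D2 := by
  constructor
  · refine ten_max _ _ _ _ _ _ ?_ ?_
    · unfold MaxSt; rw [(rw1_ep n hn _ _ _ _ _).1, rw1_stb n hn, Nat.zero_add]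
    · rw [(rw1_ep n hn _ _ _ _ _).1, (rw1_ep n hn _ _ _ _ _).2, Nat.sub_zero, rw1_stb n hn]
  · show (rowC n 1 _).ep _ + ((rowC n 1 _).ep _ - (rowC n 1 _).ph _) = _
    rw [(rw1_ep n hn _ _ _ _ _).1, (rw1_ep n hn _ _ _ _ _).2, (rw1_ep n hn _ _ _ _ _).1]; omega

lemma ST (t i : ℕ) (hi : i ≤ n) (ht : 3 ≤ t ∧ t < 2 * n) (h : t = i + 1 ∨ t + i = 2 * n + 1)
    (A1 B1 C1 D1 E1 A2 B2 C2 D2 E2 : ℕ) : 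
    MaxSt (pC n i hi) (mk n A1 B1 t C1 D1 E1, mk n A2 B2 t C2 D2 E2)
      (mk n A1 B1 (t - 1) C1 D1 E1, mk n A2 B2 (t - 1) C2 D2 E2) ∧
    (pC n i hi).ep (mk n A1 B1 t C1 D1 E1, mk n A2 B2 t C2 D2 E2) = C1 + C2 := by
  have h1 := rwt_st n hn A1 B1 t C1 D1 E1 (by omega) i hi ht h
  have h2 := rwt_st n hn A2 B2 t C2 D2 E2 (by omega) i hi ht h
  constructor
  · refine ten_max _ _ _ _ _ _ ?_ ?_
    · unfold MaxSt; rw [h1.2.1]; exact h1.1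
    · rw [h1.2.2, h2.2.1]; exact h2.1
  · show (rowC n i _).ep _ + ((rowC n i _).ep _ - (rowC n i _).ph _) = _
    rw [h1.2.2, h2.2.1, h1.2.1]; rfl

/-- `e_1` without `1̄` -/
lemma S3 (A1 B1 C1 E1 A2 B2 C2 E2 : ℕ) : 
    MaxSt (pC n 1 (one_le n hn)) (mk n A1 B1 2 C1 0 E1, mk n A2 B2 2 C2 0 E2)
    (mk n A1 (B1 + C1) 2 0 0 E1, mk n A2 (B2 + (C2 - B1)) 2 (C2 - (C2 - B1)) 0 E2) ∧
    (pC n 1 (one_le n hn)).ep (mk n A1 B1 2 C1 0 E1, mk n A2 B2 2 C2 0 E2) = C1 + (C2 - B1) := by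
  constructor
  · refine ten_max _ _ _ _ _ _ ?_ ?_
    · unfold MaxSt; rw [(rw1_ep n hn _ _ _ _ _).1, rw1_sta n hn _ _ _ _ _ _ (by omega), Nat.zero_add, Nat.sub_self]
    · rw [(rw1_ep n hn _ _ _ _ _).1, (rw1_ep n hn _ _ _ _ _).2, Nat.zero_add, rw1_sta n hn _ _ _ _ _ _ (by omega)]
  · show (rowC n 1 _).ep _ + ((rowC n 1 _).ep _ - (rowC n 1 _).ph _) = _
    rw [(rw1_ep n hn _ _ _ _ _).1, (rw1_ep n hn _ _ _ _ _).2, (rw1_ep n hn _ _ _ _ _).1]; omega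

/-- `e_0` without barred letters -/
lemma S4 (A1 B1 C1 A2 B2 C2 : ℕ) : 
    (pC n 0 (Nat.zero_le n)).st true ((B2 - A1) + B1) (mk n A1 B1 2 C1 0 0, mk n A2 B2 2 C2 0 0) = some
    (mk n (A1 + B1) 0 2 C1 0 0, mk n (A2 + (B2 - A1)) (B2 - (B2 - A1)) 2 C2 0 0) := by
  refine ten_st _ _ _ _ _ _ _ _ ?_ ?_ ?_
  · rw [(rw0_ep n hn _ _ _ _ _ _ (by omega)).1, (rw0_ep n hn _ _ _ _ _ _ (by omega)).2]; omega
  · rw [rw0_st n hn _ _ _ _ _ _ (by omega) _ (by omega)]; congr 2 <;> omega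
  · rw [rw0_st n hn _ _ _ _ _ _ (by omega) _ (by omega)]; congr 2 <;> omega

/-! affine -/
lemma A1 (a p d e f g : ℕ) : MaxSt (aC n hn) (VV n a p d e f g)
    (mk n 0 0 2 p (f + g + 2 * a) 0, mk n (min a d) 0 2 (e + f) (g + 2 * (d - a)) (min a d)) ∧
    (aC n hn).ep (VV n a p d e f g) = a + f + g + (d - a) := by
  constructor
  · refine ten_max _ _ _ _ _ _ ?_ ?_
    · unfold MaxSt; rw [(aff_ep n hn _ _ _ _ _ _ (by omega) rfl).1, Nat.sub_zero, aff_st4 n hn _ _ _ _ (by omega)]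
    · rw [(aff_ep n hn _ _ _ _ _ _ (by omega) rfl).1, (aff_ep n hn _ _ _ _ _ _ (by omega) rfl).2,
        show d + (0 - g) - (a + (0 - (f + g))) = d - a by omega, aff_st1 n hn _ _ _ _ (by omega) _ (by omega)]
      congr 2 <;> omega
  · show (affC n hn).ep _ + ((affC n hn).ep _ - (affC n hn).ph _) = _
    rw [VV, (aff_ep n hn _ _ _ _ _ _ (by omega) rfl).1, (aff_ep n hn _ _ _ _ _ _ (by omega) rfl).1, (aff_ep n hn _ _ _ _ _ _ (by omega) rfl).2]
    omega
end path

/-! classical transport of runs -/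
def asc (n : ℕ) (c : Row) : List ℕ := (rdw n c).reverse
def Cc (n m : ℕ) (u u' : Row × Row) : Prop :=
  Run n m (asc n u.1) (asc n u.2) ∧ outw n m (asc n u.1) (asc n u.2) = wp n u'

lemma ten_op_cases {X Y : Type} (C : Cry X) (D : Cry Y) (b : Bool) (u v : X × Y) (h : (ten C D).op b u = some v) :
    (C.op b u.1 = some v.1 ∧ v.2 = u.2) ∨ (v.1 = u.1 ∧ D.op b u.2 = some v.2) := by
  obtain ⟨x, y⟩ := u
  cases b
  · simp only [Cry.op, ten, tenF, Bool.false_eq_true, if_false] at h ⊢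
    split_ifs at h <;> obtain ⟨c, hc, rfl⟩ := Option.map_eq_some_iff.1 h
    · exact Or.inl ⟨hc, rfl⟩
    · exact Or.inr ⟨rfl, hc⟩
  · simp only [Cry.op, ten, tenE, if_true] at h ⊢
    split_ifs at h <;> obtain ⟨c, hc, rfl⟩ := Option.map_eq_some_iff.1 h
    · exact Or.inl ⟨hc, rfl⟩
    · exact Or.inr ⟨rfl, hc⟩

lemma row_len (n i : ℕ) (hi : i ≤ n) (b : Bool) (c c' : Row) (h : (rowC n i hi).op b c = some c') :
    (rdw n c').length = (rdw n c).length := op_len _ b _ _ ((rdw_mor n i hi).op b _ _ h)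

lemma Cc_op (n m i : ℕ) (hi : i ≤ n) (b : Bool) (u u' v v' : Row × Row) (h : Cc n m u u')
    (h1 : (pC n i hi).op b u = some v) (h2 : (pC n i hi).op b u' = some v') : Cc n m v v' := by
  have hl : (rdw n v.1).length = (rdw n u.1).length ∧ (rdw n v.2).length = (rdw n u.2).length := by
    rcases ten_op_cases _ _ _ _ _ h1 with ⟨a, e⟩ | ⟨e, a⟩
    · rw [e]; exact ⟨row_len _ _ _ _ _ _ a, rfl⟩
    · rw [e]; exact ⟨rfl, row_len _ _ _ _ _ _ a⟩
  have w1 := (wp_mor n i hi).op b _ _ h1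
  have w2 := (wp_mor n i hi).op b _ _ h2
  have := run_par n i hi b m (asc n u.1) (asc n u.2) (asc n v.1) (asc n v.2) (by simp [asc, hl.1]) (by simp [asc, hl.2])
    h.1 (by simpa [asc, wp] using w1)
  refine ⟨this.1, ?_⟩
  have h3 := this.2
  rw [h.2, w2] at h3
  exact (Option.some.inj h3).symm

lemma Cc_st (n m i : ℕ) (hi : i ≤ n) (b : Bool) (M : ℕ) (u u' v v' : Row × Row) (h : Cc n m u u')
    (h1 : (pC n i hi).st b M u = some v) (h2 : (pC n i hi).st b M u' = some v') : Cc n m v v' := by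
  induction M generalizing u u' with
  | zero =>
    simp only [Cry.st, Option.some.injEq] at h1 h2; subst h1 h2; exact h
  | succ M ih =>
    rw [Cry.st] at h1 h2
    obtain ⟨z, hz, h1⟩ := Option.bind_eq_some_iff.1 h1
    obtain ⟨z', hz', h2⟩ := Option.bind_eq_some_iff.1 h2
    exact ih z z' (Cc_op _ _ _ _ _ _ _ _ _ h hz hz') h1 h2

lemma Cc_back (n m i : ℕ) (hi : i ≤ n) (M M' : ℕ) (u u' v v' : Row × Row) (h : Cc n m v v') (hM : M = M')
    (h1 : (pC n i hi).st true M u = some v) (h2 : (pC n i hi).st true M' u' = some v') : Cc n m u u' := by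
  subst hM
  exact Cc_st n m i hi false M v v' u u' h (st_rev _ _ _ _ h1) (st_rev _ _ _ _ h2)

lemma Cc_t (n : ℕ) (hn : 2 ≤ n) (m A1 B1 C1 D1 E1 A2 B2 C2 D2 E2 A1' B1' C1' D1' E1' A2' B2' C2' D2' E2' t : ℕ)
    (ht : 2 ≤ t ∧ t < 2 * n) (hC : C1 + C2 = C1' + C2')
    (h : Cc n m (mk n A1 B1 2 C1 D1 E1, mk n A2 B2 2 C2 D2 E2) (mk n A1' B1' 2 C1' D1' E1', mk n A2' B2' 2 C2' D2' E2')) :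
    Cc n m (mk n A1 B1 t C1 D1 E1, mk n A2 B2 t C2 D2 E2) (mk n A1' B1' t C1' D1' E1', mk n A2' B2' t C2' D2' E2') := by
  induction t with
  | zero => omega
  | succ t ih =>
    by_cases h2 : t = 1
    · subst h2; exact h
    obtain ⟨i, hi, hit⟩ : ∃ i, i ≤ n ∧ (t + 1 = i + 1 ∨ (t + 1) + i = 2 * n + 1) := by
      by_cases t ≤ n
      · exact ⟨t, by omega, by omega⟩
      · exact ⟨2 * n - t, by omega, by omega⟩
    have a := ST n hn (t + 1) i hi (by omega) hit A1 B1 C1 D1 E1 A2 B2 C2 D2 E2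
    have b := ST n hn (t + 1) i hi (by omega) hit A1' B1' C1' D1' E1' A2' B2' C2' D2' E2'
    exact Cc_back n m i hi _ _ _ _ _ _ (ih (by omega)) (by rw [a.2, b.2]; exact hC) a.1 b.1

lemma seg_mk (n A B : ℕ) (m : ℕ) : seg (mk n A B 2 0 0 0) (m + 2) = List.replicate B 1 ++ List.replicate A 0 := by
  induction m with
  | zero => simp [seg, mk]
  | succ m ih =>
    rw [seg, ih]
    have : mk n A B 2 0 0 0 (m + 2) = 0 := by
      simp only [mk]; rw [if_neg (by omega), if_neg (by omega)]; split_ifs <;> rfl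
    rw [this]; rfl

lemma asc_top (n A B : ℕ) : asc n (mk n A B 2 0 0 0) = List.replicate A 0 ++ List.replicate B 1 := by
  simp [asc, rdw, seg_mk]

lemma Cc_top (n : ℕ) (hn : 2 ≤ n) (l k m A A' : ℕ) (hl : m ≤ l) (hk : m ≤ k) (hA : A = k - m) (hA' : A' = l - m) :
    Cc n m (mk n l 0 2 0 0 0, mk n A m 2 0 0 0) (mk n k 0 2 0 0 0, mk n A' m 2 0 0 0) := by
  have := run_top n hn l k m hl hk
  subst hA hA'
  refine ⟨by simpa only [asc_top, List.replicate_zero, List.append_nil] using this.1, ?_⟩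
  rw [asc_top, asc_top]
  simp only [List.replicate_zero, List.append_nil, this.2]
  simp [wp, rdw, seg_mk]

lemma arB1 (a p d e f g a' p' d' e' g' : ℕ) (h0 : a = 0 ∨ d = 0) (h0' : a' = 0 ∨ d' = 0)
    (hl : 2 * a + p + f + g = 2 * a' + e' + f + g') (hk : 2 * d + e + f + g = 2 * d' + p' + f + g')
    (hS : a + d + g = a' + d' + g')
    (hτ : min (g + 2 * (d - a)) p = min (g' + 2 * (a' - d')) p') :
    a + (g + d - p) = d' + (g' + a' - p') ∧ g + d - (g + d - p) = g' + a' - (g' + a' - p') := by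
  rcases h0 with rfl | rfl <;> rcases h0' with rfl | rfl <;> omega

lemma arB0 (a p d e f g q r : ℕ) (hq : g + d - p = q) (hr : 0 + (e + f) + q - (a + f + g) = r) :
    (p + a ≤ r + (p + a) ∧ e + d ≤ r + (p + a) ∧ e + p ≤ r + (p + a) + g) ∧ 
     (r + (p + a) ≤ p + a ∨ r + (p + a) ≤ e + d ∨ r + (p + a) + g ≤ e + p) := by omega

lemma arB3 (a d g : ℕ) (h0 : a = 0 ∨ d = 0) : g + 2 * (d - a) + a = a + d + g + d := by omega
lemma arB4 (x p : ℕ) : (min x p ≤ x ∧ min x p ≤ p) ∧ (x ≤ min x p ∨ p ≤ min x p) := by omega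
lemma arB2 (a p d e f g a' p' d' e' g' q q' r r' : ℕ) (h0 : a = 0 ∨ d = 0) (h0' : a' = 0 ∨ d' = 0)
    (hl : 2 * a + p + f + g = 2 * a' + e' + f + g') (hk : 2 * d + e + f + g = 2 * d' + p' + f + g')
    (hS : a + d + g = a' + d' + g')
    (hτ : min (g + 2 * (d - a)) p = min (g' + 2 * (a' - d')) p') (hq : g + d - p = q)
    (hq' : g' + a' - p' = q') (hr : 0 + (e + f) + q - (a + f + g) = r) (hr' : 0 + (e' + f) + q' - (d' + f + g') = r') :
    r + (p + a) = r' + (p' + d') := by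
  have h1 := arB0 a p d e f g q r hq hr
  have h2 := arB0 d' p' a' e' f g' q' r' hq' hr'
  clear hq hq' hr hr'
  generalize r + (p + a) = R at *
  generalize r' + (p' + d') = R' at *
  have e1 : g + 2 * (d - a) + a = a + d + g + d := arB3 a d g h0
  have e2 : g' + 2 * (a' - d') + d' = a' + d' + g' + a' := by rw [arB3 d' a' g' h0'.symm]; ring
  generalize g + 2 * (d - a) = x at *
  generalize g' + 2 * (a' - d') = x' at *
  have t1 : (min x p ≤ x ∧ min x p ≤ p) ∧ (x ≤ min x p ∨ p ≤ min x p) := arB4 x p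
  have t2 : (min x' p' ≤ x' ∧ min x' p' ≤ p') ∧ (x' ≤ min x' p' ∨ p' ≤ min x' p') := arB4 x' p'
  rw [← hτ] at t2
  generalize min x p = y at *
  clear hτ
  obtain ⟨⟨h3, h4, h5⟩, h6⟩ := h1
  obtain ⟨⟨h3', h4', h5'⟩, h6'⟩ := h2
  apply le_antisymm
  · clear h6'
    rcases h6 with h6 | h6 | h6 <;> rcases t1.2 with t | t <;> rcases t2.2 with t' | t' <;>
     rcases h0 with rfl | rfl <;> rcases h0' with rfl | rfl <;> omega
  · clear h6
    rcases h6' with h6 | h6 | h6 <;> rcases t1.2 with t | t <;> rcases t2.2 with t' | t' <;>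
     rcases h0 with rfl | rfl <;> rcases h0' with rfl | rfl <;> omega
/-- end of the path -/
def mm (a p d e f g : ℕ) : ℕ := min (min (a + p + f + g) (d + e + f + g)) (2 * g + f + a + d)

lemma arB5 (a p d e f g q r s : ℕ) (hq : g + d - p = q) (hr : 0 + (e + f) + q - (a + f + g) = r) (hs : g + d - q = s) :
    0 + (e + f) + q - r + s = mm a p d e f g ∧ d + r + mm a p d e f g = 2 * d + e + f + g := by
  unfold mm; omega
lemma mm_le (a p d e f g : ℕ) : mm a p d e f g ≤ 2 * a + p + f + g ∧ mm a p d e f g ≤ 2 * d + e + f + g := by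
  unfold mm; omega
lemma pathB (n : ℕ) (hn : 2 ≤ n) (a p d e f g a' p' d' e' g' : ℕ) (h0 : a = 0 ∨ d = 0) (h0' : a' = 0 ∨ d' = 0)
    (hl : 2 * a + p + f + g = 2 * a' + e' + f + g') (hk : 2 * d + e + f + g = 2 * d' + p' + f + g')
    (hS : a + d + g = a' + d' + g')
    (hτ : min (g + 2 * (d - a)) p = min (g' + 2 * (a' - d')) p') :
    Cc n (mm a p d e f g) (HH n a p d e f g) (HH n d' p' a' e' f g') := by
  obtain ⟨hqq, hss⟩ := arB1 a p d e f g a' p' d' e' g' h0 h0' hl hk hS hτ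
  refine Cc_st n _ 1 (one_le n hn) true (e + p) _ _ _ _ ?_ (S0 n hn a p d e f g)
    (by rw [show e + p = e' + p' by omega]; exact S0 n hn d' p' a' e' f g')
  refine Cc_back n _ 0 (Nat.zero_le n) _ _ _ _ _ _ ?_ (by omega) (S1 n hn a p d e f g h0) (S1 n hn d' p' a' e' f g' h0'.symm)
  have x1 := S2 n hn (a + f + g) p a 0 d 0 (e + f) (g + d) 0
  have x2 := S2 n hn (d' + f + g') p' d' 0 a' 0 (e' + f) (g' + a') 0
  refine Cc_back n _ 1 _ _ _ _ _ _ _ ?_ (by rw [x1.2, x2.2]; omega) x1.1 x2.1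
  clear x1 x2
  refine Cc_t n hn _ _ _ _ _ _ _ _ _ _ _ _ _ _ _ _ _ _ _ _ _ _ (by omega) (by omega) ?_
  have x1 := S3 n hn (a + f + g) p a 0 d (0 + (e + f)) (g + d) 0
  have x2 := S3 n hn (d' + f + g') p' d' 0 a' (0 + (e' + f)) (g' + a') 0
  refine Cc_back n _ 1 _ _ _ _ _ _ _ ?_ (by rw [x1.2, x2.2]; exact hqq) x1.1 x2.1
  clear x1 x2
  generalize hq : g + d - p = q
  generalize hq' : g' + a' - p' = q'
  rw [hq, hq'] at hqq hss
  generalize hB : 0 + (e + f) + q - (a + f + g) = r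
  generalize hB' : 0 + (e' + f) + q' - (d' + f + g') = r'
  have hr : r + (p + a) = r' + (p' + d') := arB2 a p d e f g a' p' d' e' g' q q' r r' h0 h0' hl hk hS hτ hq hq' hB hB'
  have x1 := S4 n hn (a + f + g) (p + a) 0 d (0 + (e + f) + q) (g + d - q)
  have x2 := S4 n hn (d' + f + g') (p' + d') 0 a' (0 + (e' + f) + q') (g' + a' - q')
  rw [hB] at x1
  rw [hB'] at x2
  refine Cc_back n _ 0 (Nat.zero_le n) _ _ _ _ _ _ ?_ hr x1 x2
  clear x1 x2
  generalize hs : g + d - q = s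
  generalize hs' : g' + a' - q' = s'
  rw [hs, hs'] at hss
  have x1 := S3 n hn (a + f + g + (p + a)) 0 0 0 (d + r) (0 + (e + f) + q - r) s 0
  have x2 := S3 n hn (d' + f + g' + (p' + d')) 0 0 0 (a' + r') (0 + (e' + f) + q' - r') s' 0
  refine Cc_back n _ 1 _ _ _ _ _ _ _ ?_ (by rw [x1.2, x2.2, hss]) x1.1 x2.1
  clear x1 x2
  obtain ⟨z1, z2⟩ := arB5 a p d e f g q r s hq hB hs
  obtain ⟨z1', z2'⟩ := arB5 d' p' a' e' f g' q' r' s' hq' hB' hs'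
  have z3 : mm d' p' a' e' f g' = mm a p d e f g := by
    clear h0 h0' hτ hqq hss hq hq' hB hB' hs hs' z1 z1'
    omega
  have z4 := mm_le a p d e f g
  have z4' := mm_le d' p' a' e' f g'
  rw [Nat.sub_zero, z1, Nat.sub_zero, z1', z3]
  rw [z3] at z2' z4'
  generalize mm a p d e f g = m at *
  clear h0 h0' hτ hqq hss hq hq' hB hB' hs hs' z1 z1' z3
  have x1 := S4 n hn (a + f + g + (p + a)) (0 + 0) 0 (d + r) m (s - s)
  have x2 := S4 n hn (d' + f + g' + (p' + d')) (0 + 0) 0 (a' + r') m (s' - s')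
  rw [show m - (a + f + g + (p + a)) = 0 by omega] at x1
  rw [show m - (d' + f + g' + (p' + d')) = 0 by omega] at x2
  refine Cc_back n _ 0 (Nat.zero_le n) _ _ _ _ _ _ ?_ rfl x1 x2
  clear x1 x2
  have := Cc_top n hn (2 * a + p + f + g) (2 * d + e + f + g) m (d + r) (a' + r') (by omega) (by omega) (by omega) (by omega)
  have key : ∀ A1 B1 A2 B2 A1' B1' A2' B2' C D, A1 = 2 * a + p + f + g → B1 = 0 → A2 = d + r → B2 = m →
    A1' = 2 * d + e + f + g → B1' = 0 → A2' = a' + r' → B2' = m → C = 0 → D = 0 → 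
    Cc n m (mk n A1 B1 2 0 0 0, mk n A2 B2 2 C 0 0) (mk n A1' B1' 2 0 0 0, mk n A2' B2' 2 D 0 0) := by
    rintro _ _ _ _ _ _ _ _ _ _ rfl rfl rfl rfl rfl rfl rfl rfl rfl rfl
    exact this
  apply key <;> omega


lemma mv_sum (N a b : ℕ) (c : Row) (hab : a ≠ b) (ha : a < N) (hb : b < N) (h : 0 < c a) :
    ∑ j ∈ Finset.range N, mv a b c j = ∑ j ∈ Finset.range N, c j := by
  have h1 : ∑ j ∈ Finset.range N, (mv a b c j + if j = a then 1 else 0) =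
      ∑ j ∈ Finset.range N, (c j + if j = b then 1 else 0) := by
    apply Finset.sum_congr rfl
    intro j _
    simp only [mv]
    split_ifs <;> subst_vars <;> omega
  rw [Finset.sum_add_distrib, Finset.sum_add_distrib, Finset.sum_ite_eq', Finset.sum_ite_eq'] at h1
  simp only [Finset.mem_range, ha, hb, if_true] at h1
  omega

def RB (n l : ℕ) (c : Row) : Prop :=
  c 0 = c (2 * n + 1) ∧ (∀ j, 2 * n + 2 ≤ j → c j = 0) ∧ ∑ j ∈ Finset.range (2 * n + 2), c j = l

lemma RB_mv1 (n l a b : ℕ) (c : Row) (hc : RB n l c) (ha : 1 ≤ a ∧ a ≤ 2 * n) (hb : 1 ≤ b ∧ b ≤ 2 * n) (hab : a ≠ b)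
    (h : 0 < c a) : RB n l (mv a b c) := by
  obtain ⟨h1, h2, h3⟩ := hc
  refine ⟨?_, ?_, ?_⟩
  · simp only [mv]
    rw [if_neg (by omega), if_neg (by omega), if_neg (by omega), if_neg (by omega), h1]
  · intro j hj
    simp only [mv]
    rw [if_neg (by omega), if_neg (by omega), h2 j hj]
  · rw [mv_sum _ _ _ _ hab (by omega) (by omega) h, h3]

lemma RB_row (n l i : ℕ) (h1 : 1 ≤ i) (hi : i ≤ n) (b : Bool) (c c' : Row) (hc : RB n l c)
    (h : (rowC n i hi).op b c = some c') : RB n l c' := by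
  rw [rowC] at h
  split_ifs at h with hin
  · cases b <;> simp only [Cry.op, twoC, Bool.false_eq_true, if_false, if_true] at h <;> split_ifs at h <;>
     simp only [Option.some.injEq, reduceCtorEq] at h <;> subst h <;> apply RB_mv1 _ _ _ _ _ hc <;> omega
  · cases b <;> simp only [Cry.op, fourC, Bool.false_eq_true, if_false, if_true] at h <;> split_ifs at h <;>
     simp only [Option.some.injEq, reduceCtorEq] at h <;> subst h <;> apply RB_mv1 _ _ _ _ _ hc <;> omega

lemma RB_mv2 (n l a b a' b' : ℕ) (c : Row) (hc : RB n l c) (ha : a < 2 * n + 2) (hb : b < 2 * n + 2)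
    (ha' : a' < 2 * n + 2) (hb' : b' < 2 * n + 2) (hab : a ≠ b) (hab' : a' ≠ b')
    (h : 0 < c a) (h' : 0 < mv a b c a') (h0 : mv a' b' (mv a b c) 0 = mv a' b' (mv a b c) (2 * n + 1)) :
     RB n l (mv a' b' (mv a b c)) := by
  obtain ⟨h1, h2, h3⟩ := hc
  refine ⟨h0, ?_, ?_⟩
  · intro j hj
    simp only [mv]
    rw [if_neg (by omega), if_neg (by omega), if_neg (by omega), if_neg (by omega), h2 j hj]
  · rw [mv_sum _ _ _ _ hab' ha' hb' h', mv_sum _ _ _ _ hab ha hb h, h3]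

lemma RB_aff (n l : ℕ) (hn : 2 ≤ n) (b : Bool) (c c' : Row) (hc : RB n l c)
    (h : (affC n hn).op b c = some c') : RB n l c' := by
  have e1 : 2 * n ≠ 0 := by omega
  have e2 : 2 * n ≠ 1 := by omega
  have e3 : 2 * n + 1 ≠ 1 := by omega
  have e4 : 2 * n + 1 ≠ 2 * n := by omega
  have e5 : 1 ≠ 2 * n := by omega
  have e6 : 1 ≠ 2 * n + 1 := by omega
  have e7 : 0 ≠ 2 * n := by omega
  have e8 : 0 ≠ 2 * n + 1 := by omega
  have e9 : 2 * n + 1 ≠ 0 := by omega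
  have e10 : 2 * n ≠ 2 * n + 1 := by omega
  have h0 := hc.1
  cases b <;> simp only [Cry.op, affC, Bool.false_eq_true, if_false, if_true] at h <;> split_ifs at h <;>
     simp only [Option.some.injEq, reduceCtorEq] at h <;> subst h
  · exact RB_mv2 _ _ _ _ _ _ _ hc (by omega) (by omega) (by omega) (by omega) (by omega) (by omega) (by omega)
      (by simp [mv, e1, e2, e3, e4, e5, e6, e7, e8, e9, e10]; omega) (by simp [mv, e1, e2, e3, e4, e5, e6, e7, e8, e9, e10]; omega)
  · exact RB_mv1 _ _ _ _ _ hc (by omega) (by omega) (by omega) (by omega)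
  · exact RB_mv2 _ _ _ _ _ _ _ hc (by omega) (by omega) (by omega) (by omega) (by omega) (by omega) (by omega)
      (by simp [mv, e1, e2, e3, e4, e5, e6, e7, e8, e9, e10]; omega) (by simp [mv, e1, e2, e3, e4, e5, e6, e7, e8, e9, e10]; omega)
  · exact RB_mv2 _ _ _ _ _ _ _ hc (by omega) (by omega) (by omega) (by omega) (by omega) (by omega) (by omega)
      (by simp [mv, e1, e2, e3, e4, e5, e6, e7, e8, e9, e10]; omega) (by simp [mv, e1, e2, e3, e4, e5, e6, e7, e8, e9, e10]; omega)
  · exact RB_mv1 _ _ _ _ _ hc (by omega) (by omega) (by omega) (by omega)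
  · exact RB_mv2 _ _ _ _ _ _ _ hc (by omega) (by omega) (by omega) (by omega) (by omega) (by omega) (by omega)
      (by simp [mv, e1, e2, e3, e4, e5, e6, e7, e8, e9, e10]; omega) (by simp [mv, e1, e2, e3, e4, e5, e6, e7, e8, e9, e10]; omega)

lemma mk_sum (n A B t C D E : ℕ) (ht : 2 ≤ t ∧ t < 2 * n) :
    ∑ j ∈ Finset.range (2 * n + 2), mk n A B t C D E j = A + B + C + D + E := by
  have : ∀ j ∈ Finset.range (2 * n + 2), mk n A B t C D E j = (if j = 0 then A else 0) + (if j = 1 then B else 0)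
      + (if j = t then C else 0) + (if j = 2 * n then D else 0) + (if j = 2 * n + 1 then E else 0) := by
    intro j _
    simp only [mk]
    split_ifs <;> omega
  rw [Finset.sum_congr rfl this]
  simp only [Finset.sum_add_distrib, Finset.sum_ite_eq', Finset.mem_range]
  rw [if_pos (by omega), if_pos (by omega), if_pos (by omega), if_pos (by omega), if_pos (by omega)]

lemma RB_mk (n l A B t C D E : ℕ) (ht : 2 ≤ t ∧ t < 2 * n) : RB n l (mk n A B t C D E) ↔ A = E ∧ A + B + C + D + E = l := by
  unfold RB
  rw [mk_sum _ _ _ _ _ _ _ ht, mk0, mkE n _ _ _ _ _ _ ht]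
  constructor
  · rintro ⟨h1, h2, h3⟩; exact ⟨h1, h3⟩
  · rintro ⟨h1, h3⟩
    refine ⟨h1, ?_, h3⟩
    intro j hj
    simp only [mk]
    rw [if_neg (by omega), if_neg (by omega), if_neg (by omega), if_neg (by omega), if_neg (by omega)]

/-! partial morphisms -/
section par
variable {X : Type} (C : Cry X) (R : X → Prop) (φ : X → X)
  (hR : ∀ b u v, R u → C.op b u = some v → R v)
  (hm : ∀ b u, R u → C.op b (φ u) = (C.op b u).map φ)
include hR
lemma par_R (b : Bool) (m : ℕ) (u v : X) (hu : R u) (h : C.st b m u = some v) : R v := by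
  induction m generalizing u with
  | zero => simp only [Cry.st, Option.some.injEq] at h; subst h; exact hu
  | succ m ih =>
    rw [Cry.st] at h
    obtain ⟨z, hz, h⟩ := Option.bind_eq_some_iff.1 h
    exact ih z (hR _ _ _ hu hz) h
include hm
lemma par_st (b : Bool) (m : ℕ) (u : X) (hu : R u) : C.st b m (φ u) = (C.st b m u).map φ := by
  induction m generalizing u with
  | zero => rfl
  | succ m ih =>
    rw [Cry.st, Cry.st, hm b u hu]
    cases h : C.op b u with
    | none => rfl
    | some z => exact ih z (hR _ _ _ hu h)
lemma par_ep (u : X) (hu : R u) : C.ep (φ u) = C.ep u := by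
  have key : ∀ m, m ≤ C.ep (φ u) ↔ m ≤ C.ep u := by
    intro m
    rw [← st_ex, ← st_ex, par_st C R φ hR hm true m u hu]
    cases C.st true m u <;> simp
  exact le_antisymm ((key _).1 le_rfl) ((key _).2 le_rfl)
lemma par_ph (u : X) (hu : R u) : C.ph (φ u) = C.ph u := by
  have key : ∀ m, m ≤ C.ph (φ u) ↔ m ≤ C.ph u := by
    intro m
    rw [← st_exf, ← st_exf, par_st C R φ hR hm false m u hu]
    cases C.st false m u <;> simp
  exact le_antisymm ((key _).1 le_rfl) ((key _).2 le_rfl)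
end par

lemma rowC_ep (n i : ℕ) (hi : i < n) (c : Row) : (rowC n i hi.le).ep c = c (2 * n + 1 - i) + (c (i + 1) - c (2 * n - i)) ∧
    (rowC n i hi.le).ph c = c i + (c (2 * n - i) - c (i + 1)) := by
  rw [rowC, dif_neg (by omega)]; exact ⟨rfl, rfl⟩
lemma rowC_epn (n : ℕ) (c : Row) : (rowC n n le_rfl).ep c = c (n + 1) ∧ (rowC n n le_rfl).ph c = c n := by
  rw [rowC, dif_pos rfl]; exact ⟨rfl, rfl⟩

lemma row_hw (n : ℕ) (hn : 2 ≤ n) (c : Row) (m : ℕ) (hm : 1 ≤ m ∧ m ≤ n) (h : ∀ i (hi : i ≤ n), m ≤ i → (rowC n i hi).ep c = 0) :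
    (∀ j, n + 1 ≤ j → j + m ≤ 2 * n + 1 → c j = 0) ∧ (∀ j, m + 1 ≤ j → j ≤ n → c j = 0) := by
  have A : (∀ j, n + 1 ≤ j → j + m ≤ 2 * n + 1 → c j = 0) := by
    intro j h1 h2
    by_cases hj : j = n + 1
    · rw [hj, ← (rowC_epn n c).1]; exact h n le_rfl hm.2
    · have := h (2 * n + 1 - j) (by omega) (by omega)
      rw [(rowC_ep n (2 * n + 1 - j) (by omega) c).1, show 2 * n + 1 - (2 * n + 1 - j) = j by omega] at this
      omega
  refine ⟨A, ?_⟩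
  intro j h1 h2
  have := h (j - 1) (by omega) (by omega)
  rw [(rowC_ep n (j - 1) (by omega) c).1, show j - 1 + 1 = j by omega, A (2 * n - (j - 1)) (by omega) (by omega)] at this
  omega

lemma classify (n l k : ℕ) (hn : 2 ≤ n) (u : Row × Row) (h1 : RB n l u.1) (h2 : RB n k u.2)
    (h : ∀ i (hi : i ≤ n), 1 ≤ i → (pC n i hi).ep u = 0) :
    ∃ a p d e f g, u = HH n a p d e f g := by
  obtain ⟨c, d⟩ := u
  have hc : ∀ i (hi : i ≤ n), 1 ≤ i → (rowC n i hi).ep c = 0 ∧ (rowC n i hi).ep d ≤ (rowC n i hi).ph c := by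
    intro i hi h1
    have : (rowC n i _).ep c + ((rowC n i _).ep d - (rowC n i _).ph c) = 0 := h i hi h1
    omega
  obtain ⟨c1, c2⟩ := row_hw n hn c 1 (by omega) (fun i hi h => (hc i hi h).1)
  have hph : ∀ i (hi : i ≤ n), 2 ≤ i → (rowC n i hi).ph c = 0 := by
    intro i hi h
    rcases Nat.lt_or_ge i n with hh | hh
    · rw [(rowC_ep n i hh c).2, c2 i (by omega) (by omega), c1 (2 * n - i) (by omega) (by omega)]; omega
    · have : i = n := by omega
      subst this
      rw [(rowC_epn i c).2, c2 i (by omega) (by omega)]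
  obtain ⟨d1, d2⟩ := row_hw n hn d 2 (by omega) (fun i hi h => by have := (hc i hi (by omega)).2; rw [hph i hi h] at this; omega)
  have e1 := (hc 1 (by omega) le_rfl).2
  rw [(rowC_ep n 1 (by omega) d).1, (rowC_ep n 1 (by omega) c).2, d1 (2 * n - 1) (by omega) (by omega), c1 (2 * n - 1) (by omega) (by omega),
    show 2 * n + 1 - 1 = 2 * n by omega, show 1 + 1 = 2 by omega] at e1
  refine ⟨c 0, c 1 - d 2 - d (2 * n), d 0, d 1, d 2, d (2 * n), ?_⟩
  unfold HH
  congr 1 <;> funext j <;> simp only [mk] <;> split_ifs with x1 x2 x3 x4 x5 <;> subst_vars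
  · rfl
  · omega
  · exact c2 2 (by omega) (by omega)
  · exact c1 _ (by omega) (by omega)
  · exact h1.1.symm
  · by_cases hj : j ≤ n
    · exact c2 j (by omega) hj
    by_cases hj : j ≤ 2 * n
    · exact c1 j (by omega) (by omega)
    · exact h1.2.1 j (by omega)
  · rfl
  · rfl
  · rfl
  · rfl
  · exact h2.1.symm
  · by_cases hj : j ≤ n
    · exact d2 j (by omega) hj
    by_cases hj : j ≤ 2 * n
    · exact d1 j (by omega) (by omega)
    · exact h2.2.1 j (by omega)


def RR (n l k : ℕ) (u : Row × Row) : Prop := RB n l u.1 ∧ RB n k u.2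
def dx (n : ℕ) (hn : 2 ≤ n) (u : Row × Row) : ℕ := (affC n hn).ep u.2 - (affC n hn).ph u.1

structure IH (n l k : ℕ) (hn : 2 ≤ n) (φ : Row × Row → Row × Row) (H : Row × Row → ℤ) : Prop where
  mem : ∀ u, RR n l k u → RR n k l (φ u)
  cl : ∀ i (hi : i ≤ n), 1 ≤ i → ∀ b u, RR n l k u → (pC n i hi).op b (φ u) = ((pC n i hi).op b u).map φ
  af : ∀ b u, RR n l k u → (aC n hn).op b (φ u) = ((aC n hn).op b u).map φ
  Hc : ∀ i (hi : i ≤ n), 1 ≤ i → ∀ u v, RR n l k u → (pC n i hi).op true u = some v → H v = H u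
  Ha : ∀ u v, RR n l k u → (aC n hn).op true u = some v →
    H v = H u + (if dx n hn u = 0 ∧ dx n hn (φ u) = 0 then 1 else if 0 < dx n hn u ∧ 0 < dx n hn (φ u) then -1 else 0)
  norm : H (mk n 0 l 2 0 0 0, mk n 0 0 2 k 0 0) = 0

lemma RR_p (n l k i : ℕ) (hi : i ≤ n) (h1 : 1 ≤ i) (b : Bool) (u v : Row × Row) (hu : RR n l k u)
    (h : (pC n i hi).op b u = some v) : RR n l k v := by
  rcases ten_op_cases _ _ _ _ _ h with ⟨a, e⟩ | ⟨e, a⟩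
  · exact ⟨RB_row n l i h1 hi b _ _ hu.1 a, by rw [e]; exact hu.2⟩
  · exact ⟨by rw [e]; exact hu.1, RB_row n k i h1 hi b _ _ hu.2 a⟩
lemma RR_a (n l k : ℕ) (hn : 2 ≤ n) (b : Bool) (u v : Row × Row) (hu : RR n l k u)
    (h : (aC n hn).op b u = some v) : RR n l k v := by
  rcases ten_op_cases _ _ _ _ _ h with ⟨a, e⟩ | ⟨e, a⟩
  · exact ⟨RB_aff n l hn b _ _ hu.1 a, by rw [e]; exact hu.2⟩
  · exact ⟨by rw [e]; exact hu.1, RB_aff n k hn b _ _ hu.2 a⟩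

section
variable {n l k : ℕ} {hn : 2 ≤ n} {φ : Row × Row → Row × Row} {H : Row × Row → ℤ} (I : IH n l k hn φ H)

def J (n l k : ℕ) (φ : Row × Row → Row × Row) (H : Row × Row → ℤ) (u u' : Row × Row) (h : ℤ) : Prop :=
  RR n l k u ∧ φ u = u' ∧ H u = h

include I
lemma Hst (i : ℕ) (hi : i ≤ n) (h1 : 1 ≤ i) (m : ℕ) (u v : Row × Row) (hu : RR n l k u)
    (h : (pC n i hi).st true m u = some v) : H v = H u := by
  induction m generalizing u with
  | zero => simp only [Cry.st, Option.some.injEq] at h; subst h; rfl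
  | succ m ih =>
    rw [Cry.st] at h
    obtain ⟨z, hz, h⟩ := Option.bind_eq_some_iff.1 h
    rw [ih z (RR_p n l k i hi h1 _ _ _ hu hz) h, I.Hc i hi h1 u z hu hz]

lemma J_max (i : ℕ) (hi : i ≤ n) (h1 : 1 ≤ i) (u u' v v' : Row × Row) (h : ℤ) (j : J n l k φ H u u' h)
    (m : MaxSt (pC n i hi) u v) (m' : MaxSt (pC n i hi) u' v') :
    J n l k φ H v v' h ∧ (pC n i hi).ep u = (pC n i hi).ep u' := by
  obtain ⟨ju, rfl, jh⟩ := j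
  have hR := RR_p n l k i hi h1
  have hm := fun b u hu => I.cl i hi h1 b u hu
  have ep := par_ep (pC n i hi) (RR n l k) φ hR hm u ju
  have st := par_st (pC n i hi) (RR n l k) φ hR hm true ((pC n i hi).ep u) u ju
  unfold MaxSt at m m'
  rw [ep, st, m] at m'
  refine ⟨⟨par_R _ (RR n l k) hR _ _ _ _ ju m, by simpa using m', ?_⟩, ep.symm⟩
  rw [Hst I i hi h1 _ _ _ ju m, jh]

lemma J_back (i : ℕ) (hi : i ≤ n) (h1 : 1 ≤ i) (M M' : ℕ) (hM : M = M') (u u' v v' : Row × Row) (h : ℤ) (j : J n l k φ H v v' h)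
    (m : (pC n i hi).st true M u = some v) (m' : (pC n i hi).st true M' u' = some v') :
    J n l k φ H u u' h := by
  obtain ⟨ju, rfl, jh⟩ := j
  subst hM
  have hR := RR_p n l k i hi h1
  have hm := fun b u hu => I.cl i hi h1 b u hu
  have m1 := st_rev _ _ _ _ m
  have m1' := st_rev _ _ _ _ m'
  rw [par_st (pC n i hi) (RR n l k) φ hR hm false M v ju, m1] at m1'
  have r := par_R _ (RR n l k) hR _ _ _ _ ju m1
  refine ⟨r, by simpa using m1', ?_⟩
  rw [← Hst I i hi h1 _ _ _ r m, jh]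

lemma Gst (m : ℕ) (u v : Row × Row) (hu : RR n l k u) (h : (aC n hn).st true m u = some v) :
    H v - (dx n hn v : ℤ) - (dx n hn (φ v) : ℤ) = H u + m - (dx n hn u : ℤ) - (dx n hn (φ u) : ℤ) := by
  induction m generalizing u with
  | zero => simp only [Cry.st, Option.some.injEq] at h; subst h; simp
  | succ m ih =>
    rw [Cry.st] at h
    obtain ⟨z, hz, h⟩ := Option.bind_eq_some_iff.1 h
    have key : ∀ u z : Row × Row, (aC n hn).op true u = some z → dx n hn z = dx n hn u - 1 := by
      intro u z hz
      have hz' : tenE (affC n hn) (affC n hn) u = some z := hz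
      simp only [tenE] at hz'
      unfold dx
      split_ifs at hz' with hh <;> obtain ⟨c, hc, rfl⟩ := Option.map_eq_some_iff.1 hz'
      · have := (affC n hn).e_ep _ _ hc
        simp only; omega
      · have := (affC n hn).e_ep _ _ hc
        simp only; omega
    have k1 := key u z hz
    have hz2 := I.af true u hu
    rw [hz] at hz2
    have k2 := key (φ u) (φ z) hz2
    rw [ih z (RR_a n l k hn _ _ _ hu hz) h, I.Ha u z hu hz, k1, k2]
    push_cast
    split_ifs <;> omega

lemma J_aff (M : ℕ) (u u' v v' : Row × Row) (h : ℤ) (j : J n l k φ H u u' h)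
    (m : (aC n hn).st true M u = some v) (m' : (aC n hn).st true M u' = some v') :
    J n l k φ H v v' (h + M - (dx n hn u : ℤ) - (dx n hn u' : ℤ) + (dx n hn v : ℤ) + (dx n hn v' : ℤ)) ∧ 
      (aC n hn).ep u = (aC n hn).ep u' := by
  obtain ⟨ju, rfl, jh⟩ := j
  have hR := RR_a n l k hn
  have hm := fun b u hu => I.af b u hu
  have ep := par_ep (aC n hn) (RR n l k) φ hR hm u ju
  have st := par_st (aC n hn) (RR n l k) φ hR hm true M u ju
  rw [st, m] at m'
  have e : φ v = v' := by simpa using m'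
  refine ⟨⟨par_R _ (RR n l k) hR _ _ _ _ ju m, e, ?_⟩, ep.symm⟩
  have := Gst I M u v ju m
  rw [e, jh] at this
  omega

lemma J_t (A1 B1 C1 D1 E1 A2 B2 C2 D2 E2 A1' B1' C1' D1' E1' A2' B2' C2' D2' E2' t : ℕ) (h : ℤ)
    (ht : 2 ≤ t ∧ t < 2 * n) 
    (j : J n l k φ H (mk n A1 B1 t C1 D1 E1, mk n A2 B2 t C2 D2 E2) (mk n A1' B1' t C1' D1' E1', mk n A2' B2' t C2' D2' E2') h) :
    J n l k φ H (mk n A1 B1 2 C1 D1 E1, mk n A2 B2 2 C2 D2 E2) (mk n A1' B1' 2 C1' D1' E1', mk n A2' B2' 2 C2' D2' E2') h ∧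
     (3 ≤ t → C1 + C2 = C1' + C2') := by
  induction t with
  | zero => omega
  | succ t ih =>
    by_cases h2 : t = 1
    · subst h2; exact ⟨j, by omega⟩
    obtain ⟨i, hi, hit⟩ : ∃ i, i ≤ n ∧ (t + 1 = i + 1 ∨ (t + 1) + i = 2 * n + 1) := by
      by_cases t ≤ n
      · exact ⟨t, by omega, by omega⟩
      · exact ⟨2 * n - t, by omega, by omega⟩
    have a := ST n hn (t + 1) i hi (by omega) hit A1 B1 C1 D1 E1 A2 B2 C2 D2 E2
    have b := ST n hn (t + 1) i hi (by omega) hit A1' B1' C1' D1' E1' A2' B2' C2' D2' E2'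
    obtain ⟨j1, j2⟩ := J_max I i hi (by omega) _ _ _ _ _ j a.1 b.1
    rw [a.2, b.2] at j2
    exact ⟨(ih (by omega) j1).1, fun _ => j2⟩

def WW (n l k z s : ℕ) : Row × Row := (mk n 0 l 2 0 0 0, mk n z (k - 2 * z - s) 2 s 0 z)

lemma HHph (a p d e f g : ℕ) : (pC n 1 (one_le n hn)).ph (HH n a p d e f g) = e + p := by
  show (rowC n 1 _).ph _ + ((rowC n 1 _).ph _ - (rowC n 1 _).ep _) = _
  rw [HH, (rw1_ep n hn _ _ _ _ _).1, (rw1_ep n hn _ _ _ _ _).2, (rw1_ep n hn _ _ _ _ _).2]; omega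

lemma dxV (a p d e f g : ℕ) : dx n hn (VV n a p d e f g) = d - a := by
  unfold dx VV
  rw [(aff_ep n hn _ _ _ _ _ _ (by omega) rfl).1, (aff_ep n hn _ _ _ _ _ _ (by omega) rfl).2]; omega

omit I in
lemma arA3 (x y z k : ℕ) (h : x + y + z = k) : x = k - y - z := by omega
omit I in
lemma arA1 (l k a p d e f g a' p' d' e' f' g' : ℕ) (r1 : a + (f + g + p) + 0 + 0 + a = l) (r2 : d + e + f + g + d = k)
  (r1' : d' + (f' + g' + p') + 0 + 0 + d' = k) (r2' : a' + e' + f' + g' + a' = l) (q1 : e' + p' = e + p)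
  (q2 : a + f + g + (d - a) = d' + f' + g' + (a' - d'))
  (q4 : f + g + 2 * a + (g + 2 * (d - a)) = f' + g' + 2 * d' + (g' + 2 * (a' - d'))) :
  f' = f ∧ a + d + g = a' + d' + g' ∧ min d' a' = min a d := by
  have h1 : a + (d - a) + min a d = a + d := by clear r1 r2 r1' r2' q1 q2 q4; omega
  have h2 : d' + (a' - d') + min d' a' = a' + d' := by clear r1 r2 r1' r2' q1 q2 q4; omega
  generalize d - a = X at *
  generalize a' - d' = X' at *
  generalize min a d = z at *
  generalize min d' a' = z' at *
  omega
omit I in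
lemma arA4 (x m s k : ℕ) (h : x + 2 * m + s = k) : 2 * m + s ≤ k := by omega
omit I in
lemma arA2 (l k a p d e f g a' p' d' e' g' : ℕ) (r1 : a + (f + g + p) + 0 + 0 + a = l) (r2 : d + e + f + g + d = k)
  (r1' : d' + (f + g' + p') + 0 + 0 + d' = k) (r2' : a' + e' + f + g' + a' = l) (hz : min d' a' = min a d)
  (q4 : f + g + 2 * a + (g + 2 * (d - a)) = f + g' + 2 * d' + (g' + 2 * (a' - d')))
  (q5 : f + g + 2 * a + (g + 2 * (d - a) - p) = f + g' + 2 * d' + (g' + 2 * (a' - d') - p')) (s s' : ℕ)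
  (hs : min (g + 2 * (d - a)) p = s) (hs' : min (g' + 2 * (a' - d')) p' = s') :
  s = s' ∧ g + 2 * (d - a) - (g + 2 * (d - a) - p) = s ∧ g' + 2 * (a' - d') - (g' + 2 * (a' - d') - p') = s ∧
   0 + (e + f) + (g + 2 * (d - a) - p) + 2 * min a d + s = k ∧ 0 + (e' + f) + (g' + 2 * (a' - d') - p') + 2 * min a d + s = l := by
  have h1 : d = min a d + (d - a) := by clear r1 r2 r1' r2' q4 q5 hs hs'; omega
  have h2 : a' = min a d + (a' - d') := by clear r1 r2 r1' r2' q4 q5 hs hs'; omega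
  generalize d - a = X at *
  generalize a' - d' = X' at *
  generalize min a d = z at *
  have h3 : g + 2 * X - p + s = g + 2 * X := by clear r1 r2 r1' r2' q4 q5 hs' h1 h2; omega
  have h4 : g' + 2 * X' - p' + s' = g' + 2 * X' := by clear r1 r2 r1' r2' q4 q5 hs h1 h2; omega
  clear hs hs'
  generalize g + 2 * X - p = Y at *
  generalize g' + 2 * X' - p' = Y' at *
  omega

omit I in
lemma HH_hw (n : ℕ) (hn : 2 ≤ n) (i : ℕ) (hi : i ≤ n) (h1 : 1 ≤ i) (a p d e f g : ℕ) : (pC n i hi).ep (HH n a p d e f g) = 0 := by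
  show (rowC n i _).ep _ + ((rowC n i _).ep _ - (rowC n i _).ph _) = _
  unfold HH
  by_cases h : i = 1
  · subst h
    rw [(rw1_ep n hn _ _ _ _ _).1, (rw1_ep n hn _ _ _ _ _).2, (rw1_ep n hn _ _ _ _ _).1]; omega
  have key : ∀ A B C D E, (rowC n i hi).ep (mk n A B 2 C D E) = 0 := by
    intro A B C D E
    rcases Nat.lt_or_ge i n with hh | hh
    · rw [(rowC_ep n i hh _).1, mkz n _ _ _ _ _ _ (by omega) _ (by omega) (by omega) (by omega),
       mkz n _ _ _ _ _ _ (by omega) (i + 1) (by omega) (by omega) (by omega)]; omega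
    · have : i = n := by omega
      subst this
      rw [(rowC_epn i _).1, mkz i _ _ _ _ _ _ (by omega) _ (by omega) (by omega) (by omega)]
  rw [key, key]; simp

set_option maxHeartbeats 1000000 in
lemma pathA (a p d e f g : ℕ) (hR : RR n l k (HH n a p d e f g)) :
    ∃ a' p' d' e' g', φ (HH n a p d e f g) = HH n d' p' a' e' f g' ∧
      l = 2 * a + p + f + g ∧ k = 2 * d + e + f + g ∧ l = 2 * a' + e' + f + g' ∧ k = 2 * d' + p' + f + g' ∧ 
      min a d = min a' d' ∧ a + d + g = a' + d' + g' ∧ 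
      min (g + 2 * (d - a)) p = min (g' + 2 * (a' - d')) p' ∧
      2 * min a d + min (g + 2 * (d - a)) p ≤ k ∧ 2 * min a d + min (g + 2 * (d - a)) p ≤ l ∧ 
      J n l k φ H (WW n l k (min a d) (min (g + 2 * (d - a)) p)) (WW n k l (min a d) (min (g + 2 * (d - a)) p))
        (H (HH n a p d e f g) + a + f + g - (a' - d' : ℕ)) := by
  obtain ⟨d', p', a', e', f', g', hφ⟩ := classify n k l hn (φ (HH n a p d e f g)) (I.mem _ hR).1 (I.mem _ hR).2 (by
    intro i hi h1
    rw [par_ep (pC n i hi) (RR n l k) φ (RR_p n l k i hi h1) (fun b u hu => I.cl i hi h1 b u hu) _ hR]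
    exact HH_hw n hn i hi h1 a p d e f g)
  have hR' := I.mem _ hR
  rw [hφ] at hR'
  have r1 := ((RB_mk n _ _ _ _ _ _ _ (by omega)).1 hR.1).2
  have r2 := ((RB_mk n _ _ _ _ _ _ _ (by omega)).1 hR.2).2
  have r1' := ((RB_mk n _ _ _ _ _ _ _ (by omega)).1 hR'.1).2
  have r2' := ((RB_mk n _ _ _ _ _ _ _ (by omega)).1 hR'.2).2
  have q1 := par_ph (pC n 1 (one_le n hn)) (RR n l k) φ (RR_p n l k 1 (one_le n hn) le_rfl) (fun b u hu => I.cl 1 (one_le n hn) le_rfl b u hu) _ hR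
  rw [hφ, HHph I, HHph I] at q1
  have j0 : J n l k φ H (HH n a p d e f g) (HH n d' p' a' e' f' g') (H (HH n a p d e f g)) := ⟨hR, hφ, rfl⟩
  have j1 := J_back I 1 (one_le n hn) le_rfl _ _ q1.symm _ _ _ _ _ j0 (S0 n hn a p d e f g) (S0 n hn d' p' a' e' f' g')
  have x1 := A1 n hn a p d e f g
  have x2 := A1 n hn d' p' a' e' f' g'
  have q2 : (aC n hn).ep (VV n a p d e f g) = (aC n hn).ep (VV n d' p' a' e' f' g') := by
    rw [← j1.2.1, par_ep (aC n hn) (RR n l k) φ (RR_a n l k hn) (fun b u hu => I.af b u hu) _ j1.1]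
  have x2' := x2.1
  unfold MaxSt at x2'
  rw [← q2] at x2'
  have j2 := (J_aff I _ _ _ _ _ _ j1 x1.1 x2').1
  rw [x1.2, x2.2] at q2
  rw [x1.2, dxV I, dxV I] at j2
  have dz : ∀ m1 m2 m3 m4 m5 m6 : ℕ, dx n hn (mk n 0 0 2 m1 m2 0, mk n m3 0 2 m4 m5 m3) = m3 - m2 := by
    intro m1 m2 m3 m4 m5 m6
    unfold dx
    rw [(aff_ep n hn _ _ _ _ _ _ (by omega) rfl).1, (aff_ep n hn _ _ _ _ _ _ (by omega) rfl).2]; omega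
  rw [dz _ _ _ _ _ 0, dz _ _ _ _ _ 0] at j2
  rw [show min a d - (f + g + 2 * a) = 0 by omega, show min d' a' - (f' + g' + 2 * d') = 0 by omega] at j2
  have x1 := S2 n hn 0 p (f + g + 2 * a) 0 (min a d) 0 (e + f) (g + 2 * (d - a)) (min a d)
  have x2 := S2 n hn 0 p' (f' + g' + 2 * d') 0 (min d' a') 0 (e' + f') (g' + 2 * (a' - d')) (min d' a')
  have j3 := (J_max I 1 (one_le n hn) le_rfl _ _ _ _ _ j2 x1.1 x2.1).1
  obtain ⟨j4, q4⟩ := J_t I _ _ _ _ _ _ _ _ _ _ _ _ _ _ _ _ _ _ _ _ _ _ (by omega) j3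
  have q4 := q4 (by omega)
  have x1 := S3 n hn 0 p (f + g + 2 * a) 0 (min a d) (0 + (e + f)) (g + 2 * (d - a)) (min a d)
  have x2 := S3 n hn 0 p' (f' + g' + 2 * d') 0 (min d' a') (0 + (e' + f')) (g' + 2 * (a' - d')) (min d' a')
  obtain ⟨j5, q5⟩ := J_max I 1 (one_le n hn) le_rfl _ _ _ _ _ j4 x1.1 x2.1
  rw [x1.2, x2.2] at q5
  clear x1 x2 j0 j1 j2 j3 j4 x2' dz
  obtain ⟨hf, hS, hz⟩ := arA1 l k a p d e f g a' p' d' e' f' g' r1 r2 r1' r2' q1 q2 q4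
  have hf := hf.symm
  subst hf
  have hsA := arA2 l k a p d e f g a' p' d' e' g' r1 r2 r1' r2' hz q4 q5
  generalize hs : min (g + 2 * (d - a)) p = s at *
  generalize hs' : min (g' + 2 * (a' - d')) p' = s' at *
  obtain ⟨hfs, s1, s2, w3, w4⟩ := hsA _ _ rfl rfl
  have w1 : p + (f + g + 2 * a) = l := by clear hs hs' hz s1 s2 w3 w4 q2 q4 q5; omega
  have w2 : p' + (f + g' + 2 * d') = k := by clear hs hs' hz s1 s2 w3 w4 q2 q4 q5; omega
  refine ⟨a', p', d', e', g', hφ, by clear * - r1; omega, by clear * - r2; omega, by clear * - r2'; omega, by clear * - r1'; omega, by rw [← hz, min_comm], hS, by rw [hs', hfs], arA4 _ _ _ _ w3, arA4 _ _ _ _ w4, ?_⟩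
  rw [s1, s2, w1, w2, hz] at j5
  rw [show 0 + (e + f) + (g + 2 * (d - a) - p) = k - 2 * min a d - s from arA3 _ _ _ _ w3,
    show 0 + (e' + f) + (g' + 2 * (a' - d') - p') = l - 2 * min a d - s from arA3 _ _ _ _ w4] at j5
  unfold WW
  convert j5 using 1
  push_cast
  ring
end


lemma ar9 (p e f g p' e' g' A D A' D' s : ℕ) (hAD : A = 0 ∨ D = 0) (hAD' : A' = 0 ∨ D' = 0)
    (h1 : 2 * A + p + f + g = 2 * A' + e' + f + g') (h2 : 2 * D + e + f + g = 2 * D' + p' + f + g')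
    (h3 : A + D + g = A' + D' + g') (h4 : min (g + 2 * D) p = s) (h5 : min (g' + 2 * A') p' = s) :
    s + A + f + g = A' + min (min (A + p + f + g) (D + e + f + g)) (2 * g + f + A + D) := by
  rcases hAD with rfl | rfl <;> rcases hAD' with rfl | rfl <;> omega

section
variable {n l k : ℕ} {hn : 2 ≤ n} {φ : Row × Row → Row × Row} {H : Row × Row → ℤ} (I : IH n l k hn φ H)
include I

lemma yJ (s : ℕ) (h1 : s ≤ l) (h2 : s ≤ k) : 
    J n l k φ H (WW n l k 0 s) (WW n k l 0 s) (H (WW n l k 0 0) - s) := by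
  have e : ∀ l k, s ≤ l → HH n 0 (l - s) 0 (k - s) s 0 = WW n l k 0 s := by
    intro l k h
    unfold HH WW
    congr 2; omega
  have hR : RR n l k (HH n 0 (l - s) 0 (k - s) s 0) :=
    ⟨(RB_mk n _ _ _ _ _ _ _ (by omega)).2 (by omega), (RB_mk n _ _ _ _ _ _ _ (by omega)).2 (by omega)⟩
  obtain ⟨a', p', d', e', g', x1, x2, x3, x4, x5, x6, x7, x8, x9, x10, x11⟩ := pathA I 0 (l - s) 0 (k - s) s 0 hR
  have q1 : a' = 0 := by omega
  have q2 : d' = 0 := by omega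
  have q3 : g' = 0 := by omega
  have q4 : p' = k - s := by omega
  have q5 : e' = l - s := by omega
  subst q1 q2 q3 q4 q5
  rw [e l k h1, e k l h2] at x1
  rw [e l k h1] at hR
  refine ⟨hR, x1, ?_⟩
  have := x11.2.2
  rw [e l k h1] at this
  simp at this
  linarith

lemma wJ (z s : ℕ) (h1 : 2 * z + s ≤ l) (h2 : 2 * z + s ≤ k) : H (WW n l k z s) = H (WW n l k 0 0) - s - z := by
  have key : ∀ l k, 2 * z + s ≤ l → 2 * z + s ≤ k → (aC n hn).st true z (WW n l k 0 s) = some (WW n l k z s) := by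
    intro l k h1 h2
    refine ten_st2 _ _ _ _ _ _ ?_ ?_
    · rw [(aff_ep n hn _ _ _ _ _ _ (by omega) rfl).1, (aff_ep n hn _ _ _ _ _ _ (by omega) rfl).2]; omega
    · rw [aff_st2 n hn _ _ _ _ _ (by omega) _ (by omega)]
      congr 2 <;> omega
  have dd : ∀ l k z s, dx n hn (WW n l k z s) = z + (k - 2 * z - s) := by
    intro l k z s
    unfold dx WW
    rw [(aff_ep n hn _ _ _ _ _ _ (by omega) rfl).1, (aff_ep n hn _ _ _ _ _ _ (by omega) rfl).2]; omega
  have := (J_aff I _ _ _ _ _ _ (yJ I s (by omega) (by omega)) (key l k h1 h2) (key k l h2 h1)).1.2.2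
  rw [dd, dd, dd, dd] at this
  rw [this]
  omega

lemma nJ : H (WW n l k 0 0) = (min l k : ℕ) := by
  have x := (S3 n hn 0 l 0 0 0 0 k 0)
  have m := x.1
  unfold MaxSt at m
  have := Hst I 1 _ le_rfl _ _ _ ⟨(RB_mk n _ _ _ _ _ _ _ (by omega)).2 (by omega), (RB_mk n _ _ _ _ _ _ _ (by omega)).2 (by omega)⟩ m
  rw [I.norm] at this
  have e : (mk n 0 (l + 0) 2 0 0 0, mk n 0 (0 + (k - l)) 2 (k - (k - l)) 0 0) = WW n l k 0 (min l k) := by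
    unfold WW; congr 2 <;> omega
  rw [e, wJ I 0 _ (by omega) (by omega)] at this
  push_cast at this ⊢
  linarith

def hat (n z : ℕ) (c : Row) : Row := fun j => if j = 0 then c 0 - z else if j = 2 * n + 1 then c (2 * n + 1) - z else c j
def hat2 (n z : ℕ) (u : Row × Row) : Row × Row := (hat n z u.1, hat n z u.2)

omit I in
lemma hat_mk (n : ℕ) (hn : 2 ≤ n) (z A B C D E : ℕ) : hat n z (mk n A B 2 C D E) = mk n (A - z) B 2 C D (E - z) := by
  funext j
  unfold hat
  rw [mk0, mkE n _ _ _ _ _ _ (by omega)]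
  simp only [mk]
  split_ifs <;> first | rfl | omega

omit I in
lemma hat_HH (n : ℕ) (hn : 2 ≤ n) (z a p d e f g : ℕ) : hat2 n z (HH n a p d e f g) = HH n (a - z) p (d - z) e f g := by
  unfold hat2 HH
  rw [hat_mk n hn, hat_mk n hn]

/-- The conclusion at the level of rows. -/
def Concl (n l k : ℕ) (φ : Row × Row → Row × Row) (H : Row × Row → ℤ) (u : Row × Row) : Prop :=
  ∃ m, Cc n m (hat2 n (min (u.1 0) (u.2 0)) u) (hat2 n (min (u.1 0) (u.2 0)) (φ u)) ∧
    H u = (min (l - 2 * min (u.1 0) (u.2 0)) (k - 2 * min (u.1 0) (u.2 0)) : ℕ) - (m : ℤ) ∧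
    min (u.1 0) (u.2 0) ≤ (φ u).1 0 ∧ min (u.1 0) (u.2 0) ≤ (φ u).2 0 

omit I in
lemma ar10 (l k a p d e f g a' p' d' e' g' z s M : ℕ) (x2 : l = 2 * a + p + f + g) (x3 : k = 2 * d + e + f + g) 
   (x4 : l = 2 * a' + e' + f + g') (x5 : k = 2 * d' + p' + f + g') (hz : min a d = z) (hz' : min a' d' = z)
   (x7 : a + d + g = a' + d' + g') (hs : min (g + 2 * (d - a)) p = s) (hs' : min (g' + 2 * (a' - d')) p' = s)
   (hM : M = min (min ((a - z) + p + f + g) ((d - z) + e + f + g)) (2 * g + f + (a - z) + (d - z))) :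
   ((a - z = 0 ∨ d - z = 0) ∧ (a' - z = 0 ∨ d' - z = 0) ∧ 2 * (a - z) + p + f + g = 2 * (a' - z) + e' + f + g' ∧
   2 * (d - z) + e + f + g = 2 * (d' - z) + p' + f + g' ∧ (a - z) + (d - z) + g = (a' - z) + (d' - z) + g' ∧
   min (g + 2 * ((d - z) - (a - z))) p = min (g' + 2 * ((a' - z) - (d' - z))) p') ∧
   ∀ h : ℤ, ((min l k : ℕ) : ℤ) - s - z = h + a + f + g - ((a' - d' : ℕ) : ℤ) → h = (min (l - 2 * z) (k - 2 * z) : ℕ) - (M : ℤ) := by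
  obtain ⟨A, hA⟩ : ∃ A, a = z + A := ⟨a - z, by clear * - hz; omega⟩
  obtain ⟨A', hA'⟩ : ∃ A, a' = z + A := ⟨a' - z, by clear * - hz'; omega⟩
  obtain ⟨D, hD⟩ : ∃ A, d = z + A := ⟨d - z, by clear * - hz; omega⟩
  obtain ⟨D', hD'⟩ : ∃ A, d' = z + A := ⟨d' - z, by clear * - hz'; omega⟩
  have o1 : A = 0 ∨ D = 0 := by clear * - hz hA hD; omega
  have o2 : A' = 0 ∨ D' = 0 := by clear * - hz' hA' hD'; omega
  clear hz hz'
  subst hA hA' hD hD'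
  have t1 : z + D - (z + A) = D - A := by clear * -; omega
  have t2 : z + A' - (z + D') = A' := by clear * - o2; omega
  have t3 : g + 2 * (D - A) = g + 2 * D := by clear * - o1; omega
  simp only [Nat.add_sub_cancel_left] at hM ⊢
  have t4 : A' - D' = A' := by clear * - o2; omega
  rw [t1, t3] at hs
  rw [t2] at hs'
  rw [t3, t4, hs, hs', t2]
  have h1 : 2 * A + p + f + g = 2 * A' + e' + f + g' := by clear * - x2 x4; omega
  have h2 : 2 * D + e + f + g = 2 * D' + p' + f + g' := by clear * - x3 x5; omega
  have h3 : A + D + g = A' + D' + g' := by clear * - x7; omega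
  have := ar9 p e f g p' e' g' A D A' D' s o1 o2 h1 h2 h3 hs hs'
  rw [← hM] at this
  refine ⟨⟨o1, o2, h1, h2, h3, rfl⟩, ?_⟩
  intro h hh
  have e : min l k = min (l - 2 * z) (k - 2 * z) + 2 * z := by clear * - x2 x3; omega
  rw [e] at hh
  push_cast at hh ⊢
  clear hs hs' hM e
  have : (s : ℤ) + A + f + g = A' + M := by exact_mod_cast this
  linarith

lemma baseC (u : Row × Row) (hu : RR n l k u) (h : ∀ i (hi : i ≤ n), 1 ≤ i → (pC n i hi).ep u = 0) : Concl n l k φ H u := by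
  obtain ⟨a, p, d, e, f, g, rfl⟩ := classify n l k hn u hu.1 hu.2 h
  obtain ⟨a', p', d', e', g', x1, x2, x3, x4, x5, x6, x7, x8, x9, x10, x11⟩ := pathA I a p d e f g hu
  have y := x11.2.2
  rw [wJ I _ _ x10 x9, nJ I] at y
  have z1 : (HH n a p d e f g).1 0 = a := rfl
  have z2 : (HH n a p d e f g).2 0 = d := rfl
  obtain ⟨⟨c1, c2, c3, c4, c5, c6⟩, c7⟩ := ar10 l k a p d e f g a' p' d' e' g' _ _ _ x2 x3 x4 x5 rfl x6.symm x7 rfl x8.symm rfl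
  refine ⟨mm (a - min a d) p (d - min a d) e f g, ?_, ?_, ?_, ?_⟩
  · rw [x1, z1, z2, hat_HH n hn, hat_HH n hn]
    exact pathB n hn (a - min a d) p (d - min a d) e f g (a' - min a d) p' (d' - min a d) e' g' c1 c2 c3 c4 c5 c6
  · rw [z1, z2]; exact c7 _ y
  · rw [x1, z1, z2, x6]; exact min_le_right _ _
  · rw [x1, z1, z2, x6]; exact min_le_left _ _
end


lemma hat_eq (n z j : ℕ) (c : Row) (h : 1 ≤ j ∧ j ≤ 2 * n) : hat n z c j = c j := by
  unfold hat; rw [if_neg (by omega), if_neg (by omega)]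

lemma hat_mv (n z a b : ℕ) (c : Row) (ha : 1 ≤ a ∧ a ≤ 2 * n) (hb : 1 ≤ b ∧ b ≤ 2 * n) : mv a b (hat n z c) = hat n z (mv a b c) := by
  funext j
  simp only [hat, mv]
  split_ifs <;> first | rfl | omega

lemma hat_row (n z i : ℕ) (hi : i ≤ n) (h1 : 1 ≤ i) (b : Bool) (c : Row) :
    (rowC n i hi).op b (hat n z c) = ((rowC n i hi).op b c).map (hat n z) ∧
    (rowC n i hi).ep (hat n z c) = (rowC n i hi).ep c ∧ (rowC n i hi).ph (hat n z c) = (rowC n i hi).ph c := by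
  rw [rowC]
  split_ifs with hin
  · refine ⟨?_, hat_eq n z (n + 1) c (by omega), hat_eq n z n c (by omega)⟩
    cases b <;> simp only [Cry.op, twoC, Bool.false_eq_true, if_false, if_true] <;>
      rw [hat_eq _ _ _ _ (by omega)] <;> split_ifs <;> simp only [Option.map_some, Option.map_none] <;>
      rw [hat_mv _ _ _ _ _ (by omega) (by omega)]
  · refine ⟨?_, ?_, ?_⟩
    · cases b <;> simp only [Cry.op, fourC, Bool.false_eq_true, if_false, if_true] <;>
        rw [hat_eq _ _ _ _ (by omega), hat_eq _ _ _ _ (by omega), hat_eq _ _ _ _ (by omega)] <;> split_ifs <;> simp only [Option.map_some, Option.map_none] <;>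
        rw [hat_mv _ _ _ _ _ (by omega) (by omega)]
    · simp only [fourC]; rw [hat_eq _ _ _ _ (by omega), hat_eq _ _ _ _ (by omega), hat_eq _ _ _ _ (by omega)]
    · simp only [fourC]; rw [hat_eq _ _ _ _ (by omega), hat_eq _ _ _ _ (by omega), hat_eq _ _ _ _ (by omega)]

lemma hat_p (n z i : ℕ) (hi : i ≤ n) (h1 : 1 ≤ i) (b : Bool) (u : Row × Row) :
    (pC n i hi).op b (hat2 n z u) = ((pC n i hi).op b u).map (hat2 n z) := by
  have A := hat_row n z i hi h1 b u.1
  have B := hat_row n z i hi h1 b u.2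
  cases b
  · simp only [pC, Cry.op, ten, tenF, Bool.false_eq_true, if_false] at A B ⊢
    simp only [hat2, A.1, A.2.2, B.1, B.2.1]
    split_ifs <;> simp only [Option.map_map] <;> rfl
  · simp only [pC, Cry.op, ten, tenE, if_true] at A B ⊢
    simp only [hat2, A.1, A.2.2, B.1, B.2.1]
    split_ifs <;> simp only [Option.map_map] <;> rfl

lemma row_mv (n i : ℕ) (hi : i ≤ n) (h1 : 1 ≤ i) (c c' : Row) (h : (rowC n i hi).op true c = some c') :
    ∃ a, 1 ≤ a ∧ a + 1 ≤ 2 * n ∧ 0 < c (a + 1) ∧ c' = mv (a + 1) a c := by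
  rw [rowC] at h
  split_ifs at h with hin
  · simp only [Cry.op, twoC, if_true] at h
    split_ifs at h with h2
    simp only [Option.some.injEq] at h
    exact ⟨n, by omega, by omega, h2, h.symm⟩
  · simp only [Cry.op, fourC, if_true] at h
    split_ifs at h with h2 h3 <;> simp only [Option.some.injEq] at h
    · exact ⟨i, by omega, by omega, by omega, h.symm⟩
    · refine ⟨2 * n - i, by omega, by omega, ?_, ?_⟩
      · rw [show 2 * n - i + 1 = 2 * n + 1 - i by omega]; exact h3
      · rw [show 2 * n - i + 1 = 2 * n + 1 - i by omega]; exact h.symm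

def Wt (n : ℕ) (c : Row) : ℕ := ∑ j ∈ Finset.range (2 * n + 2), j * c j

lemma Wt_mv (n a : ℕ) (c : Row) (ha : a + 1 ≤ 2 * n) (h : 0 < c (a + 1)) : Wt n (mv (a + 1) a c) + 1 = Wt n c := by
  have h1 : ∑ j ∈ Finset.range (2 * n + 2), (j * mv (a + 1) a c j + if j = a + 1 then a + 1 else 0) =
      ∑ j ∈ Finset.range (2 * n + 2), (j * c j + if j = a then a else 0) := by
    apply Finset.sum_congr rfl
    intro j _
    simp only [mv]
    by_cases x1 : j = a
    · subst x1
      rw [if_pos rfl, if_neg (by omega), if_pos rfl]; ring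
    · rw [if_neg x1]
      by_cases x2 : j = a + 1
      · rw [if_pos x2, if_pos x2, if_neg x1, x2]
        obtain ⟨t, ht⟩ : ∃ t, c (a + 1) = t + 1 := ⟨c (a + 1) - 1, by omega⟩
        rw [ht]; simp; ring
      · rw [if_neg x2, if_neg x2, if_neg x1]
  rw [Finset.sum_add_distrib, Finset.sum_add_distrib, Finset.sum_ite_eq', Finset.sum_ite_eq'] at h1
  simp only [Finset.mem_range] at h1
  rw [if_pos (by omega), if_pos (by omega)] at h1
  unfold Wt; omega

lemma row_W (n i : ℕ) (hi : i ≤ n) (h1 : 1 ≤ i) (c c' : Row) (h : (rowC n i hi).op true c = some c') :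
    Wt n c' + 1 = Wt n c ∧ c' 0 = c 0 := by
  obtain ⟨a, h2, h3, h4, rfl⟩ := row_mv n i hi h1 c c' h
  refine ⟨Wt_mv n a c h3 h4, ?_⟩
  unfold mv; rw [if_neg (by omega), if_neg (by omega)]

lemma p_W (n i : ℕ) (hi : i ≤ n) (h1 : 1 ≤ i) (u v : Row × Row) (h : (pC n i hi).op true u = some v) :
    Wt n v.1 + Wt n v.2 + 1 = Wt n u.1 + Wt n u.2 ∧ v.1 0 = u.1 0 ∧ v.2 0 = u.2 0 := by
  rcases ten_op_cases _ _ _ _ _ h with ⟨a, e⟩ | ⟨e, a⟩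
  · have := row_W n i hi h1 _ _ a
    rw [e]; omega
  · have := row_W n i hi h1 _ _ a
    rw [e]; omega

section
variable {n l k : ℕ} {hn : 2 ≤ n} {φ : Row × Row → Row × Row} {H : Row × Row → ℤ}

lemma allC (I : IH n l k hn φ H) (N : ℕ) (u : Row × Row) (hu : RR n l k u) (hN : Wt n u.1 + Wt n u.2 = N) : Concl n l k φ H u := by
  induction N using Nat.strong_induction_on generalizing u with
  | _ N ih =>
    by_cases h : ∀ i (hi : i ≤ n), 1 ≤ i → (pC n i hi).ep u = 0
    · exact baseC I u hu h
    push Not at h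
    obtain ⟨i, hi, h1, h2⟩ := h
    have h3 : (pC n i hi).op true u ≠ none := by
      intro h; exact h2 (((pC n i hi).e_none u).1 h)
    obtain ⟨v, hv⟩ := Option.ne_none_iff_exists'.1 h3
    have hv' := I.cl i hi h1 true u hu
    rw [hv, Option.map_some] at hv'
    have w := p_W n i hi h1 _ _ hv
    have w' := p_W n i hi h1 _ _ hv'
    obtain ⟨m, c1, c2, c3, c4⟩ := ih (Wt n v.1 + Wt n v.2) (by omega) v (RR_p n l k i hi h1 _ _ _ hu hv) rfl
    rw [w.2.1, w.2.2] at c1 c2 c3 c4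
    rw [w'.2.1] at c3
    rw [w'.2.2] at c4
    refine ⟨m, ?_, ?_, c3, c4⟩
    · refine Cc_op n m i hi false _ _ _ _ c1 ?_ ?_
      · rw [hat_p n _ i hi h1, (op_ef (pC n i hi) _ _).1 hv]; rfl
      · rw [hat_p n _ i hi h1, (op_ef (pC n i hi) _ _).1 hv']; rfl
    · rw [← c2, I.Hc i hi h1 _ _ hu hv]
end


def toTup (n : ℕ) (c : Row) : Tup n := (fun j => c (j + 1), fun j => c (2 * n - j))
def toRow (n l : ℕ) (b : Tup n) : Row := fun j =>
  if j = 0 then x0 l b else if j ≤ n then xc b j else if j ≤ 2 * n then xbc b (2 * n + 1 - j)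
  else if j = 2 * n + 1 then x0 l b else 0

lemma xc_tup (n j : ℕ) (c : Row) (h : 1 ≤ j ∧ j ≤ n) : xc (toTup n c) j = c j := by
  unfold xc toTup
  rw [dif_pos (by omega)]
  show c (j - 1 + 1) = c j
  congr 1; omega
lemma xbc_tup (n j : ℕ) (c : Row) (h : 1 ≤ j ∧ j ≤ n) : xbc (toTup n c) j = c (2 * n + 1 - j) := by
  unfold xbc toTup
  rw [dif_pos (by omega)]
  show c (2 * n - (j - 1)) = _
  congr 1; omega

lemma sum_tup (n : ℕ) (c : Row) : ∑ j ∈ Finset.range (2 * n + 2), c j = tsum (toTup n c) + c 0 + c (2 * n + 1) := by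
  rw [Finset.sum_range_succ, Finset.sum_range_succ']
  have : ∑ j ∈ Finset.range (2 * n), c (j + 1) = tsum (toTup n c) := by
    unfold tsum toTup
    rw [Finset.sum_add_distrib, two_mul, Finset.sum_range_add, Fin.sum_univ_eq_sum_range (fun j => c (j + 1)),
      Fin.sum_univ_eq_sum_range (fun j => c (n + n - j)), ← Finset.sum_range_reflect (fun j => c (n + n - j))]
    congr 1
    apply Finset.sum_congr rfl
    intro j hj
    rw [Finset.mem_range] at hj
    congr 1; omega
  rw [this]

lemma tsum_tup (n l : ℕ) (c : Row) (h : RB n l c) : tsum (toTup n c) + 2 * c 0 = l := by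
  have := sum_tup n c
  rw [h.2.2, ← h.1] at this
  omega
lemma x0_tup (n l : ℕ) (c : Row) (h : RB n l c) : x0 l (toTup n c) = c 0 := by
  have := tsum_tup n l c h
  unfold x0; omega
lemma mem_tup (n l : ℕ) (c : Row) (h : RB n l c) : toTup n c ∈ BC n l := by
  have := tsum_tup n l c h
  show _ ∧ _
  omega
lemma row_tup (n l : ℕ) (c : Row) (h : RB n l c) : toRow n l (toTup n c) = c := by
  funext j
  unfold toRow
  rw [x0_tup n l c h]
  split_ifs with h1 h2 h3 h4
  · rw [h1]
  · rw [xc_tup _ _ _ (by omega)]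
  · rw [xbc_tup _ _ _ (by omega)]; congr 1; omega
  · rw [h4, h.1]
  · rw [h.2.1 j (by omega)]
lemma tup_row (n l : ℕ) (b : Tup n) : toTup n (toRow n l b) = b := by
  obtain ⟨x, y⟩ := b
  unfold toTup
  congr 1 <;> funext j <;> have hj := j.2 <;> simp only [toRow]
  · rw [if_neg (by omega), if_pos (by omega)]
    unfold xc
    rw [dif_pos (by omega)]; rfl
  · rw [if_neg (by omega), if_neg (by omega), if_pos (by omega)]
    unfold xbc
    rw [dif_pos (by omega)]
    show y _ = y _
    congr 1; ext; show 2 * n + 1 - (2 * n - j) - 1 = j; omega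
lemma RB_toRow (n l : ℕ) (hn : 2 ≤ n) (b : Tup n) (hb : b ∈ BC n l) : RB n l (toRow n l b) := by
  have e0 : toRow n l b 0 = x0 l b := rfl
  have e1 : toRow n l b (2 * n + 1) = x0 l b := by
    unfold toRow; rw [if_neg (by omega), if_neg (by omega), if_neg (by omega), if_pos rfl]
  refine ⟨by rw [e0, e1], ?_, ?_⟩
  · intro j hj
    unfold toRow; rw [if_neg (by omega), if_neg (by omega), if_neg (by omega), if_neg (by omega)]
  · rw [sum_tup, e0, e1, tup_row]
    obtain ⟨h1, h2⟩ : tsum b ≤ l ∧ (l - tsum b) % 2 = 0 := hb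
    unfold x0; omega

/-! operators -/
lemma tup_ext (n : ℕ) (c : Row) (x y : Fin n → ℕ) (h1 : ∀ j : Fin n, x j = c (j + 1)) (h2 : ∀ j : Fin n, y j = c (2 * n - j)) :
    (x, y) = toTup n c := by
  unfold toTup; congr 1 <;> funext j
  · exact h1 j
  · exact h2 j

lemma eC_row (n l i : ℕ) (hi : i ≤ n) (h1 : 1 ≤ i) (c : Row) :
    eC n l i (toTup n c) = ((rowC n i hi).op true c).map (toTup n) ∧ fC n l i (toTup n c) = ((rowC n i hi).op false c).map (toTup n) := by
  unfold eC fC rowC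
  have hi0 : ¬ i = 0 := by omega
  rw [if_neg hi0, if_neg hi0]
  by_cases hin : i = n
  · subst hin
    have e : 2 * i + 1 - i = i + 1 := by omega
    simp only [if_true, dite_true, xc_tup i i c (by omega), xbc_tup i i c (by omega), e]
    simp only [Cry.op, twoC, Bool.false_eq_true, if_false, if_true]
    constructor <;> split_ifs <;> simp only [Option.map_some, Option.map_none] <;> congr 1 <;>
      apply tup_ext <;> intro j <;> simp only [setx, toTup, mv] <;> have := j.2 <;> split_ifs <;>
      first | omega | (congr 1; omega) | (congr 2; omega)
  · have hl : i < n := by omega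
    have e : 2 * n + 1 - (i + 1) = 2 * n - i := by omega
    rw [if_neg hin, if_neg hin, dif_neg hin, if_pos hl, if_pos hl]
    simp only [xc_tup n i c (by omega), xbc_tup n i c (by omega), xc_tup n (i + 1) c (by omega), xbc_tup n (i + 1) c (by omega), e]
    simp only [Cry.op, fourC, Bool.false_eq_true, if_false, if_true]
    constructor <;> split_ifs <;> simp only [Option.map_some, Option.map_none] <;> congr 1 <;>
      apply tup_ext <;> intro j <;> simp only [setx, toTup, mv] <;> have := j.2 <;> split_ifs <;>
      first | omega | (congr 1; omega) | (congr 2; omega)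

lemma eC_aff (n l : ℕ) (hn : 2 ≤ n) (c : Row) (hc : RB n l c) :
    eC n l 0 (toTup n c) = ((affC n hn).op true c).map (toTup n) ∧ fC n l 0 (toTup n c) = ((affC n hn).op false c).map (toTup n) := by
  have hs : tsum (toTup n c) + 2 ≤ l ↔ 0 < min (c 0) (c (2 * n + 1)) := by
    have := tsum_tup n l c hc
    rw [← hc.1, min_self]; omega
  unfold eC fC
  have e : 2 * n + 1 - 1 = 2 * n := by omega
  have hl : 0 < n := by omega
  rw [if_pos rfl, if_pos rfl, if_pos hl, if_pos hl]
  simp only [xc_tup n 1 c (by omega), xbc_tup n 1 c (by omega), e]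
  simp only [hs, Cry.op, affC, Bool.false_eq_true, if_false, if_true]
  clear hs
  constructor <;> split_ifs <;> simp only [Option.map_some, Option.map_none] <;> congr 1 <;>
      apply tup_ext <;> rintro ⟨j, hj⟩ <;> simp only [setx, toTup, mv] <;> clear hc <;> grind


def gC (n : ℕ) (hn : 2 ≤ n) (i : ℕ) (hi : i ≤ n) : Cry Row := if i = 0 then affC n hn else rowC n i hi

lemma gC_e (n l : ℕ) (hn : 2 ≤ n) (i : ℕ) (hi : i ≤ n) (c : Row) (hc : RB n l c) :
    eC n l i (toTup n c) = ((gC n hn i hi).op true c).map (toTup n) ∧ fC n l i (toTup n c) = ((gC n hn i hi).op false c).map (toTup n) := by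
  unfold gC
  split_ifs with h
  · subst h; exact eC_aff n l hn c hc
  · exact eC_row n l i hi (by omega) c

lemma gC_RB (n l : ℕ) (hn : 2 ≤ n) (i : ℕ) (hi : i ≤ n) (b : Bool) (c c' : Row) (hc : RB n l c)
    (h : (gC n hn i hi).op b c = some c') : RB n l c' := by
  unfold gC at h
  split_ifs at h with h0
  · exact RB_aff n l hn b c c' hc h
  · exact RB_row n l i (by omega) hi b c c' hc h

lemma iter_st {X Y : Type} (C : Cry X) (R : X → Prop) (t : X → Y) (g : Y → Option Y) (b : Bool)
    (hR : ∀ u v, R u → C.op b u = some v → R v) (hg : ∀ u, R u → g (t u) = (C.op b u).map t) (m : ℕ) (u : X) (hu : R u) :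
    (fun o => Option.bind o g)^[m] (some (t u)) = (C.st b m u).map t := by
  induction m generalizing u with
  | zero => rfl
  | succ m ih =>
    rw [Function.iterate_succ_apply, Cry.st]
    show (fun o => Option.bind o g)^[m] (g (t u)) = _
    rw [hg u hu]
    cases h : C.op b u with
    | none =>
      clear ih h
      simp only [Option.map_none, Option.bind_none]
      induction m with
      | zero => rfl
      | succ m ih => rw [Function.iterate_succ_apply]; exact ih
    | some v => exact ih v (hR u v hu h)

lemma sSup_le_iff_eq (S : Set ℕ) (a : ℕ) (h : ∀ m, m ∈ S ↔ m ≤ a) : sSup S = a := by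
  have : S = Set.Iic a := by ext m; exact h m
  rw [this, csSup_Iic]

lemma eps_g (n l : ℕ) (hn : 2 ≤ n) (i : ℕ) (hi : i ≤ n) (c : Row) (hc : RB n l c) :
    epsC n l i (toTup n c) = (gC n hn i hi).ep c := by
  apply sSup_le_iff_eq
  intro m
  rw [Set.mem_setOf_eq, ← st_ex]
  unfold eCIter
  rw [iter_st (gC n hn i hi) (RB n l) (toTup n) (eC n l i) true (gC_RB n l hn i hi true) (fun c h => (gC_e n l hn i hi c h).1) m c hc]
  cases (gC n hn i hi).st true m c <;> simp

lemma phi_g (n l : ℕ) (hn : 2 ≤ n) (i : ℕ) (hi : i ≤ n) (c : Row) (hc : RB n l c) :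
    phiC n l i (toTup n c) = (gC n hn i hi).ph c := by
  apply sSup_le_iff_eq
  intro m
  rw [Set.mem_setOf_eq, ← st_exf]
  unfold fCIter
  rw [iter_st (gC n hn i hi) (RB n l) (toTup n) (fC n l i) false (gC_RB n l hn i hi false) (fun c h => (gC_e n l hn i hi c h).2) m c hc]
  cases (gC n hn i hi).st false m c <;> simp

def tt (n : ℕ) (u : Row × Row) : Tup n × Tup n := (toTup n u.1, toTup n u.2)
def rr (n l k : ℕ) (x : Tup n × Tup n) : Row × Row := (toRow n l x.1, toRow n k x.2)

def tenG (n : ℕ) (hn : 2 ≤ n) (i : ℕ) (hi : i ≤ n) : Cry (Row × Row) := ten (gC n hn i hi) (gC n hn i hi)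

lemma eTen_g (n l k : ℕ) (hn : 2 ≤ n) (i : ℕ) (hi : i ≤ n) (u : Row × Row) (hu : RR n l k u) :
    eTenC n l k i (tt n u) = ((tenG n hn i hi).op true u).map (tt n) := by
  unfold eTenC tt
  simp only [eps_g n k hn i hi u.2 hu.2, phi_g n l hn i hi u.1 hu.1, (gC_e n l hn i hi u.1 hu.1).1, (gC_e n k hn i hi u.2 hu.2).1]
  simp only [tenG, Cry.op, ten, tenE, if_true]
  split_ifs
  · cases (gC n hn i hi).e u.1 <;> rfl
  · cases (gC n hn i hi).e u.2 <;> rfl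

lemma fTen_g (n l k : ℕ) (hn : 2 ≤ n) (i : ℕ) (hi : i ≤ n) (u : Row × Row) (hu : RR n l k u) :
    fTenC n l k i (tt n u) = ((tenG n hn i hi).op false u).map (tt n) := by
  unfold fTenC tt
  simp only [eps_g n k hn i hi u.2 hu.2, phi_g n l hn i hi u.1 hu.1, (gC_e n l hn i hi u.1 hu.1).2, (gC_e n k hn i hi u.2 hu.2).2]
  simp only [tenG, Cry.op, ten, tenF, Bool.false_eq_true, if_false]
  split_ifs
  · cases (gC n hn i hi).f u.1 <;> rfl
  · cases (gC n hn i hi).f u.2 <;> rfl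

lemma RR_g (n l k : ℕ) (hn : 2 ≤ n) (i : ℕ) (hi : i ≤ n) (b : Bool) (u v : Row × Row) (hu : RR n l k u)
    (h : (tenG n hn i hi).op b u = some v) : RR n l k v := by
  rcases ten_op_cases _ _ _ _ _ h with ⟨a, e⟩ | ⟨e, a⟩
  · exact ⟨gC_RB n l hn i hi b _ _ hu.1 a, by rw [e]; exact hu.2⟩
  · exact ⟨by rw [e]; exact hu.1, gC_RB n k hn i hi b _ _ hu.2 a⟩

lemma rr_tt (n l k : ℕ) (u : Row × Row) (hu : RR n l k u) : rr n l k (tt n u) = u := by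
  unfold rr tt; simp only [row_tup n l u.1 hu.1, row_tup n k u.2 hu.2]
lemma tt_rr (n l k : ℕ) (x : Tup n × Tup n) : tt n (rr n l k x) = x := by
  unfold rr tt; simp only [tup_row]
lemma tt_mem (n l k : ℕ) (u : Row × Row) (hu : RR n l k u) : tt n u ∈ BC n l ×ˢ BC n k :=
  ⟨mem_tup n l _ hu.1, mem_tup n k _ hu.2⟩
lemma RR_rr (n l k : ℕ) (hn : 2 ≤ n) (x : Tup n × Tup n) (hx : x ∈ BC n l ×ˢ BC n k) : RR n l k (rr n l k x) :=
  ⟨RB_toRow n l hn _ hx.1, RB_toRow n k hn _ hx.2⟩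

def phR (n l k : ℕ) (ι : Tup n × Tup n → Tup n × Tup n) (u : Row × Row) : Row × Row := rr n k l (ι (tt n u))

lemma phR_mem (n l k : ℕ) (hn : 2 ≤ n) (ι : Tup n × Tup n → Tup n × Tup n) (hι : IsIsoC n l k ι) (u : Row × Row)
    (hu : RR n l k u) : RR n k l (phR n l k ι u) :=
  RR_rr n k l hn _ (hι.1.mapsTo (tt_mem n l k u hu))

lemma phR_op (n l k : ℕ) (hn : 2 ≤ n) (ι : Tup n × Tup n → Tup n × Tup n) (hι : IsIsoC n l k ι)
    (i : ℕ) (hi : i ≤ n) (b : Bool) (u : Row × Row) (hu : RR n l k u) :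
    (tenG n hn i hi).op b (phR n l k ι u) = ((tenG n hn i hi).op b u).map (phR n l k ι) := by
  have hφ := phR_mem n l k hn ι hι u hu
  have key : ((tenG n hn i hi).op b (phR n l k ι u)).map (tt n) = ((tenG n hn i hi).op b u).map (fun v => ι (tt n v)) := by
    have h := hι.2 (tt n u) (tt_mem n l k u hu) i hi
    have e : ι (tt n u) = tt n (phR n l k ι u) := (tt_rr n k l _).symm
    rw [e] at h
    cases b
    · rw [← fTen_g n k l hn i hi _ hφ, ← h.2, fTen_g n l k hn i hi _ hu, Option.map_map]; rfl
    · rw [← eTen_g n k l hn i hi _ hφ, ← h.1, eTen_g n l k hn i hi _ hu, Option.map_map]; rfl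
  have hm := RR_g n k l hn i hi b (phR n l k ι u)
  generalize (tenG n hn i hi).op b (phR n l k ι u) = A at key hm
  generalize (tenG n hn i hi).op b u = B at key
  cases A <;> cases B <;> simp only [Option.map_none, Option.map_some, reduceCtorEq, Option.some.injEq] at key ⊢
  rw [phR, ← key, rr_tt n k l _ (hm _ hφ rfl)]

lemma tenG_p (n : ℕ) (hn : 2 ≤ n) (i : ℕ) (hi : i ≤ n) (h : 1 ≤ i) : tenG n hn i hi = pC n i hi := by
  unfold tenG gC; rw [if_neg (by omega)]; rfl
lemma tenG_a (n : ℕ) (hn : 2 ≤ n) (hi : 0 ≤ n) : tenG n hn 0 hi = aC n hn := by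
  unfold tenG gC; rw [if_pos rfl]; rfl
lemma gC_a (n : ℕ) (hn : 2 ≤ n) (hi : 0 ≤ n) : gC n hn 0 hi = affC n hn := by
  unfold gC; rw [if_pos rfl]

lemma mkIH (n l k : ℕ) (hn : 2 ≤ n) (ι : Tup n × Tup n → Tup n × Tup n) (hι : IsIsoC n l k ι)
    (H : Tup n × Tup n → ℤ) (hH : IsEnergyC n l k ι H) : IH n l k hn (phR n l k ι) (fun u => H (tt n u)) where
  mem := phR_mem n l k hn ι hι
  cl i hi h b u hu := by rw [← tenG_p n hn i hi h]; exact phR_op n l k hn ι hι i hi b u hu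
  af b u hu := by rw [← tenG_a n hn (Nat.zero_le _)]; exact phR_op n l k hn ι hι 0 _ b u hu
  Hc i hi h u v hu e := by
    rw [← tenG_p n hn i hi h] at e
    have := hH.1 (tt n u) (tt_mem n l k u hu) i hi (tt n v) (by rw [eTen_g n l k hn i hi u hu, e]; rfl)
    rw [if_neg (by omega)] at this
    simpa using this
  Ha u v hu e := by
    have hi := Nat.zero_le n
    rw [← tenG_a n hn hi] at e
    have := hH.1 (tt n u) (tt_mem n l k u hu) 0 hi (tt n v) (by rw [eTen_g n l k hn 0 hi u hu, e]; rfl)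
    have hφ := phR_mem n l k hn ι hι u hu
    have e : ι (tt n u) = tt n (phR n l k ι u) := (tt_rr n k l _).symm
    rw [if_pos rfl, e] at this
    simp only [tt, eps_g n k hn 0 hi _ hu.2, phi_g n l hn 0 hi _ hu.1, eps_g n l hn 0 hi _ hφ.2, phi_g n k hn 0 hi _ hφ.1,
      gC_a] at this
    simp only [tt, this, dx, Nat.sub_eq_zero_iff_le, Nat.sub_pos_iff_lt]
  norm := by
    have e : tt n (mk n 0 l 2 0 0 0, mk n 0 0 2 k 0 0) = (uvec n l, u2vec n k) := by
      unfold tt toTup uvec u2vec mk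
      ext ⟨j, hj⟩ <;> simp only <;> grind
    simp only [e]
    exact hH.2



lemma seg_range (c : Row) (m : ℕ) : (seg c m).reverse = ((List.range m).map (fun i => List.replicate (c i) i)).flatten := by
  induction m with
  | zero => rfl
  | succ m ih => rw [seg, List.reverse_append, ih, List.range_succ]; simp

lemma foldr_flat (L : List (List ℕ)) : L.foldr (· ++ ·) [] = L.flatten := by
  induction L with
  | nil => rfl
  | cons a L ih => rw [List.foldr_cons, ih, List.flatten_cons]

lemma asc_core (n : ℕ) (c : Row) :
    asc n c = List.replicate (c 0) 0 ++ coreWord n (toTup n c) ++ List.replicate (c (2 * n + 1)) (2 * n + 1) := by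
  unfold asc rdw coreWord
  rw [seg_range, List.range_succ, List.range_succ_eq_map, two_mul, List.range_add, foldr_flat, foldr_flat]
  have e1 : (List.finRange n).map (fun i => List.replicate ((toTup n c).1 i) ((i : ℕ) + 1))
      = (List.range n).map (fun i => List.replicate (c (i + 1)) (i + 1)) :=
    List.ext_getElem (by simp) (by intro i h1 h2; simp [toTup])
  have e2 : (List.finRange n).reverse.map (fun i => List.replicate ((toTup n c).2 i) (bar n ((i : ℕ) + 1)))
      = (List.range n).map (fun i => List.replicate (c (n + i + 1)) (n + i + 1)) := by
    refine List.ext_getElem (by simp) ?_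
    intro i h1 h2
    simp only [List.length_map, List.length_range] at h2
    have a : 2 * n - (n - 1 - i) = n + i + 1 := by omega
    have b : 2 * n + 1 - (n - 1 - i + 1) = n + i + 1 := by omega
    simp [toTup, bar, a, b]
  rw [e1, e2]
  simp [Function.comp_def]

lemma tup_hat (n z : ℕ) (c : Row) : toTup n (hat n z c) = toTup n c := by
  unfold toTup
  congr 1 <;> funext j <;> have := j.2 <;> exact hat_eq n z _ c (by omega)

lemma hat0 (n z : ℕ) (c : Row) : hat n z c 0 = c 0 - z := rfl
lemma hatL (n z : ℕ) (c : Row) : hat n z c (2 * n + 1) = c (2 * n + 1) - z := by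
  unfold hat; rw [if_neg (by omega), if_pos rfl]

lemma hat_word (n l z : ℕ) (hn : 2 ≤ n) (b : Tup n) (hb : b ∈ BC n l) :
    hatWordC n l z b = asc n (hat n z (toRow n l b)) := by
  have h := RB_toRow n l hn b hb
  rw [asc_core, tup_hat, tup_row, hat0, hatL, ← h.1]
  rfl

lemma row_word (n l : ℕ) (hn : 2 ≤ n) (b : Tup n) (hb : b ∈ BC n l) :
    rowWordC n l b = asc n (toRow n l b) := by
  have h := RB_toRow n l hn b hb
  rw [asc_core, tup_row, ← h.1]
  rfl

lemma asc_hat (n l z : ℕ) (c : Row) (hc : RB n l c) (hz : z ≤ c 0) :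
    List.replicate z 0 ++ asc n (hat n z c) ++ List.replicate z (2 * n + 1) = asc n c := by
  have hz' : z ≤ c (2 * n + 1) := by rw [← hc.1]; exact hz
  rw [asc_core, asc_core, tup_hat, hat0, hatL]
  have e1 : List.replicate (c 0) 0 = List.replicate z 0 ++ List.replicate (c 0 - z) 0 := by
    rw [← List.replicate_add]; congr 1; omega
  have e2 : List.replicate (c (2 * n + 1)) (2 * n + 1) = List.replicate (c (2 * n + 1) - z) (2 * n + 1) ++ List.replicate z (2 * n + 1) := by
    rw [← List.replicate_add]; congr 1; omega
  rw [e1, e2]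
  simp only [List.append_assoc]

lemma seg_count (c : Row) (m j : ℕ) : (seg c m).count j = if j < m then c j else 0 := by
  induction m with
  | zero => simp [seg]
  | succ m ih =>
    rw [seg, List.count_append, ih, List.count_replicate]
    rcases lt_trichotomy j m with h | h | h
    · have a : j < m + 1 := by omega
      have b : ¬ m = j := by omega
      simp [h, a, b]
    · subst h; simp
    · have a : ¬ j < m + 1 := by omega
      have b : ¬ m = j := by omega
      have d : ¬ j < m := by omega
      simp [a, b, d]

lemma asc_inj (n l : ℕ) (c d : Row) (hc : RB n l c) (hd : RB n l d) (h : asc n c = asc n d) : c = d := by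
  funext j
  have h1 := congrArg (List.count j) h
  simp only [asc, rdw, List.count_reverse, seg_count] at h1
  by_cases hj : j < 2 * n + 2
  · rwa [if_pos hj, if_pos hj] at h1
  · rw [hc.2.1 j (by omega), hd.2.1 j (by omega)]

lemma seg_len (c : Row) (m : ℕ) : (seg c m).length = ∑ j ∈ Finset.range m, c j := by
  induction m with
  | zero => rfl
  | succ m ih => rw [seg, List.length_append, ih, Finset.sum_range_succ, List.length_replicate]; omega

lemma asc_len (n l z : ℕ) (c : Row) (hc : RB n l c) (hz : z ≤ c 0) : (asc n (hat n z c)).length = l - 2 * z := by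
  have h := congrArg List.length (asc_hat n l z c hc hz)
  have h2 : (asc n c).length = l := by
    unfold asc rdw; rw [List.length_reverse, seg_len, hc.2.2]
  rw [List.length_append, List.length_append, List.length_replicate, List.length_replicate, h2] at h
  omega

/-- **Theorem 3.1** (main theorem, `C_n^{(1)}` case).  Given `b₁ ⊗ b₂ ∈ B_l ⊗ B_k`, let
`b₂' ∈ B_k`, `b₁' ∈ B_l` and `l', k', m` be produced by Rule (C): remove
`z = min(x₀(b₁), x₀(b₂))` pairs `(0,0̄)` from the words of `b₁, b₂`, column-insert the second
word into the first obtaining the tableau `P` with second row of length `m`, reverse-bump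
`l' - m` letters from the first row and then `m` letters from the second row, obtaining the
ejected letters `ws = w_1 ⋯ w_{l'}` and the remaining one-row tableau; `b₁'` has word
`0^z ws 0̄^z` and `b₂'` has word `0^z T' 0̄^z`.  Then `ι(b₁ ⊗ b₂) = b₂' ⊗ b₁'` and
`H(b₁ ⊗ b₂) = min(l',k') - m`. -/
theorem main_theorem_C
    (n l k : ℕ) (hn : 2 ≤ n) (hl : 1 ≤ l) (hk : 1 ≤ k)
    (ι : Tup n × Tup n → Tup n × Tup n) (hι : IsIsoC n l k ι)
    (H : Tup n × Tup n → ℤ) (hH : IsEnergyC n l k ι H)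
    (b1 b2 : Tup n) (hb1 : b1 ∈ BC n l) (hb2 : b2 ∈ BC n k)
    (z l' k' m : ℕ)
    (hz : z = min (x0 l b1) (x0 k b2))
    (hl' : l' = l - 2 * z) (hk' : k' = k - 2 * z)
    (P : List (List ℕ))
    (hP : P = insertWord n (hatWordC n k z b2) (rowCols (hatWordC n l z b1)))
    (hm : m = numTwoCols P)
    (Q1 : List (List ℕ) × List ℕ) (hQ1 : Q1 = rbIter (rbFirst n) (l' - m) P)
    (Q2 : List (List ℕ) × List ℕ) (hQ2 : Q2 = rbIter (rbSecond n) m Q1.1)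
    (b1' b2' : Tup n) (hb1' : b1' ∈ BC n l) (hb2' : b2' ∈ BC n k)
    (hw1 : rowWordC n l b1' =
      List.replicate z 0 ++ (Q1.2 ++ Q2.2) ++ List.replicate z (bar n 0))
    (hw2 : rowWordC n k b2' =
      List.replicate z 0 ++ colsWord Q2.1 ++ List.replicate z (bar n 0)) :
    ι (b1, b2) = (b2', b1') ∧
    H (b1, b2) = ((min l' k' : ℕ) : ℤ) - (m : ℤ) := by
  obtain ⟨u, hu, e1, e2⟩ : ∃ u : Row × Row, RR n l k u ∧ u.1 = toRow n l b1 ∧ u.2 = toRow n k b2 :=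
    ⟨(toRow n l b1, toRow n k b2), ⟨RB_toRow n l hn b1 hb1, RB_toRow n k hn b2 hb2⟩, rfl, rfl⟩
  have htt : tt n u = (b1, b2) := by unfold tt; rw [e1, e2, tup_row, tup_row]
  have I := mkIH n l k hn ι hι H hH
  have hφ := phR_mem n l k hn ι hι u hu
  obtain ⟨m0, ⟨hr, ho⟩, hE, z1, z2⟩ := allC I _ u hu rfl
  have hz0 : min (u.1 0) (u.2 0) = z := by rw [e1, e2, hz]; rfl
  rw [hz0] at hr ho hE z1 z2
  have zu1 : z ≤ u.1 0 := by omega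
  have zu2 : z ≤ u.2 0 := by omega
  have W1 : hatWordC n l z b1 = asc n (hat n z u.1) := by rw [e1]; exact hat_word n l z hn b1 hb1
  have W2 : hatWordC n k z b2 = asc n (hat n z u.2) := by rw [e2]; exact hat_word n k z hn b2 hb2
  have L1 : (asc n (hat n z u.1)).length = l' := by rw [hl']; exact asc_len n l z _ hu.1 zu1
  have hmm : m = m0 := by rw [hm, hP, W1, W2]; exact hr.2.1
  subst hmm
  have key := run_out n m _ _ (asc n (hat n z (phR n l k ι u).2)) (asc n (hat n z (phR n l k ι u).1)) hr
    (by rw [asc_len n l z _ hφ.2 z2]; exact (asc_len n l z _ hu.1 zu1).symm)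
    (by rw [asc_len n k z _ hφ.1 z1]; exact (asc_len n k z _ hu.2 zu2).symm)
    (by rw [ho]; unfold wp asc hat2; rw [List.reverse_reverse, List.reverse_reverse])
  have HQ1 : QQ1 n m (asc n (hat2 n z u).1) (asc n (hat2 n z u).2) = Q1 := by
    rw [hQ1, hP, W1, W2, ← L1]; rfl
  have HQ2 : QQ2 n m (asc n (hat2 n z u).1) (asc n (hat2 n z u).2) = Q2 := by
    rw [hQ2, ← HQ1]; rfl
  rw [HQ2, HQ1] at key
  rw [key.2, row_word n l hn b1' hb1'] at hw1
  rw [key.1, row_word n k hn b2' hb2'] at hw2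
  have g1 := asc_inj n l _ _ (RB_toRow n l hn b1' hb1') hφ.2 (hw1.trans (asc_hat n l z _ hφ.2 z2))
  have g2 := asc_inj n k _ _ (RB_toRow n k hn b2' hb2') hφ.1 (hw2.trans (asc_hat n k z _ hφ.1 z1))
  have g3 : ι (tt n u) = tt n (phR n l k ι u) := (tt_rr n k l _).symm
  rw [htt] at g3
  constructor
  · rw [g3]; unfold tt; rw [← g1, ← g2, tup_row, tup_row]
  · rw [hl', hk', ← htt]; exact hE

end KTT
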